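/- If Σ_Γ is a subshift of finite type having an irreducible core and E ⊆ Σ_Γ is a nonempty clopen set, then the Thompson group V_{Γ,E} is finitely presented. -/

import Mathlib

open scoped Classical

noncomputable section

/-- A finite directed graph (loops and parallel edges are allowed). -/
structure FinDigraph : Type 1 where
  V : Type
  E : Type
  [fintypeV : Fintype V]
  [fintypeE : Fintype E]
  o : E → V
  t : E → V

attribute [instance] FinDigraph.fintypeV FinDigraph.fintypeE

instance (Γ : FinDigraph) : TopologicalSpace Γ.E := ⊥
instance (Γ : FinDigraph) : DiscreteTopology Γ.E := ⟨rfl⟩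

namespace FinDigraph

variable (Γ : FinDigraph)

/-- The subshift of finite type `Σ_Γ`: the set of all infinite directed paths in `Γ`,
viewed as a subset of the product space of all edge sequences (each edge's terminus is
the origin of the next edge). -/
def shift : Set (ℕ → Γ.E) := {x | ∀ i, Γ.t (x i) = Γ.o (x (i + 1))}

/-- Validity of a finite directed path starting at a given node. -/
def pathOk : Γ.V → List Γ.E → Prop
  | _, [] => True
  | v, e :: l => Γ.o e = v ∧ pathOk (Γ.t e) l

/-- A finite directed path in `Γ` (a node together with a compatible list of edges;
a path with no edges is a node, regarded as a path of length `0`). -/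
structure FinPath where
  start : Γ.V
  edges : List Γ.E
  ok : Γ.pathOk start edges

/-- Terminus of a list of edges starting at a given node. -/
def pathEndAux : Γ.V → List Γ.E → Γ.V
  | v, [] => v
  | _, e :: l => pathEndAux (Γ.t e) l

/-- The terminus `t(α)` of a finite directed path. -/
def pathEnd (α : Γ.FinPath) : Γ.V := Γ.pathEndAux α.start α.edges

/-- The length-0 path at a node `v`. -/
def trivPath (v : Γ.V) : Γ.FinPath := ⟨v, [], by simp [pathOk]⟩

/-- The cone `C_α ⊆ Σ_Γ` of all infinite directed paths having `α` as a prefix. -/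
def cone (α : Γ.FinPath) : Set (ℕ → Γ.E) :=
  {x | x ∈ Γ.shift ∧ Γ.o (x 0) = α.start ∧
    ∀ (i : ℕ) (h : i < α.edges.length), x i = α.edges.get ⟨i, h⟩}

/-- The canonical similarity `C_α → C_β` (for `t(α) = t(β)`) on the level of edge
sequences: delete the prefix `α` and attach the prefix `β`. -/
def splice (α β : Γ.FinPath) (x : ℕ → Γ.E) : ℕ → Γ.E := fun i =>
  if h : i < β.edges.length then β.edges.get ⟨i, h⟩
  else x (i - β.edges.length + α.edges.length)

/-- Concatenation `α · ω` of a finite path with an infinite path (on sequences). -/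
def catPath (α : Γ.FinPath) (x : ℕ → Γ.E) : ℕ → Γ.E :=
  Γ.splice (Γ.trivPath (Γ.pathEnd α)) α x

/-- The length of the path `f̄(α)`, i.e. of the greatest common prefix of all points
of `f(C_α)`. -/
def barLen (f : (ℕ → Γ.E) → ℕ → Γ.E) (α : Γ.FinPath) : ℕ :=
  sSup {n | ∀ x ∈ Γ.cone α, ∀ y ∈ Γ.cone α, ∀ i < n, f x i = f y i}

/-- The local action `f|_α : C_{t(α)} → C_{t(f̄(α))}`, determined by
`f(α·ω) = f̄(α)·(f|_α)(ω)`.  It is recorded together with the node `t(α)`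
(the node of its domain cone), and is extended by the identity off the cone
`C_{t(α)}`. -/
def localAction (f : (ℕ → Γ.E) → ℕ → Γ.E) (α : Γ.FinPath) :
    Γ.V × ((ℕ → Γ.E) → ℕ → Γ.E) :=
  (Γ.pathEnd α, fun w =>
    if w ∈ Γ.cone (Γ.trivPath (Γ.pathEnd α)) then
      fun i => f (Γ.catPath α w) (i + Γ.barLen f α)
    else w)

/-- A map is rational (on a domain `D`) if it has only finitely many distinct local
actions at cones contained in `D`. -/
def RationalOn (f : (ℕ → Γ.E) → ℕ → Γ.E) (D : Set (ℕ → Γ.E)) : Prop :=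
  (Γ.localAction f '' {α : Γ.FinPath | Γ.cone α ⊆ D}).Finite

/-- The nucleus `𝒩_f` of a map: the set of local actions `f|_α` that occur for
infinitely many finite paths `α` with `C_α` contained in the domain. -/
def nucleusOf (f : (ℕ → Γ.E) → ℕ → Γ.E) (D : Set (ℕ → Γ.E)) :
    Set (Γ.V × ((ℕ → Γ.E) → ℕ → Γ.E)) :=
  {p | {α : Γ.FinPath | Γ.cone α ⊆ D ∧ Γ.localAction f α = p}.Infinite}

/-- A nondegenerate map on `Σ_Γ` with domain `D`: it takes values in `Σ_Γ` and maps no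
cone contained in `D` to a single point. -/
def Nondegenerate (f : (ℕ → Γ.E) → ℕ → Γ.E) (D : Set (ℕ → Γ.E)) : Prop :=
  (∀ x ∈ D, f x ∈ Γ.shift) ∧
  ∀ α : Γ.FinPath, Γ.cone α ⊆ D → ¬∃ p, ∀ x ∈ Γ.cone α, f x = p

/-- Extension of a map `E → E'` between subsets of the sequence space to a globally
defined map (by the identity off `E`). -/
def homExt (E E' : Set (ℕ → Γ.E)) (f : ↥E → ↥E') : (ℕ → Γ.E) → ℕ → Γ.E :=
  fun x => if h : x ∈ E then ↑(f ⟨x, h⟩) else x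

/-- Extension of a permutation of `E` to a globally defined map. -/
def permExt (E : Set (ℕ → Γ.E)) (g : Equiv.Perm ↥E) : (ℕ → Γ.E) → ℕ → Γ.E :=
  Γ.homExt E E ⇑g

/-- `E` is a clopen subset of the subshift `Σ_Γ`. -/
def ClopenIn (E : Set (ℕ → Γ.E)) : Prop :=
  IsClopen {x : ↥Γ.shift | (x : ℕ → Γ.E) ∈ E}

/-- `U ⊆ Σ_Γ` is open in the subshift. -/
def OpenInShift (U : Set (ℕ → Γ.E)) : Prop :=
  IsOpen {x : ↥Γ.shift | (x : ℕ → Γ.E) ∈ U}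

/-- The subshift `Σ_Γ` has no isolated points. -/
def NoIsolatedPoints : Prop := ∀ x : ↥Γ.shift, ¬IsOpen ({x} : Set ↥Γ.shift)

/-- The subshift `Σ_Γ` has no empty cones. -/
def NoEmptyCones : Prop := ∀ α : Γ.FinPath, (Γ.cone α).Nonempty

/-- A permutation of `E` which is a homeomorphism and is a rational map:
an element of the rational group `R_{Γ,E}`. -/
def IsRatHomeo (E : Set (ℕ → Γ.E)) (g : Equiv.Perm ↥E) : Prop :=
  Continuous ⇑g ∧ Continuous ⇑g.symm ∧ Γ.RationalOn (Γ.permExt E g) E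

/-- `g` maps the cone `C_α` to the cone `C_β` by the canonical similarity
`α·ω ↦ β·ω`. -/
def RealizesCanonSim (E : Set (ℕ → Γ.E)) (g : Equiv.Perm ↥E) (α β : Γ.FinPath) : Prop :=
  ∀ x, ∀ hx : x ∈ E, x ∈ Γ.cone α → ↑(g ⟨x, hx⟩) = Γ.splice α β x

/-- A rational similarity group (RSG): a subgroup of the rational group `R_{Γ,E}` that
realizes the canonical similarity between any two cones `C_α, C_β ⊊ E` with
`t(α) = t(β)`. -/
def IsRSG (E : Set (ℕ → Γ.E)) (G : Subgroup (Equiv.Perm ↥E)) : Prop :=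
  (∀ g ∈ G, Γ.IsRatHomeo E g) ∧
  ∀ α β : Γ.FinPath, Γ.pathEnd α = Γ.pathEnd β → Γ.cone α ⊂ E → Γ.cone β ⊂ E →
    ∃ g ∈ G, Γ.RealizesCanonSim E g α β

/-- `h` locally agrees with the group `G`: every point has an open neighborhood on
which `h` coincides with some element of `G`. -/
def LocallyAgrees (E : Set (ℕ → Γ.E)) (G : Subgroup (Equiv.Perm ↥E))
    (h : Equiv.Perm ↥E) : Prop :=
  ∀ x : ↥E, ∃ U : Set ↥E, IsOpen U ∧ x ∈ U ∧ ∃ g ∈ G, ∀ u ∈ U, h u = g u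

/-- `G` is full as a group of homeomorphisms of `E`: every homeomorphism of `E` that
locally agrees with `G` already belongs to `G`. -/
def IsFullOn (E : Set (ℕ → Γ.E)) (G : Subgroup (Equiv.Perm ↥E)) : Prop :=
  ∀ h : Equiv.Perm ↥E, Continuous ⇑h → Continuous ⇑h.symm →
    Γ.LocallyAgrees E G h → h ∈ G

/-- The nucleus `𝒩_G` of a subgroup `G ≤ R_{Γ,E}`: the union of the nuclei of its
elements. -/
def groupNucleus (E : Set (ℕ → Γ.E)) (G : Subgroup (Equiv.Perm ↥E)) :
    Set (Γ.V × ((ℕ → Γ.E) → ℕ → Γ.E)) :=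
  ⋃ g ∈ G, Γ.nucleusOf (Γ.permExt E g) E

/-- An edge of the induced subgraph on a set `W` of nodes. -/
def InducedEdge (W : Set Γ.V) (e : Γ.E) : Prop := Γ.o e ∈ W ∧ Γ.t e ∈ W

/-- A path of the induced subgraph on `W`. -/
def PathIn (W : Set Γ.V) (α : Γ.FinPath) : Prop :=
  α.start ∈ W ∧ ∀ e ∈ α.edges, Γ.InducedEdge W e

/-- The induced subgraph on `W` is strongly connected and is not a directed cycle,
i.e. `Σ_{Γ₀}` is irreducible (where `Γ₀` is the induced subgraph on `W`). -/
def IrreducibleOn (W : Set Γ.V) : Prop :=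
  (∀ v ∈ W, ∀ w ∈ W, ∃ α : Γ.FinPath,
      α.start = v ∧ Γ.pathEnd α = w ∧ α.edges ≠ [] ∧ Γ.PathIn W α) ∧
  ¬∀ v ∈ W, ∃! e : Γ.E, Γ.InducedEdge W e ∧ Γ.o e = v

/-- `Σ_Γ` has an irreducible core: an induced subgraph `Γ₀` (on a node set `W`) with
`Σ_{Γ₀}` irreducible, such that every node has a directed path to `Γ₀` and every
sufficiently long directed path ends in `Γ₀`. -/
def HasIrreducibleCore : Prop :=
  ∃ W : Set Γ.V, Γ.IrreducibleOn W ∧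
    (∀ v : Γ.V, ∃ α : Γ.FinPath, α.start = v ∧ Γ.pathEnd α ∈ W) ∧
    ∃ N : ℕ, ∀ α : Γ.FinPath, α.edges.length = N → Γ.pathEnd α ∈ W

/-- `G ≤ R_{Γ,E}` is contracting: `Σ_Γ` has an irreducible core and the nucleus `𝒩_G`
is finite. -/
def IsContracting (E : Set (ℕ → Γ.E)) (G : Subgroup (Equiv.Perm ↥E)) : Prop :=
  Γ.HasIrreducibleCore ∧ (Γ.groupNucleus E G).Finite

/-- An element of the Thompson group `V_{Γ,E}`: there are partitions of `E` into cones
`C_{α_1},…,C_{α_k}` and `C_{β_1},…,C_{β_k}` with `t(α_i) = t(β_i)` such that `g` maps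
each `C_{α_i}` to `C_{β_i}` by the canonical similarity. -/
def IsThompson (E : Set (ℕ → Γ.E)) (g : Equiv.Perm ↥E) : Prop :=
  ∃ (k : ℕ) (α β : Fin k → Γ.FinPath),
    (∀ i, Γ.pathEnd (α i) = Γ.pathEnd (β i)) ∧
    E = (⋃ i, Γ.cone (α i)) ∧
    Pairwise (fun i j => Disjoint (Γ.cone (α i)) (Γ.cone (α j))) ∧
    E = (⋃ i, Γ.cone (β i)) ∧
    Pairwise (fun i j => Disjoint (Γ.cone (β i)) (Γ.cone (β j))) ∧
    ∀ i, Γ.RealizesCanonSim E g (α i) (β i)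

/-- A rational (eventually repeating) point `σ·τ^∞` of `Σ_Γ`. -/
def IsRationalPt (x : ℕ → Γ.E) : Prop :=
  ∃ σ τ : Γ.FinPath, τ.edges ≠ [] ∧
    (∀ (i : ℕ) (h : i < σ.edges.length), x i = σ.edges.get ⟨i, h⟩) ∧
    ∀ i : ℕ, σ.edges.length ≤ i →
      ∀ h : (i - σ.edges.length) % τ.edges.length < τ.edges.length,
        x i = τ.edges.get ⟨(i - σ.edges.length) % τ.edges.length, h⟩

/-- `β = f̄(α)`: the cone `C_β` is the smallest cone containing `f(C_α)`, with `β` the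
greatest common prefix of the points of `f(C_α)`. -/
def IsBar (f : (ℕ → Γ.E) → ℕ → Γ.E) (α β : Γ.FinPath) : Prop :=
  f '' Γ.cone α ⊆ Γ.cone β ∧
  ∀ γ : Γ.FinPath, f '' Γ.cone α ⊆ Γ.cone γ →
    Γ.cone β ⊆ Γ.cone γ ∧ γ.edges.length ≤ β.edges.length

end FinDigraph
/-- A group is finitely presented if it is the quotient of a finitely generated free
group by the normal closure of finitely many relators. -/
def FinitelyPresentedGroup (G : Type) [Group G] : Prop :=
  ∃ (n : ℕ) (φ : FreeGroup (Fin n) →* G), Function.Surjective φ ∧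
    ∃ R : Set (FreeGroup (Fin n)), R.Finite ∧ φ.ker = Subgroup.normalClosure R

/-! ### A criterion for finite presentability -/

/-- `R`-walks with exactly `k` steps. -/
def StepWalk {Ω : Type*} (R : Ω → Ω → Prop) : ℕ → Ω → Ω → Prop
  | 0, x, y => x = y
  | k + 1, x, y => ∃ z, StepWalk R k x z ∧ R z y

namespace StepWalk

variable {Ω : Type*} {R : Ω → Ω → Prop}

theorem mono (hrefl : ∀ x, R x x) {k l : ℕ} (h : k ≤ l) {x y : Ω} (w : StepWalk R k x y) :
    StepWalk R l x y := by
  induction l, h using Nat.le_induction with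
  | base => exact w
  | succ l _ ih => exact ⟨y, ih, hrefl y⟩

theorem trans {k l : ℕ} {x y z : Ω} (w : StepWalk R k x y) (w' : StepWalk R l y z) :
    StepWalk R (k + l) x z := by
  induction l generalizing z with
  | zero => cases w'; exact w
  | succ l ih => obtain ⟨u, hu, hr⟩ := w'; exact ⟨u, ih hu, hr⟩

theorem single {x y : Ω} (h : R x y) : StepWalk R 1 x y := ⟨x, rfl, h⟩

theorem symm (hsymm : ∀ x y, R x y → R y x) {k : ℕ} {x y : Ω} (w : StepWalk R k x y) :
    StepWalk R k y x := by
  induction k generalizing y with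
  | zero => exact Eq.symm w
  | succ k ih =>
    obtain ⟨z, hz, hr⟩ := w
    have := (single (hsymm _ _ hr)).trans (ih hz)
    rwa [add_comm] at this

theorem smul {G : Type*} [Group G] [MulAction G Ω]
    (hinv : ∀ (g : G) x y, R x y → R (g • x) (g • y)) (g : G) {k : ℕ} {x y : Ω}
    (w : StepWalk R k x y) : StepWalk R k (g • x) (g • y) := by
  induction k generalizing y with
  | zero => exact congrArg _ w
  | succ k ih => obtain ⟨z, hz, hr⟩ := w; exact ⟨_, ih hz, hinv _ _ _ hr⟩

theorem finite_ball (hfin : ∀ x, {y | R x y}.Finite) (k : ℕ) (x : Ω) :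
    {y | StepWalk R k x y}.Finite := by
  induction k with
  | zero => exact (Set.finite_singleton x).subset fun y hy => Eq.symm hy
  | succ k ih =>
    exact (ih.biUnion fun z _ => hfin z).subset fun y ⟨z, hz, hr⟩ => Set.mem_biUnion hz hr

theorem of_reflTransGen {x y : Ω} (h : Relation.ReflTransGen R x y) :
    ∃ k, StepWalk R k x y := by
  induction h with
  | refl => exact ⟨0, rfl⟩
  | tail _ hr ih => obtain ⟨k, hk⟩ := ih; exact ⟨k + 1, _, hk, hr⟩

end StepWalk

/-- A group is finitely presented as soon as its relations are detected on a finite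
generating set by words of bounded length. -/
theorem finitelyPresentedGroup_of_local {G : Type} [Group G] (B : Set G) (hB : B.Finite)
    (hgen : Subgroup.closure B = ⊤) (ℓ : ℕ)
    (hloc : ∀ (H : Type) [Group H] (f : G → H),
      (∀ l : List G, (∀ b ∈ l, b ∈ B) → l.length ≤ ℓ → l.prod = 1 → (l.map f).prod = 1) →
      ∃ p : G → H, ∀ g, ∀ b ∈ B, p (g * b) = p g * f b) :
    FinitelyPresentedGroup G := by
  obtain ⟨n, ⟨e⟩⟩ : ∃ n, Nonempty (Fin n ≃ B) := by
    have := hB.fintype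
    exact ⟨_, ⟨(Fintype.equivFin B).symm⟩⟩
  let φ : FreeGroup (Fin n) →* G := FreeGroup.lift fun i => (e i : G)
  let R : Set (FreeGroup (Fin n)) :=
    {w | w ∈ φ.ker ∧ ∃ l : List (Fin n × Bool), l.length ≤ ℓ ∧ w = FreeGroup.mk l}
  let N := Subgroup.normalClosure R
  let f : G → FreeGroup (Fin n) ⧸ N := fun g =>
    if h : g ∈ B then QuotientGroup.mk' N (FreeGroup.of (e.symm ⟨g, h⟩)) else 1
  refine ⟨n, φ, ?_, R, ?_, le_antisymm ?_ ?_⟩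
  · rw [← MonoidHom.range_eq_top, eq_top_iff, ← hgen, Subgroup.closure_le]
    intro b hb
    exact ⟨FreeGroup.of (e.symm ⟨b, hb⟩), by simp [φ]⟩
  · refine ((List.finite_length_le (Fin n × Bool) ℓ).image FreeGroup.mk).subset ?_
    rintro w ⟨-, l, hl, rfl⟩
    exact ⟨l, hl, rfl⟩
  · obtain ⟨p, hp⟩ := hloc _ f (by
      intro l hl hlen hprod
      have key : ∃ l' : List (Fin n × Bool), l'.length = l.length ∧
          φ (FreeGroup.mk l') = l.prod ∧
          QuotientGroup.mk' N (FreeGroup.mk l') = (l.map f).prod := by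
        clear hlen hprod
        induction l with
        | nil => exact ⟨[], rfl, map_one φ, map_one _⟩
        | cons b l ih =>
          obtain ⟨l', h1, h2, h3⟩ := ih fun x hx => hl x (List.mem_cons_of_mem _ hx)
          have hb : b ∈ B := hl b List.mem_cons_self
          have hmk : (FreeGroup.mk ((e.symm ⟨b, hb⟩, true) :: l') : FreeGroup (Fin n)) =
            FreeGroup.of (e.symm ⟨b, hb⟩) * FreeGroup.mk l' := rfl
          refine ⟨(e.symm ⟨b, hb⟩, true) :: l', by simp [h1], ?_, ?_⟩
          · rw [hmk, map_mul, h2]; simp [φ]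
          · rw [hmk, map_mul, h3, List.map_cons, List.prod_cons]
            congr 1
            simp only [f, dif_pos hb]
      obtain ⟨l', h1, h2, h3⟩ := key
      rw [← h3, QuotientGroup.mk'_apply, QuotientGroup.eq_one_iff]
      exact Subgroup.subset_normalClosure ⟨by rw [MonoidHom.mem_ker, h2, hprod], l',
        h1 ▸ hlen, rfl⟩)
    have hof : ∀ g i, p (g * φ (FreeGroup.of i)) =
        p g * QuotientGroup.mk' N (FreeGroup.of i) := by
      intro g i
      have := hp g (e i) (e i).2
      simpa [f, φ] using this
    have hall : ∀ w g, p (g * φ w) = p g * QuotientGroup.mk' N w := by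
      intro w
      induction w using FreeGroup.induction_on with
      | C1 => intro g; simp
      | of i => exact fun g => hof g i
      | inv_of i _ =>
        intro g
        have := hof (g * (φ (FreeGroup.of i))⁻¹) i
        rw [inv_mul_cancel_right] at this
        rw [map_inv, map_inv, this, mul_inv_cancel_right]
      | mul x y hx hy => intro g; rw [map_mul, ← mul_assoc, hy, hx, map_mul, mul_assoc]
    intro w hw
    have := hall w 1
    rw [MonoidHom.mem_ker.1 hw, mul_one, left_eq_mul, QuotientGroup.mk'_apply,
      QuotientGroup.eq_one_iff] at this
    exact this
  · exact Subgroup.normalClosure_le_normal fun w hw => hw.1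

/-- Let `G` act cocompactly, with a connected invariant locally finite adjacency relation `R`.
If every `H`-valued cocycle along `R` that is trivial on squares is a coboundary
(a form of simple connectivity), then `G` is finitely presented. -/
theorem finitelyPresentedGroup_of_action {G : Type} [Group G] {Ω : Type*} [MulAction G Ω]
    (R : Ω → Ω → Prop) (hrefl : ∀ x, R x x) (hsymm : ∀ x y, R x y → R y x)
    (hinv : ∀ (g : G) x y, R x y → R (g • x) (g • y)) (x₀ : Ω)
    (hball : ∀ x, {y | R x y}.Finite) (hstab : ∀ x y : Ω, {g : G | g • x = y}.Finite)
    (hrep : ∃ T : Set Ω, T.Finite ∧ ∀ x, ∃ g : G, ∃ t ∈ T, x = g • t)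
    (hconn : ∀ x y, Relation.ReflTransGen R x y)
    (hflat : ∀ (H : Type) [Group H] (c : Ω → Ω → H), (∀ x, c x x = 1) →
      (∀ x y z w, R x y → R y z → R x w → R w z → c x y * c y z = c x w * c w z) →
      ∃ p : Ω → H, ∀ x y, R x y → c x y = (p x)⁻¹ * p y) :
    FinitelyPresentedGroup G := by
  obtain ⟨d, hd⟩ : ∃ d, ∀ x, ∃ g : G, StepWalk R d x (g • x₀) := by
    obtain ⟨T, hT, hTx⟩ := hrep
    obtain ⟨d, hd⟩ : ∃ d, ∀ t ∈ T, StepWalk R d t x₀ := by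
      choose k hk using fun t => StepWalk.of_reflTransGen (hconn t x₀)
      obtain ⟨d, hd⟩ := (hT.image k).bddAbove
      exact ⟨d, fun t ht => (hk t).mono hrefl (hd ⟨t, ht, rfl⟩)⟩
    refine ⟨d, fun x => ?_⟩
    obtain ⟨g, t, ht, rfl⟩ := hTx x
    exact ⟨g, (hd t ht).smul hinv g⟩
  choose γ hγ using hd
  set s := 2 * d + 1 with hs
  let B : Set G := {b | StepWalk R s x₀ (b • x₀)}
  have memB : ∀ {g h : G} {k : ℕ}, k ≤ s → StepWalk R k (g • x₀) (h • x₀) → g⁻¹ * h ∈ B := by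
    intro g h k hk hw
    have := (hw.mono hrefl hk).smul hinv g⁻¹
    rwa [inv_smul_smul, smul_smul] at this
  have hγB : ∀ {x y}, R x y → (γ x)⁻¹ * γ y ∈ B := by
    intro x y hxy
    refine memB (k := s) le_rfl ?_
    have := (((hγ x).symm hsymm).trans (StepWalk.single hxy)).trans (hγ y)
    exact this.mono hrefl (by omega)
  have hγ1 : ∀ g, (γ (g • x₀))⁻¹ * g ∈ B := fun g =>
    memB (k := d) (by omega) ((hγ _).symm hsymm)
  have hBinv : ∀ b ∈ B, b⁻¹ ∈ B := by
    intro b hb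
    have := memB (g := b) (h := 1) le_rfl (by simpa using StepWalk.symm hsymm hb)
    simpa using this
  have hBfin : B.Finite :=
    ((StepWalk.finite_ball hball s x₀).biUnion fun y _ => hstab x₀ y).subset
      fun b hb => Set.mem_biUnion (x := b • x₀) hb rfl
  have hgen : Subgroup.closure B = ⊤ := by
    rw [eq_top_iff]
    intro g _
    have h1 : ∀ y, Relation.ReflTransGen R x₀ y → (γ x₀)⁻¹ * γ y ∈ Subgroup.closure B := by
      intro y h
      induction h with
      | refl => simp
      | tail _ hr ih =>
        have := mul_mem ih (Subgroup.subset_closure (hγB hr))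
        simpa [mul_assoc] using this
    have h2 : γ x₀ ∈ Subgroup.closure B := by
      have := Subgroup.subset_closure (hBinv _ (hγ1 1))
      simpa using this
    have h3 := mul_mem (mul_mem h2 (h1 _ (hconn x₀ (g • x₀)))) (Subgroup.subset_closure (hγ1 g))
    simpa [mul_assoc] using h3
  refine finitelyPresentedGroup_of_local B hBfin hgen (s + 4) fun H _ f hf => ?_
  have hone : f 1 = 1 := by
    have := hf [1] (by simpa [B] using (StepWalk.mono hrefl (Nat.zero_le s) rfl :
      StepWalk R s x₀ x₀)) (by simp) (by simp)
    simpa using this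
  have hfinv : ∀ b ∈ B, f b⁻¹ = (f b)⁻¹ := by
    intro b hb
    have := hf [b, b⁻¹] (by simp [hb, hBinv b hb]) (by simp) (by simp)
    exact eq_inv_of_mul_eq_one_right (by simpa using this)
  obtain ⟨p, hp⟩ := hflat H (fun x y => f ((γ x)⁻¹ * γ y)) (by simp [hone]) (by
    intro x y z w hxy hyz hxw hwz
    have := hf [(γ x)⁻¹ * γ y, (γ y)⁻¹ * γ z, ((γ w)⁻¹ * γ z)⁻¹, ((γ x)⁻¹ * γ w)⁻¹]
      (by simp only [List.mem_cons, List.not_mem_nil, or_false]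
          rintro b (rfl | rfl | rfl | rfl)
          exacts [hγB hxy, hγB hyz, hBinv _ (hγB hwz), hBinv _ (hγB hxw)])
      (by simp) (by simp [mul_assoc])
    simp only [List.map_cons, List.map_nil, List.prod_cons, List.prod_nil, mul_one] at this
    rw [hfinv _ (hγB hwz), hfinv _ (hγB hxw), ← mul_assoc, ← mul_inv_rev] at this
    exact mul_inv_eq_one.1 this)
  have hwalk : ∀ k x y, StepWalk R k x y → ∃ l : List G, (∀ b ∈ l, b ∈ B) ∧ l.length = k ∧
      l.prod = (γ x)⁻¹ * γ y ∧ (l.map f).prod = (p x)⁻¹ * p y := by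
    intro k x
    induction k with
    | zero => rintro y rfl; exact ⟨[], by simp⟩
    | succ k ih =>
      rintro y ⟨z, hz, hr⟩
      obtain ⟨l, h1, h2, h3, h4⟩ := ih z hz
      refine ⟨l ++ [(γ z)⁻¹ * γ y], ?_, by simp [h2], ?_, ?_⟩
      · simp only [List.mem_append, List.mem_singleton]
        rintro b (hb | rfl)
        exacts [h1 b hb, hγB hr]
      · simp [h3, mul_assoc]
      · simp [h4, hp z y hr, mul_assoc]
  refine ⟨fun g => p (g • x₀) * f ((γ (g • x₀))⁻¹ * g), fun g b hb => ?_⟩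
  have hgb : StepWalk R s (g • x₀) ((g * b) • x₀) := by
    rw [mul_smul]; exact StepWalk.smul hinv g hb
  obtain ⟨l, h1, h2, h3, h4⟩ := hwalk _ _ _ hgb
  have := hf ([((γ (g • x₀))⁻¹ * g)⁻¹] ++ l ++ [(γ ((g * b) • x₀))⁻¹ * (g * b), b⁻¹])
    (by simp only [List.mem_append, List.mem_cons, List.not_mem_nil, or_false]
        rintro c ((rfl | hc) | rfl | rfl)
        exacts [hBinv _ (hγ1 g), h1 c hc, hγ1 _, hBinv _ hb])
    (by simp [h2]) (by simp [h3, mul_assoc])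
  simp only [List.map_append, List.map_cons, List.map_nil, List.prod_append, List.prod_cons,
    List.prod_nil, mul_one, h4, hfinv _ (hγ1 g), hfinv _ hb] at this
  rw [← mul_assoc, mul_inv_eq_one] at this
  rw [← this]
  simp [mul_assoc]

/-- A family `X` of finite sets together with local replacement moves `A ⇝ A'` of bounded
size, which can be applied to any member of `X` containing `A`. -/
structure MoveSystem (Ch : Type*) where
  X : Set (Finset Ch)
  M : Finset Ch → Finset Ch → Prop
  κ : ℕ
  symm : ∀ {A A'}, M A A' → M A' A
  card_le : ∀ {A A'}, M A A' → A.card ≤ κ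
  mem : ∀ {P A A'}, P ∈ X → A ⊆ P → M A A' → (P \ A) ∪ A' ∈ X
  disj : ∀ {P A A'}, P ∈ X → A ⊆ P → M A A' → Disjoint (P \ A) A'
  nil : M ∅ ∅

namespace MoveSystem

variable {Ch : Type*} (S : MoveSystem Ch)

/-- `P` and `Q` differ by one move which leaves all elements of `J` untouched. -/
def RJ (J P Q : Finset Ch) : Prop :=
  ∃ I A A', S.M A A' ∧ J ⊆ I ∧ P = I ∪ A ∧ Q = I ∪ A' ∧ Disjoint I A ∧ Disjoint I A'

/-- Two members of `X` are adjacent if they differ by one move. -/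
def R (P Q : Finset Ch) : Prop := P ∈ S.X ∧ Q ∈ S.X ∧ S.RJ ∅ P Q

/-- Replace `A` by `A'` in `P`. -/
def tr (A A' P : Finset Ch) : Finset Ch := (P \ A) ∪ A'

variable {S}

lemma RJ.symm {J P Q : Finset Ch} (h : S.RJ J P Q) : S.RJ J Q P := by
  obtain ⟨I, A, A', h, h1, h2, h3, h4, h5⟩ := h
  exact ⟨I, A', A, S.symm h, h1, h3, h2, h5, h4⟩

lemma RJ.mono {J J' P Q : Finset Ch} (h : S.RJ J P Q) (hJ : J' ⊆ J) : S.RJ J' P Q := by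
  obtain ⟨I, A, A', h, h1, h2⟩ := h
  exact ⟨I, A, A', h, hJ.trans h1, h2⟩

lemma RJ.left {J P Q : Finset Ch} (h : S.RJ J P Q) : J ⊆ P := by
  obtain ⟨I, A, A', h, h1, rfl, h2⟩ := h
  exact h1.trans Finset.subset_union_left

lemma RJ.right {J P Q : Finset Ch} (h : S.RJ J P Q) : J ⊆ Q := h.symm.left

lemma RJ.rfl {P : Finset Ch} : S.RJ P P P :=
  ⟨P, ∅, ∅, S.nil, Finset.Subset.refl _, by simp, by simp, by simp, by simp⟩

lemma RJ.R {J P Q : Finset Ch} (h : S.RJ J P Q) (hP : P ∈ S.X) (hQ : Q ∈ S.X) : S.R P Q :=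
  ⟨hP, hQ, h.mono (Finset.empty_subset _)⟩

lemma R.symm {P Q : Finset Ch} (h : S.R P Q) : S.R Q P := ⟨h.2.1, h.1, h.2.2.symm⟩

lemma R.refl {P : Finset Ch} (h : P ∈ S.X) : S.R P P := RJ.rfl.R h h

lemma R.exists_inert {P Q : Finset Ch} (h : S.R P Q) :
    ∃ J, (P \ J).card ≤ S.κ ∧ (Q \ J).card ≤ S.κ ∧ S.RJ J P Q := by
  obtain ⟨-, -, I, A, A', hM, -, rfl, rfl, h1, h2⟩ := h
  refine ⟨I, ?_, ?_, I, A, A', hM, Finset.Subset.refl _, rfl, rfl, h1, h2⟩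
  · refine le_trans (Finset.card_le_card ?_) (S.card_le hM)
    intro; simp; tauto
  · refine le_trans (Finset.card_le_card ?_) (S.card_le (S.symm hM))
    intro; simp; tauto

lemma R.card_le {P Q : Finset Ch} (h : S.R P Q) : Q.card ≤ P.card + S.κ := by
  obtain ⟨J, h1, h2, h3⟩ := h.exists_inert
  have := Finset.card_sdiff_add_card_eq_card h3.right
  have := Finset.card_le_card h3.left
  omega

lemma tr_mem {P A A' : Finset Ch} (hP : P ∈ S.X) (hA : A ⊆ P) (hM : S.M A A') :
    tr A A' P ∈ S.X := S.mem hP hA hM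

lemma RJ_tr {P A A' : Finset Ch} (hP : P ∈ S.X) (hA : A ⊆ P) (hM : S.M A A') :
    S.RJ (P \ A) P (tr A A' P) :=
  ⟨P \ A, A, A', hM, Finset.Subset.refl _, (Finset.sdiff_union_of_subset hA).symm, _root_.rfl,
    Finset.sdiff_disjoint, S.disj hP hA hM⟩

lemma RJ.tr {J P Q A A' : Finset Ch} (h : S.RJ J P Q) (hP : P ∈ S.X) (hQ : Q ∈ S.X)
    (hA : A ⊆ J) (hM : S.M A A') : S.RJ (J \ A) (tr A A' P) (tr A A' Q) := by
  have d1 := S.disj hP (hA.trans h.left) hM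
  have d2 := S.disj hQ (hA.trans h.right) hM
  obtain ⟨I, B, B', hB, hJ, rfl, rfl, h1, h2⟩ := h
  have hAI := hA.trans hJ
  refine ⟨(I \ A) ∪ A', B, B', hB, ?_, ?_, ?_, ?_, ?_⟩ <;>
    simp only [Finset.disjoint_left, Finset.subset_iff, Finset.ext_iff, MoveSystem.tr,
      Finset.mem_union, Finset.mem_sdiff] at * <;> grind

lemma tr_card {P A A' : Finset Ch} (hA : A ⊆ P) (hlt : A'.card < A.card) :
    (tr A A' P).card < P.card := by
  have := Finset.card_sdiff_add_card_eq_card hA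
  have := Finset.card_union_le (P \ A) A'
  unfold tr; omega

lemma tr_comm {P A A' B B' : Finset Ch} (hP : P ∈ S.X) (hA : A ⊆ P) (hM : S.M A A')
    (hB : B ⊆ P) (hM' : S.M B B') (hAB : Disjoint A B) :
    tr A A' (tr B B' P) = tr B B' (tr A A' P) := by
  have d1 := S.disj hP hA hM
  have d2 := S.disj hP hB hM'
  simp only [Finset.disjoint_left, Finset.subset_iff, Finset.ext_iff, MoveSystem.tr,
      Finset.mem_union, Finset.mem_sdiff] at *
  grind

lemma subset_tr {P A A' J : Finset Ch} (hJ : J ⊆ P) : J \ A ⊆ tr A A' P := by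
  intro x; simp [tr]; intro h1 h2; exact Or.inl ⟨hJ h1, h2⟩

variable (S) in
/-- Every large member of `X` admits cardinality-decreasing moves avoiding any prescribed
set of `K` elements. -/
def HasDescents (K n₀ : ℕ) : Prop :=
  ∀ P ∈ S.X, n₀ ≤ P.card → ∀ J ⊆ P, (P \ J).card ≤ K →
    ∃ A A', S.M A A' ∧ A ⊆ J ∧ A'.card < A.card

variable (S) in
/-- A cocycle on the members of `X` of cardinality at most `m` which is trivial on the
diagonal and on squares. -/
def Flat {H : Type*} [Group H] (m : ℕ) (c : Finset Ch → Finset Ch → H) : Prop :=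
  (∀ x ∈ S.X, x.card ≤ m → c x x = 1) ∧
  ∀ x y z w, x.card ≤ m → y.card ≤ m → z.card ≤ m → w.card ≤ m →
    S.R x y → S.R y z → S.R x w → S.R w z → c x y * c y z = c x w * c w z

variable {H : Type*} [Group H] {m : ℕ} {c : Finset Ch → Finset Ch → H}

lemma Flat.inv (hc : S.Flat m c) {x y : Finset Ch} (h : S.R x y) (hx : x.card ≤ m)
    (hy : y.card ≤ m) : c y x = (c x y)⁻¹ := by
  have := hc.2 x y x x hx hy hx hx h h.symm (R.refl h.1) (R.refl h.1)
  rw [hc.1 x h.1 hx, one_mul] at this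
  exact eq_inv_of_mul_eq_one_right this

variable (S m) in
/-- A chosen neighbour of smaller cardinality for members of cardinality above `m`. -/
def desc (P : Finset Ch) : Finset Ch :=
  if P.card ≤ m then P
  else if h : ∃ A A', S.M A A' ∧ A ⊆ P ∧ A'.card < A.card then
    tr h.choose h.choose_spec.choose P
  else P

lemma desc_of_le {P : Finset Ch} (h : P.card ≤ m) : S.desc m P = P := by simp [desc, h]

lemma desc_spec {K n₀ : ℕ} (hD : S.HasDescents K n₀) (hm : n₀ ≤ m) {P : Finset Ch}
    (hP : P ∈ S.X) (hPm : P.card ≤ m + 1) :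
    S.desc m P ∈ S.X ∧ (S.desc m P).card ≤ m ∧
      ∃ J, (P \ J).card ≤ S.κ ∧ S.RJ J P (S.desc m P) := by
  by_cases h : P.card ≤ m
  · rw [desc_of_le h]
    exact ⟨hP, h, P, by simp, RJ.rfl⟩
  · have h' : ∃ A A', S.M A A' ∧ A ⊆ P ∧ A'.card < A.card :=
      hD P hP (by omega) P (Finset.Subset.refl _) (by simp)
    have e : S.desc m P = tr h'.choose h'.choose_spec.choose P := by simp [desc, h, h']
    obtain ⟨h1, h2, h3⟩ := h'.choose_spec.choose_spec
    rw [e]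
    refine ⟨tr_mem hP h2 h1, ?_, P \ h'.choose, ?_, RJ_tr hP h2 h1⟩
    · have := tr_card h2 h3; omega
    · rw [Finset.sdiff_sdiff_eq_self h2]; exact S.card_le h1

variable (S m) in
/-- `J` is inert for the edge `P - Q` and for the chosen descents of `P` and `Q`. -/
def Inert (J P Q : Finset Ch) : Prop :=
  S.RJ J P (S.desc m P) ∧ S.RJ J P Q ∧ S.RJ J Q (S.desc m Q)

variable (m c S) in
/-- The potential of `P` relative to the translated copy of `P` under a descent. -/
def lift (A A' P : Finset Ch) : H :=
  c (tr A A' P) (tr A A' (S.desc m P)) * c (tr A A' (S.desc m P)) (S.desc m P)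

variable (m c S) in
/-- The value on the edge `P - Q` obtained by pushing it down along a descent. -/
def hol (A A' P Q : Finset Ch) : H :=
  (S.lift m c A A' P)⁻¹ * c (tr A A' P) (tr A A' Q) * S.lift m c A A' Q

lemma lift_eq (hc : S.Flat m c) {J P A A' B B' : Finset Ch} (hJ : S.RJ J P (S.desc m P))
    (hP : P ∈ S.X) (hPm : P.card ≤ m + 1) (hd : S.desc m P ∈ S.X) (hdm : (S.desc m P).card ≤ m)
    (hA : A ⊆ J) (hM : S.M A A') (hlt : A'.card < A.card)
    (hB : B ⊆ J) (hM' : S.M B B') (hlt' : B'.card < B.card) (hAB : Disjoint A B) :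
    S.lift m c A A' P =
      c (tr A A' P) (tr B B' (tr A A' P)) * c (tr B B' (tr A A' P)) (tr B B' P) *
        S.lift m c B B' P := by
  set d := S.desc m P with hdd
  have hBA : B ⊆ J \ A := fun x hx => by
    simp [hB hx]; exact fun h => Finset.disjoint_left.1 hAB h hx
  have hAP := hA.trans hJ.left
  have hBP := hB.trans hJ.left
  have hAd := hA.trans hJ.right
  have hBd := hB.trans hJ.right
  have mPA := tr_mem hP hAP hM
  have mPB := tr_mem hP hBP hM'
  have mdA := tr_mem hd hAd hM
  have mdB := tr_mem hd hBd hM'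
  have hBPA : B ⊆ tr A A' P := hBA.trans (subset_tr hJ.left)
  have hBdA : B ⊆ tr A A' d := hBA.trans (subset_tr hJ.right)
  have mPAB := tr_mem mPA hBPA hM'
  have mdAB := tr_mem mdA hBdA hM'
  have cPA := tr_card hAP hlt
  have cPB := tr_card hBP hlt'
  have cdA := tr_card hAd hlt
  have cdB := tr_card hBd hlt'
  have cPAB := tr_card hBPA hlt'
  have cdAB := tr_card hBdA hlt'
  have eP := tr_comm hP hAP hM hBP hM' hAB
  have ed := tr_comm hd hAd hM hBd hM' hAB
  have hAB' : A ⊆ J \ B := fun x hx => by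
    simp [hA hx]; exact fun h => Finset.disjoint_left.1 hAB hx h
  have rA := hJ.tr hP hd hA hM
  have rB := hJ.tr hP hd hB hM'
  have rAB := rA.tr mPA mdA hBA hM'
  have s1 : c (tr A A' P) (tr A A' d) * c (tr A A' d) (tr B B' (tr A A' d)) =
      c (tr A A' P) (tr B B' (tr A A' P)) * c (tr B B' (tr A A' P)) (tr B B' (tr A A' d)) :=
    hc.2 _ _ _ _ (by omega) (by omega) (by omega) (by omega) (rA.R mPA mdA)
      ((RJ_tr mdA hBdA hM').R mdA mdAB) ((RJ_tr mPA hBPA hM').R mPA mPAB) (rAB.R mPAB mdAB)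
  have tB : S.RJ (tr B B' P \ A) (tr B B' P) (tr B B' (tr A A' P)) := by
    rw [← eP]; exact RJ_tr mPB (hAB'.trans (subset_tr hJ.left)) hM
  have tB' : S.RJ (tr B B' d \ A) (tr B B' d) (tr B B' (tr A A' d)) := by
    rw [← ed]; exact RJ_tr mdB (hAB'.trans (subset_tr hJ.right)) hM
  have s2 : c (tr B B' (tr A A' P)) (tr B B' (tr A A' d)) * c (tr B B' (tr A A' d)) (tr B B' d) =
      c (tr B B' (tr A A' P)) (tr B B' P) * c (tr B B' P) (tr B B' d) :=
    hc.2 _ _ _ _ (by omega) (by omega) (by omega) (by omega) (rAB.R mPAB mdAB)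
      (tB'.symm.R mdAB mdB) (tB.symm.R mPAB mPB) (rB.R mPB mdB)
  have s3 : c (tr A A' d) (tr B B' (tr A A' d)) * c (tr B B' (tr A A' d)) (tr B B' d) =
      c (tr A A' d) d * c d (tr B B' d) :=
    hc.2 _ _ _ _ (by omega) (by omega) (by omega) (by omega) ((RJ_tr mdA hBdA hM').R mdA mdAB)
      (tB'.symm.R mdAB mdB) ((RJ_tr hd hAd hM).symm.R mdA hd) ((RJ_tr hd hBd hM').R hd mdB)
  have i1 := hc.inv ((RJ_tr hd hBd hM').R hd mdB) (by omega) (by omega)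
  simp only [lift, ← hdd]
  rw [i1]
  have h3 : c (tr A A' d) d = c (tr A A' d) (tr B B' (tr A A' d)) *
      c (tr B B' (tr A A' d)) (tr B B' d) * (c d (tr B B' d))⁻¹ := by rw [s3]; group
  rw [h3]
  calc _ = (c (tr A A' P) (tr A A' d) * c (tr A A' d) (tr B B' (tr A A' d))) *
      c (tr B B' (tr A A' d)) (tr B B' d) * (c d (tr B B' d))⁻¹ := by group
    _ = c (tr A A' P) (tr B B' (tr A A' P)) * (c (tr B B' (tr A A' P)) (tr B B' (tr A A' d)) *
      c (tr B B' (tr A A' d)) (tr B B' d)) * (c d (tr B B' d))⁻¹ := by rw [s1]; group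
    _ = _ := by rw [s2]; group

lemma edge_eq (hc : S.Flat m c) {J P Q A A' B B' : Finset Ch} (hJ : S.RJ J P Q)
    (hP : P ∈ S.X) (hPm : P.card ≤ m + 1) (hQ : Q ∈ S.X) (hQm : Q.card ≤ m + 1)
    (hA : A ⊆ J) (hM : S.M A A') (hlt : A'.card < A.card)
    (hB : B ⊆ J) (hM' : S.M B B') (hlt' : B'.card < B.card) (hAB : Disjoint A B) :
    c (tr A A' P) (tr A A' Q) *
      (c (tr A A' Q) (tr B B' (tr A A' Q)) * c (tr B B' (tr A A' Q)) (tr B B' Q)) =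
      (c (tr A A' P) (tr B B' (tr A A' P)) * c (tr B B' (tr A A' P)) (tr B B' P)) *
        c (tr B B' P) (tr B B' Q) := by
  have hBA : B ⊆ J \ A := fun x hx => by
    simp [hB hx]; exact fun h => Finset.disjoint_left.1 hAB h hx
  have hAP := hA.trans hJ.left
  have hBP := hB.trans hJ.left
  have hAd := hA.trans hJ.right
  have hBd := hB.trans hJ.right
  have mPA := tr_mem hP hAP hM
  have mPB := tr_mem hP hBP hM'
  have mdA := tr_mem hQ hAd hM
  have mdB := tr_mem hQ hBd hM'
  have hBPA : B ⊆ tr A A' P := hBA.trans (subset_tr hJ.left)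
  have hBdA : B ⊆ tr A A' Q := hBA.trans (subset_tr hJ.right)
  have mPAB := tr_mem mPA hBPA hM'
  have mdAB := tr_mem mdA hBdA hM'
  have cPA := tr_card hAP hlt
  have cPB := tr_card hBP hlt'
  have cdA := tr_card hAd hlt
  have cdB := tr_card hBd hlt'
  have cPAB := tr_card hBPA hlt'
  have cdAB := tr_card hBdA hlt'
  have eP := tr_comm hP hAP hM hBP hM' hAB
  have ed := tr_comm hQ hAd hM hBd hM' hAB
  have hAB' : A ⊆ J \ B := fun x hx => by
    simp [hA hx]; exact fun h => Finset.disjoint_left.1 hAB hx h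
  have rA := hJ.tr hP hQ hA hM
  have rB := hJ.tr hP hQ hB hM'
  have rAB := rA.tr mPA mdA hBA hM'
  have s1 := hc.2 _ _ _ _ (by omega) (by omega) (by omega) (by omega) (rA.R mPA mdA)
      ((RJ_tr mdA hBdA hM').R mdA mdAB) ((RJ_tr mPA hBPA hM').R mPA mPAB) (rAB.R mPAB mdAB)
  have tB : S.RJ (tr B B' P \ A) (tr B B' P) (tr B B' (tr A A' P)) := by
    rw [← eP]; exact RJ_tr mPB (hAB'.trans (subset_tr hJ.left)) hM
  have tB' : S.RJ (tr B B' Q \ A) (tr B B' Q) (tr B B' (tr A A' Q)) := by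
    rw [← ed]; exact RJ_tr mdB (hAB'.trans (subset_tr hJ.right)) hM
  have s2 := hc.2 _ _ _ _ (by omega) (by omega) (by omega) (by omega) (rAB.R mPAB mdAB)
      (tB'.symm.R mdAB mdB) (tB.symm.R mPAB mPB) (rB.R mPB mdB)
  rw [← mul_assoc, s1, mul_assoc, s2, mul_assoc]

lemma hol_eq (hc : S.Flat m c) {J P Q A A' B B' : Finset Ch} (hJ : S.Inert m J P Q)
    (hP : P ∈ S.X) (hPm : P.card ≤ m + 1) (hd : S.desc m P ∈ S.X) (hdm : (S.desc m P).card ≤ m)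
    (hQ : Q ∈ S.X) (hQm : Q.card ≤ m + 1) (hd' : S.desc m Q ∈ S.X)
    (hdm' : (S.desc m Q).card ≤ m)
    (hA : A ⊆ J) (hM : S.M A A') (hlt : A'.card < A.card)
    (hB : B ⊆ J) (hM' : S.M B B') (hlt' : B'.card < B.card) (hAB : Disjoint A B) :
    S.hol m c A A' P Q = S.hol m c B B' P Q := by
  have e := edge_eq hc hJ.2.1 hP hPm hQ hQm hA hM hlt hB hM' hlt' hAB
  simp only [hol]
  rw [lift_eq hc hJ.1 hP hPm hd hdm hA hM hlt hB hM' hlt' hAB,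
    lift_eq hc hJ.2.2 hQ hQm hd' hdm' hA hM hlt hB hM' hlt' hAB]
  rw [mul_assoc, mul_assoc, ← mul_assoc (c (tr A A' P) (tr A A' Q)), e]
  group

lemma exists_inert_edge {K n₀ : ℕ} (hD : S.HasDescents K n₀) (hm : n₀ ≤ m) {P Q : Finset Ch}
    (h : S.R P Q) (hPm : P.card ≤ m + 1) (hQm : Q.card ≤ m + 1) :
    ∃ J, (P \ J).card ≤ 3 * S.κ ∧ S.Inert m J P Q := by
  obtain ⟨-, -, J1, a1, r1⟩ := desc_spec hD hm h.1 hPm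
  obtain ⟨-, -, J2, a2, r2⟩ := desc_spec hD hm h.2.1 hQm
  obtain ⟨J3, a3, b3, r3⟩ := h.exists_inert
  refine ⟨J1 ∩ J2 ∩ J3, ?_, r1.mono ?_, r3.mono ?_, r2.mono ?_⟩
  · have : P \ (J1 ∩ J2 ∩ J3) ⊆ (P \ J1) ∪ (Q \ J2) ∪ (P \ J3) := by
      intro x; have := fun h : x ∈ J3 => r3.right h; simp; tauto
    have := Finset.card_le_card this
    have := Finset.card_union_le ((P \ J1) ∪ (Q \ J2)) (P \ J3)
    have := Finset.card_union_le (P \ J1) (Q \ J2)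
    omega
  all_goals intro x; simp +contextual

variable (m c S) in
/-- The value `u` is forced on the edge `P - Q` by the cocycle `c` and all descents. -/
def Forced (n₀ : ℕ) (P Q : Finset Ch) (u : H) : Prop :=
  (P.card ≤ m → Q.card ≤ m → u = c P Q) ∧
  (n₀ ≤ P.card → ∀ J, (P \ J).card ≤ 10 * S.κ → S.Inert m J P Q →
    ∀ A A', S.M A A' → A ⊆ J → A'.card < A.card → S.hol m c A A' P Q = u)

lemma hol_of_le (hc : S.Flat m c) {J P Q A A' : Finset Ch} (hJ : S.RJ J P Q) (hP : P ∈ S.X)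
    (hQ : Q ∈ S.X) (hPm : P.card ≤ m) (hQm : Q.card ≤ m)
    (hA : A ⊆ J) (hM : S.M A A') (hlt : A'.card < A.card) : S.hol m c A A' P Q = c P Q := by
  have hAP := hA.trans hJ.left
  have hAQ := hA.trans hJ.right
  have cP := tr_card hAP hlt
  have cQ := tr_card hAQ hlt
  have mP := tr_mem hP hAP hM
  have mQ := tr_mem hQ hAQ hM
  have rP := (RJ_tr hP hAP hM).R hP mP
  have rQ := (RJ_tr hQ hAQ hM).R hQ mQ
  simp only [hol, lift, desc_of_le hPm, desc_of_le hQm]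
  rw [hc.1 _ mP (by omega), hc.1 _ mQ (by omega), hc.inv rP (by omega) (by omega)]
  have := hc.2 _ _ _ _ (by omega) (by omega) (by omega) (by omega) rP
    ((hJ.tr hP hQ hA hM).R mP mQ) (hJ.R hP hQ) rQ
  rw [hc.inv rQ (by omega) (by omega)]
  simp only [one_mul, inv_inv, this]
  group

lemma exists_forced {n₀ : ℕ} (hD : S.HasDescents (22 * S.κ) n₀) (hm : n₀ + S.κ ≤ m)
    (hc : S.Flat m c) {P Q : Finset Ch}
    (h : S.R P Q) (hPm : P.card ≤ m + 1) (hQm : Q.card ≤ m + 1) :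
    ∃ u, S.Forced m c n₀ P Q u := by
  by_cases hle : P.card ≤ m ∧ Q.card ≤ m
  · refine ⟨c P Q, fun _ _ => rfl, fun _ J _ hJ A A' hM hA hlt => ?_⟩
    exact hol_of_le hc hJ.2.1 h.1 h.2.1 hle.1 hle.2 hA hM hlt
  · have hPn : n₀ ≤ P.card := by have := h.card_le; have := h.symm.card_le; omega
    obtain ⟨J0, hJ0, hi0⟩ := exists_inert_edge hD (by omega) h hPm hQm
    obtain ⟨A0, A0', hM0, hA0, hlt0⟩ := hD P h.1 hPn J0 hi0.2.1.left (by omega)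
    refine ⟨S.hol m c A0 A0' P Q, fun a b => absurd ⟨a, b⟩ hle,
      fun _ J hJ hi A A' hM hA hlt => ?_⟩
    obtain ⟨B, B', hM', hB, hlt'⟩ := hD P h.1 hPn (((J ∩ J0) \ A) \ A0)
      (fun x hx => hi.2.1.left (by simp at hx; tauto)) (by
        have : P \ (((J ∩ J0) \ A) \ A0) ⊆ (P \ J) ∪ (P \ J0) ∪ (A ∪ A0) := by
          intro x; simp; tauto
        have := Finset.card_le_card this
        have := Finset.card_union_le ((P \ J) ∪ (P \ J0)) (A ∪ A0)
        have := Finset.card_union_le (P \ J) (P \ J0)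
        have := Finset.card_union_le A A0
        have := S.card_le hM
        have := S.card_le hM0
        omega)
    have hBJ : B ⊆ J := fun x hx => by have := hB hx; simp at this; tauto
    have hBJ0 : B ⊆ J0 := fun x hx => by have := hB hx; simp at this; tauto
    have d1 : Disjoint A B := Finset.disjoint_left.2 fun x h1 h2 => by
      have := hB h2; simp at this; tauto
    have d2 : Disjoint A0 B := Finset.disjoint_left.2 fun x h1 h2 => by
      have := hB h2; simp at this; tauto
    obtain ⟨p1, p2, -⟩ := desc_spec hD (by omega : n₀ ≤ m) h.1 hPm
    obtain ⟨q1, q2, -⟩ := desc_spec hD (by omega : n₀ ≤ m) h.2.1 hQm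
    rw [hol_eq hc hi h.1 hPm p1 p2 h.2.1 hQm q1 q2 hA hM hlt hBJ hM' hlt' d1,
      hol_eq hc hi0 h.1 hPm p1 p2 h.2.1 hQm q1 q2 hA0 hM0 hlt0 hBJ0 hM' hlt' d2]

lemma Flat.extend {n₀ : ℕ} (hD : S.HasDescents (22 * S.κ) n₀) (hm : n₀ + 2 * S.κ ≤ m)
    (hc : S.Flat m c) : ∃ c' : Finset Ch → Finset Ch → H, S.Flat (m + 1) c' ∧
      ∀ P Q, S.R P Q → P.card ≤ m → Q.card ≤ m → c' P Q = c P Q := by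
  have ex : ∀ P Q, ∃ u, S.R P Q → P.card ≤ m + 1 → Q.card ≤ m + 1 → S.Forced m c n₀ P Q u := by
    intro P Q
    by_cases h : S.R P Q ∧ P.card ≤ m + 1 ∧ Q.card ≤ m + 1
    · obtain ⟨u, hu⟩ := exists_forced hD (by omega) hc h.1 h.2.1 h.2.2
      exact ⟨u, fun _ _ _ => hu⟩
    · exact ⟨1, fun a b d => absurd ⟨a, b, d⟩ h⟩
  choose c' hc' using ex
  refine ⟨c', ⟨fun x hx hxm => ?_, fun x y z w hx hy hz hw xy yz xw wz => ?_⟩,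
    fun P Q h hP hQ => (hc' P Q h (by omega) (by omega)).1 hP hQ⟩
  · obtain ⟨h1, h2⟩ := hc' x x (R.refl hx) hxm hxm
    by_cases h : x.card ≤ m
    · rw [h1 h h, hc.1 x hx h]
    · obtain ⟨J, hJ, hi⟩ := exists_inert_edge hD (by omega) (R.refl hx) hxm hxm
      obtain ⟨A, A', hM, hA, hlt⟩ := hD x hx (by omega) J hi.2.1.left (by omega)
      rw [← h2 (by omega) J (by omega) hi A A' hM hA hlt]
      have := tr_card (hA.trans hi.2.1.left) hlt
      simp only [hol]
      rw [hc.1 _ (tr_mem hx (hA.trans hi.2.1.left) hM) (by omega)]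
      group
  · by_cases hall : x.card ≤ m ∧ y.card ≤ m ∧ z.card ≤ m ∧ w.card ≤ m
    · rw [(hc' x y xy hx hy).1 (by tauto) (by tauto), (hc' y z yz hy hz).1 (by tauto) (by tauto),
        (hc' x w xw hx hw).1 (by tauto) (by tauto), (hc' w z wz hw hz).1 (by tauto) (by tauto)]
      exact hc.2 x y z w (by tauto) (by tauto) (by tauto) (by tauto) xy yz xw wz
    · have c1 := xy.card_le
      have c2 := xy.symm.card_le
      have c3 := yz.card_le
      have c4 := yz.symm.card_le
      have c5 := xw.card_le
      have c6 := xw.symm.card_le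
      have c7 := wz.card_le
      have c8 := wz.symm.card_le
      have gx : n₀ ≤ x.card := by omega
      have gy : n₀ ≤ y.card := by omega
      have gw : n₀ ≤ w.card := by omega
      have hm' : n₀ ≤ m := by omega
      obtain ⟨-, -, Jx, ax, rx⟩ := desc_spec hD hm' xy.1 hx
      obtain ⟨-, -, Jy, ay, ry⟩ := desc_spec hD hm' yz.1 hy
      obtain ⟨-, -, Jz, az, rz⟩ := desc_spec hD hm' yz.2.1 hz
      obtain ⟨-, -, Jw, aw, rw'⟩ := desc_spec hD hm' wz.1 hw
      obtain ⟨J1, a1, b1, r1⟩ := xy.exists_inert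
      obtain ⟨J2, a2, b2, r2⟩ := yz.exists_inert
      obtain ⟨J3, a3, b3, r3⟩ := xw.exists_inert
      obtain ⟨J4, a4, b4, r4⟩ := wz.exists_inert
      let J := (Jx ∩ Jy ∩ (Jz ∩ Jw)) ∩ (J1 ∩ J2 ∩ (J3 ∩ J4))
      have bound : (x \ J).card ≤ 8 * S.κ := by
        have : x \ J ⊆ (((x \ Jx) ∪ (y \ Jy)) ∪ ((z \ Jz) ∪ (w \ Jw))) ∪
            (((x \ J1) ∪ (y \ J2)) ∪ ((x \ J3) ∪ (w \ J4))) := by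
          intro t
          have q1 := fun h : t ∈ J1 => r1.right h
          have q2 := fun h : t ∈ J2 => r2.right h
          have q3 := fun h : t ∈ J3 => r3.right h
          simp only [J, Finset.mem_sdiff, Finset.mem_union, Finset.mem_inter]
          clear * - q1 q2 q3
          grind
        have := Finset.card_le_card this
        have u1 := Finset.card_union_le (((x \ Jx) ∪ (y \ Jy)) ∪ ((z \ Jz) ∪ (w \ Jw)))
            (((x \ J1) ∪ (y \ J2)) ∪ ((x \ J3) ∪ (w \ J4)))
        have u2 := Finset.card_union_le ((x \ Jx) ∪ (y \ Jy)) ((z \ Jz) ∪ (w \ Jw))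
        have u3 := Finset.card_union_le ((x \ J1) ∪ (y \ J2)) ((x \ J3) ∪ (w \ J4))
        have := Finset.card_union_le (x \ Jx) (y \ Jy)
        have := Finset.card_union_le (z \ Jz) (w \ Jw)
        have := Finset.card_union_le (x \ J1) (y \ J2)
        have := Finset.card_union_le (x \ J3) (w \ J4)
        omega
      have boundy : (y \ J).card ≤ 9 * S.κ := by
        have : y \ J ⊆ (y \ J1) ∪ (x \ J) := by
          intro t
          have := fun h : t ∈ J1 => r1.left h
          simp only [Finset.mem_sdiff, Finset.mem_union]; tauto
        have := Finset.card_le_card this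
        have := Finset.card_union_le (y \ J1) (x \ J)
        omega
      have boundw : (w \ J).card ≤ 9 * S.κ := by
        have : w \ J ⊆ (w \ J3) ∪ (x \ J) := by
          intro t
          have := fun h : t ∈ J3 => r3.left h
          simp only [Finset.mem_sdiff, Finset.mem_union]; tauto
        have := Finset.card_le_card this
        have := Finset.card_union_le (w \ J3) (x \ J)
        omega
      have sub : J ⊆ Jx ∧ J ⊆ Jy ∧ J ⊆ Jz ∧ J ⊆ Jw ∧ J ⊆ J1 ∧ J ⊆ J2 ∧ J ⊆ J3 ∧ J ⊆ J4 := by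
        refine ⟨?_, ?_, ?_, ?_, ?_, ?_, ?_, ?_⟩ <;> intro t <;>
          simp +contextual only [J, Finset.mem_inter, implies_true]
      obtain ⟨sx, sy, sz, sw, s1, s2, s3, s4⟩ := sub
      replace rx := rx.mono sx
      replace ry := ry.mono sy
      replace rz := rz.mono sz
      replace rw' := rw'.mono sw
      replace r1 := r1.mono s1
      replace r2 := r2.mono s2
      replace r3 := r3.mono s3
      replace r4 := r4.mono s4
      clear_value J
      obtain ⟨A, A', hM, hA, hlt⟩ := hD x xy.1 gx J r1.left (by omega)
      rw [← (hc' x y xy hx hy).2 gx J (by omega) ⟨rx, r1, ry⟩ A A' hM hA hlt,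
        ← (hc' y z yz hy hz).2 gy J (by omega) ⟨ry, r2, rz⟩ A A' hM hA hlt,
        ← (hc' x w xw hx hw).2 gx J (by omega) ⟨rx, r3, rw'⟩ A A' hM hA hlt,
        ← (hc' w z wz hw hz).2 gw J (by omega) ⟨rw', r4, rz⟩ A A' hM hA hlt]
      have tx := tr_card (hA.trans r1.left) hlt
      have ty := tr_card (hA.trans r2.left) hlt
      have tz := tr_card (hA.trans r2.right) hlt
      have tw := tr_card (hA.trans r4.left) hlt
      have mx := tr_mem xy.1 (hA.trans r1.left) hM
      have my := tr_mem yz.1 (hA.trans r2.left) hM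
      have mz := tr_mem yz.2.1 (hA.trans r2.right) hM
      have mw := tr_mem wz.1 (hA.trans r4.left) hM
      have := hc.2 _ _ _ _ (by omega) (by omega) (by omega) (by omega)
        ((r1.tr xy.1 xy.2.1 hA hM).R mx my) ((r2.tr yz.1 yz.2.1 hA hM).R my mz)
        ((r3.tr xw.1 xw.2.1 hA hM).R mx mw) ((r4.tr wz.1 wz.2.1 hA hM).R mw mz)
      simp only [hol]
      calc _ = (S.lift m c A A' x)⁻¹ * (c (tr A A' x) (tr A A' y) * c (tr A A' y) (tr A A' z)) *
            S.lift m c A A' z := by group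
        _ = _ := by rw [this]; group

/-- A flat cocycle on the members of bounded cardinality extends to all of `X`. -/
theorem Flat.extend_all {n₀ n : ℕ} (hD : S.HasDescents (22 * S.κ) n₀) (hn : n₀ + 2 * S.κ ≤ n)
    (hc : S.Flat n c) : ∃ c' : Finset Ch → Finset Ch → H, (∀ m, S.Flat m c') ∧
      ∀ P Q, S.R P Q → P.card ≤ n → Q.card ≤ n → c' P Q = c P Q := by
  have step : ∀ (k : ℕ) (d : {d : Finset Ch → Finset Ch → H // S.Flat (n + k) d}),
      ∃ d' : {d : Finset Ch → Finset Ch → H // S.Flat (n + (k + 1)) d},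
        ∀ P Q, S.R P Q → P.card ≤ n + k → Q.card ≤ n + k → d'.1 P Q = d.1 P Q := by
    intro k d
    obtain ⟨d', h1, h2⟩ := d.2.extend hD (by omega)
    exact ⟨⟨d', h1⟩, h2⟩
  choose nxt hnxt using step
  let s : ∀ k, {d : Finset Ch → Finset Ch → H // S.Flat (n + k) d} :=
    fun k => Nat.rec ⟨c, hc⟩ (fun k d => nxt k d) k
  have hs : ∀ j i, ∀ P Q, S.R P Q → P.card ≤ n + i → Q.card ≤ n + i →
      (s (i + j)).1 P Q = (s i).1 P Q := by
    intro j
    induction j with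
    | zero => intros; rfl
    | succ j ih =>
      intro i P Q h hP hQ
      rw [← ih i P Q h hP hQ]
      exact hnxt (i + j) (s (i + j)) P Q h (by omega) (by omega)
  let c' : Finset Ch → Finset Ch → H := fun P Q => (s (max P.card Q.card)).1 P Q
  have hc' : ∀ k P Q, S.R P Q → P.card ≤ n + k → Q.card ≤ n + k → c' P Q = (s k).1 P Q := by
    intro k P Q h hP hQ
    have e1 := hs k (max P.card Q.card) P Q h (by omega) (by omega)
    have e2 := hs (max P.card Q.card) k P Q h hP hQ
    have e3 : (s (k + max P.card Q.card)).1 = (s (max P.card Q.card + k)).1 :=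
      congrArg (fun i => (s i).1) (add_comm _ _)
    rw [e3] at e2
    exact e1.symm.trans e2
  refine ⟨c', fun m => ⟨fun x hx hxm => ?_, fun x y z w hx hy hz hw xy yz xw wz => ?_⟩,
    fun P Q h hP hQ => hc' 0 P Q h hP hQ⟩
  · rw [hc' m x x (R.refl hx) (by omega) (by omega)]
    exact (s m).2.1 x hx (by omega)
  · rw [hc' m x y xy (by omega) (by omega), hc' m y z yz (by omega) (by omega),
      hc' m x w xw (by omega) (by omega), hc' m w z wz (by omega) (by omega)]
    exact (s m).2.2 x y z w (by omega) (by omega) (by omega) (by omega) xy yz xw wz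

variable (S) in
/-- Adjacency of members of cardinality at most `m`. -/
def RLe (m : ℕ) (P Q : Finset Ch) : Prop := S.R P Q ∧ P.card ≤ m ∧ Q.card ≤ m

lemma connected_desc {n₀ : ℕ} (hD : S.HasDescents (22 * S.κ) n₀) (hm : n₀ + 2 * S.κ ≤ m)
    {P Q : Finset Ch} (h : Relation.ReflTransGen (S.RLe (m + 1)) P Q) :
    Relation.ReflTransGen (S.RLe m) (S.desc m P) (S.desc m Q) := by
  induction h with
  | refl => exact .refl
  | @tail Q R' _ h ih =>
    refine ih.trans ?_
    obtain ⟨h, hP, hQ⟩ := h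
    by_cases hle : Q.card ≤ m ∧ R'.card ≤ m
    · rw [desc_of_le hle.1, desc_of_le hle.2]
      exact .single ⟨h, hle⟩
    · have hPn : n₀ ≤ Q.card := by have := h.card_le; have := h.symm.card_le; omega
      obtain ⟨J, hJ, hi⟩ := exists_inert_edge hD (by omega) h hP hQ
      obtain ⟨A, A', hM, hA, hlt⟩ := hD Q h.1 hPn J hi.2.1.left (by omega)
      obtain ⟨p1, p2, -⟩ := desc_spec hD (by omega : n₀ ≤ m) h.1 hP
      obtain ⟨q1, q2, -⟩ := desc_spec hD (by omega : n₀ ≤ m) h.2.1 hQ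
      have t1 := tr_card (hA.trans hi.1.left) hlt
      have t2 := tr_card (hA.trans hi.1.right) hlt
      have t3 := tr_card (hA.trans hi.2.2.left) hlt
      have t4 := tr_card (hA.trans hi.2.2.right) hlt
      have m1 := tr_mem h.1 (hA.trans hi.1.left) hM
      have m2 := tr_mem p1 (hA.trans hi.1.right) hM
      have m3 := tr_mem h.2.1 (hA.trans hi.2.2.left) hM
      have m4 := tr_mem q1 (hA.trans hi.2.2.right) hM
      refine .head ⟨(RJ_tr p1 (hA.trans hi.1.right) hM).R p1 m2, by omega, by omega⟩ ?_
      refine .head ⟨((hi.1.tr h.1 p1 hA hM).R m1 m2).symm, by omega, by omega⟩ ?_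
      refine .head ⟨(hi.2.1.tr h.1 h.2.1 hA hM).R m1 m3, by omega, by omega⟩ ?_
      refine .head ⟨(hi.2.2.tr h.2.1 q1 hA hM).R m3 m4, by omega, by omega⟩ ?_
      exact .single ⟨((RJ_tr q1 (hA.trans hi.2.2.right) hM).R q1 m4).symm, by omega, by omega⟩

theorem connected_le {n₀ n : ℕ} (hD : S.HasDescents (22 * S.κ) n₀) (hn : n₀ + 2 * S.κ ≤ n)
    {P Q : Finset Ch} (hP : P.card ≤ n) (hQ : Q.card ≤ n) (h : Relation.ReflTransGen S.R P Q) :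
    Relation.ReflTransGen (S.RLe n) P Q := by
  have key : ∀ k, Relation.ReflTransGen (S.RLe (n + k)) P Q →
      Relation.ReflTransGen (S.RLe n) P Q := by
    intro k
    induction k with
    | zero => exact id
    | succ k ih =>
      intro h
      have := connected_desc hD (m := n + k) (by omega) h
      rw [desc_of_le (by omega), desc_of_le (by omega)] at this
      exact ih this
  have : ∀ Q, Relation.ReflTransGen S.R P Q →
      ∃ k, Q.card ≤ n + k ∧ Relation.ReflTransGen (S.RLe (n + k)) P Q := by
    intro Q h
    induction h with
    | refl => exact ⟨0, hP, .refl⟩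
    | @tail Q R' _ h ih =>
      obtain ⟨k, hk, ih⟩ := ih
      refine ⟨k + R'.card, by omega,
        .tail (Relation.ReflTransGen.mono (fun a b hab => ⟨hab.1, ?_, ?_⟩) _ _ ih)
        ⟨h, by omega, by omega⟩⟩
      · exact hab.2.1.trans (by omega)
      · exact hab.2.2.trans (by omega)
  obtain ⟨k, -, h⟩ := this Q h
  exact key k h

end MoveSystem

lemma eqvGen_of_reflTransGen {α : Type*} {r : α → α → Prop} {a b : α}
    (h : Relation.ReflTransGen r a b) : Relation.EqvGen r a b := by
  induction h with
  | refl => exact .refl _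
  | tail _ h ih => exact .trans _ _ _ ih (.rel _ _ h)

lemma reflTransGen_symm {α : Type*} {r : α → α → Prop} (hr : ∀ a b, r a b → r b a) {a b : α}
    (h : Relation.ReflTransGen r a b) : Relation.ReflTransGen r b a := by
  induction h with
  | refl => exact .refl
  | tail _ h ih => exact .head (hr _ _ h) ih

/-- On a terminating rewriting system with commuting squares, a cocycle which is trivial on
these squares is a coboundary. -/
theorem exists_potential_of_diamond {α H : Type*} [Group H] (step : α → α → Prop)
    (c : α → α → H) (wf : WellFounded fun Q P => step P Q)
    (diamond : ∀ P Q Q', step P Q → step P Q' → Q = Q' ∨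
      ∃ Z, step Q Z ∧ step Q' Z ∧ c P Q * c Q Z = c P Q' * c Q' Z) :
    ∃ u : α → H, ∀ P Q, step P Q → u P = c P Q * u Q := by
  let u : α → H := wf.fix fun P ih =>
    if h : ∃ Q, step P Q then c P h.choose * ih h.choose h.choose_spec else 1
  have hu : ∀ P (h : ∃ Q, step P Q), u P = c P h.choose * u h.choose := by
    intro P h
    change wf.fix _ P = _
    rw [wf.fix_eq, dif_pos h]
  refine ⟨u, fun P => ?_⟩
  induction P using wf.induction with | _ P ih
  intro Q hQ
  have hex : ∃ Q, step P Q := ⟨Q, hQ⟩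
  rw [hu P hex]
  rcases diamond P hex.choose Q hex.choose_spec hQ with h | ⟨Z, h1, h2, h3⟩
  · rw [h]
  · rw [ih _ hex.choose_spec Z h1, ih _ hQ Z h2, ← mul_assoc, h3, mul_assoc]

/-- If a cocycle is a coboundary on an increasing sequence of connected pieces, it is a
coboundary on the union. -/
theorem exists_potential_of_exhaustion {α H : Type*} [Group H] (r : ℕ → α → α → Prop)
    (hr : ∀ N P Q, r N P Q → r (N + 1) P Q) (b : ℕ → α)
    (hb : ∀ N P Q, r N P Q → Relation.EqvGen (r N) P (b N) ∧ Relation.EqvGen (r N) Q (b N))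
    (hbb : ∀ N, Relation.EqvGen (r (N + 1)) (b N) (b (N + 1)))
    (c : α → α → H) (hc : ∀ N, ∃ u : α → H, ∀ P Q, r N P Q → c P Q = u P * (u Q)⁻¹) :
    ∃ u : α → H, ∀ N P Q, r N P Q → c P Q = u P * (u Q)⁻¹ := by
  choose u hu using hc
  have mono : ∀ {M N}, M ≤ N → ∀ P Q, r M P Q → r N P Q := by
    intro M N h P Q hr'
    induction h with
    | refl => exact hr'
    | step _ ih => exact hr _ _ _ ih
  have key : ∀ N M P Q, N ≤ M → Relation.EqvGen (r N) P Q →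
      u M P * (u M Q)⁻¹ = u N P * (u N Q)⁻¹ := by
    intro N M P Q hNM h
    induction h with
    | rel P Q h => rw [← hu M P Q (mono hNM _ _ h), ← hu N P Q h]
    | refl => simp
    | symm P Q _ ih => rw [← inv_inj]; simpa using ih
    | trans P Q S _ _ ih1 ih2 =>
      have e1 : u M P * (u M S)⁻¹ = (u M P * (u M Q)⁻¹) * (u M Q * (u M S)⁻¹) := by group
      rw [e1, ih1, ih2]; group
  let s : ℕ → H := fun n => Nat.rec 1 (fun N h => h * u (N + 1) (b N) * (u (N + 1) (b (N + 1)))⁻¹) n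
  have hs : ∀ N, s (N + 1) = s N * u (N + 1) (b N) * (u (N + 1) (b (N + 1)))⁻¹ := fun N => rfl
  let w : ℕ → α → H := fun N P => u N P * (u N (b N))⁻¹ * (s N)⁻¹
  have hw : ∀ N P, Relation.EqvGen (r N) P (b N) → w (N + 1) P = w N P := by
    intro N P h
    have := key N (N + 1) P (b N) (by omega) h
    simp only [w, hs]
    rw [← this]; group
  have hmem : ∀ M N P, M ≤ N → Relation.EqvGen (r M) P (b M) → Relation.EqvGen (r N) P (b N) := by
    intro M N P h hP
    induction h with
    | refl => exact hP
    | @step N _ ih =>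
      exact .trans _ _ _ (Relation.EqvGen.mono (hr N) _ _ ih) (hbb N)
  have hw' : ∀ M N P, M ≤ N → Relation.EqvGen (r M) P (b M) → w N P = w M P := by
    intro M N P h hP
    induction h with
    | refl => rfl
    | @step N hN ih => rw [hw N P (hmem _ _ _ hN hP), ih]
  refine ⟨fun P => if h : ∃ N, Relation.EqvGen (r N) P (b N) then w (Nat.find h) P else 1, ?_⟩
  intro N P Q h
  obtain ⟨hP, hQ⟩ := hb N P Q h
  have eP : ∃ N, Relation.EqvGen (r N) P (b N) := ⟨N, hP⟩
  have eQ : ∃ N, Relation.EqvGen (r N) Q (b N) := ⟨N, hQ⟩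
  beta_reduce
  rw [dif_pos eP, dif_pos eQ, ← hw' _ N P (Nat.find_min' eP hP) (Nat.find_spec eP),
    ← hw' _ N Q (Nat.find_min' eQ hQ) (Nat.find_spec eQ), hu N P Q h]
  simp only [w]; group

/-- An abstract system of charts: each chart has a support and a type, and is subdivided
into finitely many smaller charts, the types of which depend only on its type. -/
structure ChartSystem where
  Pt : Type
  Ch : Type
  V : Type
  [fintypeV : Fintype V]
  supp : Ch → Set Pt
  kids : Ch → Finset Ch
  ty : Ch → V
  ch : V → Multiset V
  supp_nonempty : ∀ a, (supp a).Nonempty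
  supp_kids : ∀ a, ⋃ k ∈ kids a, supp k = supp a
  disj_kids : ∀ a, ∀ k ∈ kids a, ∀ l ∈ kids a, k ≠ l → Disjoint (supp k) (supp l)
  ty_kids : ∀ a, (kids a).val.map ty = ch (ty a)
  merge : ∀ (A : Finset Ch) (v : V), (∀ k ∈ A, ∀ l ∈ A, k ≠ l → Disjoint (supp k) (supp l)) →
    A.val.map ty = ch v → ∃ a, ty a = v ∧ kids a = A
  finite_merge : ∀ A : Finset Ch, {a | kids a = A}.Finite

attribute [instance] ChartSystem.fintypeV

namespace ChartSystem

variable (C : ChartSystem)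

/-- `C.Desc a n b`: the chart `b` is an `n`-fold subdivision of `a`. -/
def Desc : C.Ch → ℕ → C.Ch → Prop
  | a, 0, b => a = b
  | a, n + 1, b => ∃ k ∈ C.kids a, Desc k n b

/-- A finite set of charts with pairwise disjoint supports. -/
def Code (A : Finset C.Ch) : Prop :=
  ∀ k ∈ A, ∀ l ∈ A, k ≠ l → Disjoint (C.supp k) (C.supp l)

/-- The union of the supports. -/
def Supp (A : Finset C.Ch) : Set C.Pt := ⋃ k ∈ A, C.supp k

/-- The subdivisions of the whole space into charts. -/
def X : Set (Finset C.Ch) := {P | C.Code P ∧ C.Supp P = Set.univ}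

/-- `Q` is a refinement of `P`. -/
def Refines (P Q : Finset C.Ch) : Prop := ∀ b ∈ Q, ∃ a ∈ P, ∃ n, C.Desc a n b

/-- Elementary subdivision of the chart `a` in `A`. -/
def expand (a : C.Ch) (A : Finset C.Ch) : Finset C.Ch := MoveSystem.tr {a} (C.kids a) A

/-- Two codes differ by an elementary subdivision. -/
def Step (A A' : Finset C.Ch) : Prop :=
  (C.Code A ∧ ∃ a ∈ A, A' = C.expand a A) ∨ (C.Code A' ∧ ∃ a ∈ A', A = C.expand a A')

/-- Two codes are related by `r` elementary subdivisions and their inverses, without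
ever using more than `κ` charts. -/
def Walk (κ r : ℕ) (A A' : Finset C.Ch) : Prop :=
  ∃ f : ℕ → Finset C.Ch, f 0 = A ∧ f r = A' ∧ (∀ i < r, C.Step (f i) (f (i + 1))) ∧
    ∀ i ≤ r, C.Code (f i) ∧ (f i).card ≤ κ

variable {C}

lemma mem_Supp {A : Finset C.Ch} {x : C.Pt} : x ∈ C.Supp A ↔ ∃ k ∈ A, x ∈ C.supp k := by
  simp [Supp]

lemma mem_kids_supp {a : C.Ch} {x : C.Pt} : x ∈ C.supp a ↔ ∃ k ∈ C.kids a, x ∈ C.supp k := by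
  rw [← C.supp_kids a]; simp

lemma Code.eq {A : Finset C.Ch} (h : C.Code A) {k l : C.Ch} (hk : k ∈ A) (hl : l ∈ A)
    {x : C.Pt} (h1 : x ∈ C.supp k) (h2 : x ∈ C.supp l) : k = l := by
  by_contra hne
  exact Set.disjoint_left.1 (h k hk l hl hne) h1 h2

lemma Code.mono {A B : Finset C.Ch} (h : C.Code A) (hB : B ⊆ A) : C.Code B :=
  fun k hk l hl => h k (hB hk) l (hB hl)

lemma code_singleton (a : C.Ch) : C.Code {a} := by
  intro k hk l hl h; simp at hk hl; exact absurd (hk.trans hl.symm) h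

lemma code_kids (a : C.Ch) : C.Code (C.kids a) := C.disj_kids a

lemma Supp_singleton (a : C.Ch) : C.Supp {a} = C.supp a := by simp [Supp]

lemma Supp_kids (a : C.Ch) : C.Supp (C.kids a) = C.supp a := C.supp_kids a

lemma Code.disjoint {P A A' : Finset C.Ch} (h : C.Code P) (hA : A ⊆ P)
    (hS : C.Supp A = C.Supp A') : Disjoint (P \ A) A' := by
  rw [Finset.disjoint_left]
  intro k hk hk'
  obtain ⟨x, hx⟩ := C.supp_nonempty k
  have : x ∈ C.Supp A := hS ▸ mem_Supp.2 ⟨k, hk', hx⟩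
  obtain ⟨l, hl, hxl⟩ := mem_Supp.1 this
  rw [Finset.mem_sdiff] at hk
  exact hk.2 (h.eq hk.1 (hA hl) hx hxl ▸ hl)

lemma Code.tr {P A A' : Finset C.Ch} (h : C.Code P) (hA : A ⊆ P) (hA' : C.Code A')
    (hS : C.Supp A = C.Supp A') : C.Code (MoveSystem.tr A A' P) := by
  have key : ∀ k ∈ P \ A, ∀ l ∈ A', Disjoint (C.supp k) (C.supp l) := by
    intro k hk l hl
    rw [Set.disjoint_left]
    intro x hx hxl
    have : x ∈ C.Supp A := hS ▸ mem_Supp.2 ⟨l, hl, hxl⟩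
    obtain ⟨j, hj, hxj⟩ := mem_Supp.1 this
    rw [Finset.mem_sdiff] at hk
    exact hk.2 (h.eq hk.1 (hA hj) hx hxj ▸ hj)
  intro k hk l hl hne
  simp only [MoveSystem.tr, Finset.mem_union] at hk hl
  rcases hk with hk | hk <;> rcases hl with hl | hl
  · exact h k (Finset.mem_sdiff.1 hk).1 l (Finset.mem_sdiff.1 hl).1 hne
  · exact key k hk l hl
  · exact (key l hl k hk).symm
  · exact hA' k hk l hl hne

lemma Supp_union (A B : Finset C.Ch) : C.Supp (A ∪ B) = C.Supp A ∪ C.Supp B := by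
  ext x; simp only [mem_Supp, Finset.mem_union, Set.mem_union]
  constructor
  · rintro ⟨k, h | h, hx⟩
    · exact Or.inl ⟨k, h, hx⟩
    · exact Or.inr ⟨k, h, hx⟩
  · rintro (⟨k, h, hx⟩ | ⟨k, h, hx⟩)
    · exact ⟨k, Or.inl h, hx⟩
    · exact ⟨k, Or.inr h, hx⟩

lemma Supp_tr {P A A' : Finset C.Ch} (hA : A ⊆ P) (hS : C.Supp A = C.Supp A') :
    C.Supp (MoveSystem.tr A A' P) = C.Supp P := by
  rw [MoveSystem.tr, Supp_union, ← hS, ← Supp_union, Finset.sdiff_union_of_subset hA]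

lemma Code.expand {A : Finset C.Ch} (h : C.Code A) {a : C.Ch} (ha : a ∈ A) :
    C.Code (C.expand a A) :=
  h.tr (by simpa using ha) (code_kids a) (by rw [Supp_singleton, Supp_kids])

lemma Supp_expand {A : Finset C.Ch} {a : C.Ch} (ha : a ∈ A) :
    C.Supp (C.expand a A) = C.Supp A :=
  Supp_tr (by simpa using ha) (by rw [Supp_singleton, Supp_kids])

lemma Step.symm {A A' : Finset C.Ch} (h : C.Step A A') : C.Step A' A := Or.symm h

lemma Step.Supp_eq {A A' : Finset C.Ch} (h : C.Step A A') : C.Supp A = C.Supp A' := by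
  rcases h with ⟨-, a, ha, rfl⟩ | ⟨-, a, ha, rfl⟩
  · rw [Supp_expand ha]
  · rw [Supp_expand ha]

lemma Step.code {A A' : Finset C.Ch} (h : C.Step A A') : C.Code A' := by
  rcases h with ⟨h, a, ha, rfl⟩ | ⟨h, -⟩
  · exact h.expand ha
  · exact h

lemma expand_subset {a : C.Ch} {A : Finset C.Ch} {P : Finset C.Ch} (hP : C.Code P)
    (hA : A ⊆ P) (ha : a ∈ A) : MoveSystem.tr A (C.expand a A) P = C.expand a P := by
  have := hP.disjoint (A := {a}) (A' := C.kids a) (by simpa using hA ha)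
    (by rw [Supp_singleton, Supp_kids])
  ext x
  simp only [expand, MoveSystem.tr, Finset.mem_union, Finset.mem_sdiff, Finset.mem_singleton]
  constructor
  · rintro (h | h | h)
    · exact Or.inl ⟨h.1, fun e => h.2 (e ▸ ha)⟩
    · exact Or.inl ⟨hA h.1, h.2⟩
    · exact Or.inr h
  · rintro (h | h)
    · by_cases hx : x ∈ A
      · exact Or.inr (Or.inl ⟨hx, h.2⟩)
      · exact Or.inl ⟨h.1, hx⟩
    · exact Or.inr (Or.inr h)

lemma Walk.symm {κ r : ℕ} {A A' : Finset C.Ch} (h : C.Walk κ r A A') : C.Walk κ r A' A := by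
  obtain ⟨f, rfl, rfl, h1, h2⟩ := h
  refine ⟨fun i => f (r - i), by simp, by simp, fun i hi => ?_, fun i hi => h2 _ (by omega)⟩
  have := (h1 (r - (i + 1)) (by omega)).symm
  rwa [show r - (i + 1) + 1 = r - i by omega] at this

lemma Walk.refl {κ : ℕ} {A : Finset C.Ch} (h : C.Code A) (hκ : A.card ≤ κ) : C.Walk κ 0 A A :=
  ⟨fun _ => A, rfl, rfl, by simp, fun _ _ => ⟨h, hκ⟩⟩

lemma Walk.code {κ r : ℕ} {A A' : Finset C.Ch} (h : C.Walk κ r A A') : C.Code A ∧ A.card ≤ κ := by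
  obtain ⟨f, rfl, rfl, h1, h2⟩ := h
  exact h2 0 (by omega)

lemma Walk.succ {κ r : ℕ} {A A' : Finset C.Ch} :
    C.Walk κ (r + 1) A A' ↔ ∃ B, C.Walk κ r A B ∧ C.Step B A' ∧ A'.card ≤ κ := by
  constructor
  · rintro ⟨f, rfl, rfl, h1, h2⟩
    exact ⟨f r, ⟨f, rfl, rfl, fun i hi => h1 i (by omega), fun i hi => h2 i (by omega)⟩,
      h1 r (by omega), (h2 _ le_rfl).2⟩
  · rintro ⟨B, ⟨f, rfl, rfl, h1, h2⟩, h3, h4⟩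
    refine ⟨fun i => if i ≤ r then f i else A', by simp, by simp, fun i hi => ?_, fun i hi => ?_⟩
    · by_cases h : i = r
      · subst h; simpa using h3
      · have := h1 i (by omega)
        simpa [show i ≤ r by omega, show i + 1 ≤ r by omega]
    · by_cases h : i ≤ r
      · simpa [h] using h2 i h
      · simpa [h] using ⟨h3.code, h4⟩

lemma Walk.Supp_eq {κ r : ℕ} {A A' : Finset C.Ch} (h : C.Walk κ r A A') :
    C.Supp A = C.Supp A' := by
  induction r generalizing A' with
  | zero => obtain ⟨f, rfl, rfl, -⟩ := h; rfl
  | succ r ih =>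
    obtain ⟨B, h1, h2, -⟩ := Walk.succ.1 h
    rw [ih h1, h2.Supp_eq]

variable (C) in
/-- The move system of bounded walks. -/
def moves (κ k : ℕ) : MoveSystem C.Ch where
  X := C.X
  M A A' := ∃ r ≤ k, C.Walk κ r A A'
  κ := κ
  symm := fun ⟨r, h, h'⟩ => ⟨r, h, h'.symm⟩
  card_le := fun ⟨_, _, h⟩ => h.code.2
  mem := fun hP hA ⟨_, _, h⟩ =>
    ⟨hP.1.tr hA h.symm.code.1 h.Supp_eq, (Supp_tr hA h.Supp_eq).trans hP.2⟩
  disj := fun hP hA ⟨_, _, h⟩ => hP.1.disjoint hA h.Supp_eq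
  nil := ⟨0, Nat.zero_le _, Walk.refl (by simp [Code]) (by simp)⟩

lemma finite_step (A : Finset C.Ch) : {A' | C.Step A A'}.Finite := by
  have h1 : {A' | ∃ a ∈ A, A' = C.expand a A}.Finite := by
    refine (A.finite_toSet.image fun a => C.expand a A).subset ?_
    rintro _ ⟨a, ha, rfl⟩; exact ⟨a, ha, rfl⟩
  have h2 : (⋃ B ∈ A.powerset, (fun a => (A \ B) ∪ {a}) '' {a | C.kids a = B}).Finite :=
    Set.Finite.biUnion A.powerset.finite_toSet fun B _ => (C.finite_merge B).image _
  refine (h1.union h2).subset ?_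
  rintro A' (⟨-, h⟩ | ⟨hA', a, ha, rfl⟩)
  · exact Or.inl h
  · refine Or.inr ?_
    have hd := hA'.disjoint (A := {a}) (A' := C.kids a) (by simpa using ha)
      (by rw [Supp_singleton, Supp_kids])
    simp only [Set.mem_iUnion]
    refine ⟨C.kids a, ?_, a, rfl, ?_⟩
    · rw [Finset.mem_powerset]
      exact Finset.subset_union_right
    · simp only [expand, MoveSystem.tr, Finset.union_sdiff_right]
      rw [Finset.sdiff_eq_self_of_disjoint hd]
      exact Finset.sdiff_union_of_subset (by simpa using ha)

lemma finite_walk (κ r : ℕ) (A : Finset C.Ch) : {A' | C.Walk κ r A A'}.Finite := by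
  induction r with
  | zero =>
    refine (Set.finite_singleton A).subset ?_
    rintro A' ⟨f, rfl, rfl, -⟩; rfl
  | succ r ih =>
    refine (ih.biUnion fun B _ => finite_step B).subset ?_
    intro A' h
    obtain ⟨B, h1, h2, -⟩ := Walk.succ.1 h
    simp only [Set.mem_iUnion]
    exact ⟨B, h1, h2⟩

lemma finite_adjacent (κ k : ℕ) (P : Finset C.Ch) : {Q | (C.moves κ k).R P Q}.Finite := by
  have h : (⋃ IA ∈ P.powerset ×ˢ P.powerset, ⋃ r ∈ Finset.range (k + 1),
      (fun A' => IA.1 ∪ A') '' {A' | C.Walk κ r IA.2 A'}).Finite :=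
    Set.Finite.biUnion (Finset.finite_toSet _) fun IA _ =>
      Set.Finite.biUnion (Finset.finite_toSet _) fun r _ => (finite_walk κ r IA.2).image _
  refine h.subset ?_
  rintro Q ⟨-, -, I, A, A', ⟨r, hr, hw⟩, -, rfl, rfl, -⟩
  simp only [Set.mem_iUnion]
  refine ⟨(I, A), ?_, r, by simp; omega, A', hw, rfl⟩
  rw [Finset.mem_product, Finset.mem_powerset, Finset.mem_powerset]
  exact ⟨Finset.subset_union_left, Finset.subset_union_right⟩

/-! ### Descendants -/

lemma Desc.trans {a b d : C.Ch} {m n : ℕ} (h : C.Desc a m b) (h' : C.Desc b n d) :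
    C.Desc a (m + n) d := by
  induction m generalizing a with
  | zero => cases h; simpa using h'
  | succ m ih =>
    obtain ⟨k, hk, h⟩ := h
    rw [show m + 1 + n = (m + n) + 1 by omega]
    exact ⟨k, hk, ih h⟩

lemma Desc.supp_subset {a b : C.Ch} {n : ℕ} (h : C.Desc a n b) : C.supp b ⊆ C.supp a := by
  induction n generalizing a with
  | zero => cases h; rfl
  | succ n ih =>
    obtain ⟨k, hk, h⟩ := h
    exact (ih h).trans fun x hx => mem_kids_supp.2 ⟨k, hk, hx⟩

lemma Refines.trans {P Q S : Finset C.Ch} (h : C.Refines P Q) (h' : C.Refines Q S) :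
    C.Refines P S := by
  intro d hd
  obtain ⟨b, hb, n, h1⟩ := h' d hd
  obtain ⟨a, ha, m, h2⟩ := h b hb
  exact ⟨a, ha, _, h2.trans h1⟩

lemma Refines.refl (P : Finset C.Ch) : C.Refines P P := fun b hb => ⟨b, hb, 0, rfl⟩

lemma Refines.hit {P Q : Finset C.Ch} (hP : P ∈ C.X) (hQ : Q ∈ C.X) (h : C.Refines P Q)
    {a : C.Ch} (ha : a ∈ P) : ∃ b ∈ Q, ∃ n, C.Desc a n b := by
  obtain ⟨x, hx⟩ := C.supp_nonempty a
  obtain ⟨b, hb, hxb⟩ := mem_Supp.1 (hQ.2.symm ▸ Set.mem_univ x : x ∈ C.Supp Q)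
  obtain ⟨a', ha', n, hd⟩ := h b hb
  obtain rfl := hP.1.eq ha ha' hx (hd.supp_subset hxb)
  exact ⟨b, hb, n, hd⟩

lemma Code.desc_unique {P : Finset C.Ch} (hP : C.Code P) {a a' b : C.Ch} {n n' : ℕ}
    (ha : a ∈ P) (ha' : a' ∈ P) (h : C.Desc a n b) (h' : C.Desc a' n' b) : a = a' := by
  obtain ⟨x, hx⟩ := C.supp_nonempty b
  exact hP.eq ha ha' (h.supp_subset hx) (h'.supp_subset hx)

lemma expand_mem_X {P : Finset C.Ch} (hP : P ∈ C.X) {a : C.Ch} (ha : a ∈ P) :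
    C.expand a P ∈ C.X := ⟨hP.1.expand ha, (Supp_expand ha).trans hP.2⟩

lemma mem_expand {P : Finset C.Ch} {a b : C.Ch} :
    b ∈ C.expand a P ↔ (b ∈ P ∧ b ≠ a) ∨ b ∈ C.kids a := by
  simp [expand, MoveSystem.tr]

variable (C) in
/-- `Q` is an elementary subdivision of `P` which is still refined by `T`. -/
def ExpStep (T P Q : Finset C.Ch) : Prop :=
  P ∈ C.X ∧ C.Refines P T ∧ ∃ a ∈ P, a ∉ T ∧ Q = C.expand a P

lemma ExpStep.mem {T P Q : Finset C.Ch} (h : C.ExpStep T P Q) : Q ∈ C.X := by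
  obtain ⟨h1, -, a, ha, -, rfl⟩ := h; exact expand_mem_X h1 ha

lemma ExpStep.refines {T P Q : Finset C.Ch} (h : C.ExpStep T P Q) : C.Refines Q T := by
  obtain ⟨h1, h2, a, ha, haT, rfl⟩ := h
  intro b hb
  obtain ⟨a', ha', n, hd⟩ := h2 b hb
  by_cases e : a' = a
  · subst e
    cases n with
    | zero => cases hd; exact absurd hb haT
    | succ n =>
      obtain ⟨k, hk, hd⟩ := hd
      exact ⟨k, mem_expand.2 (Or.inr hk), n, hd⟩
  · exact ⟨a', mem_expand.2 (Or.inl ⟨ha', e⟩), n, hd⟩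

variable (C) in
/-- The minimal depth of `b` below `P`. -/
def depth (P : Finset C.Ch) (b : C.Ch) : ℕ := sInf {n | ∃ a ∈ P, C.Desc a n b}

lemma depth_le {P : Finset C.Ch} {a b : C.Ch} {n : ℕ} (ha : a ∈ P) (h : C.Desc a n b) :
    C.depth P b ≤ n := Nat.sInf_le ⟨a, ha, h⟩

lemma ExpStep.depth_lt {T P Q : Finset C.Ch} (hT : T ∈ C.X) (h : C.ExpStep T P Q) :
    ∑ b ∈ T, C.depth Q b < ∑ b ∈ T, C.depth P b := by
  obtain ⟨h1, h2, a, ha, haT, rfl⟩ := h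
  have spec : ∀ b ∈ T, ∃ a ∈ P, C.Desc a (C.depth P b) b := fun b hb => by
    obtain ⟨a, ha, n, h⟩ := h2 b hb
    exact Nat.sInf_mem (s := {n | ∃ a ∈ P, C.Desc a n b}) ⟨n, a, ha, h⟩
  have key : ∀ b ∈ T, ∀ a' ∈ P, C.Desc a' (C.depth P b) b →
      C.depth (C.expand a P) b ≤ C.depth P b ∧
      (a' = a → C.depth (C.expand a P) b < C.depth P b) := by
    intro b hb a' ha' hd
    by_cases e : a' = a
    · subst e
      generalize C.depth P b = n at hd
      cases n with
      | zero => cases hd; exact absurd hb haT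
      | succ n =>
        obtain ⟨k, hk, hd⟩ := hd
        have := depth_le (P := C.expand a' P) (mem_expand.2 (Or.inr hk)) hd
        exact ⟨by omega, fun _ => by omega⟩
    · exact ⟨depth_le (mem_expand.2 (Or.inl ⟨ha', e⟩)) hd, fun h => absurd h e⟩
  obtain ⟨b, hb, n, hd⟩ := h2.hit h1 hT ha
  refine Finset.sum_lt_sum (fun b hb => ?_) ⟨b, hb, ?_⟩
  · obtain ⟨a', ha', hd⟩ := spec b hb
    exact (key b hb a' ha' hd).1
  · obtain ⟨a', ha', hd'⟩ := spec b hb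
    exact (key b hb a' ha' hd').2 (h1.1.desc_unique ha' ha hd' hd)

lemma expStep_wf {T : Finset C.Ch} (hT : T ∈ C.X) :
    WellFounded fun Q P => C.ExpStep T P Q :=
  Subrelation.wf (r := InvImage (· < ·) fun P => ∑ b ∈ T, C.depth P b)
    (fun h => h.depth_lt hT) (InvImage.wf _ wellFounded_lt)

lemma reach_of_refines {T P : Finset C.Ch} (hT : T ∈ C.X) (hP : P ∈ C.X) (h : C.Refines P T) :
    Relation.ReflTransGen (C.ExpStep T) P T := by
  induction P using (expStep_wf hT).induction with | _ P ih
  by_cases hex : ∃ a ∈ P, a ∉ T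
  · obtain ⟨a, ha, haT⟩ := hex
    have st : C.ExpStep T P (C.expand a P) := ⟨hP, h, a, ha, haT, rfl⟩
    exact .head st (ih _ st st.mem st.refines)
  · push Not at hex
    suffices P = T by rw [this]
    refine Finset.Subset.antisymm hex fun b hb => ?_
    obtain ⟨a, ha, n, hd⟩ := h b hb
    rw [← hT.1.desc_unique (hex a ha) hb hd (show C.Desc b 0 b from rfl)]
    exact ha

lemma expand_comm {P : Finset C.Ch} (hP : C.Code P) {a b : C.Ch} (ha : a ∈ P) (hb : b ∈ P)
    (hab : a ≠ b) : C.expand a (C.expand b P) = C.expand b (C.expand a P) := by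
  have d1 := hP.disjoint (A := {a}) (A' := C.kids a) (by simpa using ha)
    (by rw [Supp_singleton, Supp_kids])
  have d2 := hP.disjoint (A := {b}) (A' := C.kids b) (by simpa using hb)
    (by rw [Supp_singleton, Supp_kids])
  have q1 : b ∉ C.kids a := fun h => Finset.disjoint_left.1 d1 (by simp [hb, hab.symm]) h
  have q2 : a ∉ C.kids b := fun h => Finset.disjoint_left.1 d2 (by simp [ha, hab]) h
  ext x
  simp only [mem_expand]
  grind

lemma card_kids (a : C.Ch) : (C.kids a).card = Multiset.card (C.ch (C.ty a)) := by
  rw [← C.ty_kids, Multiset.card_map]; rfl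

variable (C) in
/-- The number of pieces in any elementary subdivision is at most `κ`, and `κ`, `k` are
positive. -/
def Large (κ k : ℕ) : Prop := 1 ≤ k ∧ 1 ≤ κ ∧ ∀ v, Multiset.card (C.ch v) ≤ κ

lemma Large.move {κ k : ℕ} (h : C.Large κ k) (a : C.Ch) : (C.moves κ k).M {a} (C.kids a) := by
  refine ⟨1, h.1, Walk.succ.2 ⟨{a}, Walk.refl (code_singleton a) (by simpa using h.2.1),
    Or.inl ⟨code_singleton a, a, by simp, by simp [expand, MoveSystem.tr]⟩, ?_⟩⟩
  rw [card_kids]; exact h.2.2 _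

lemma Large.R_expand {κ k : ℕ} (h : C.Large κ k) {P : Finset C.Ch} (hP : P ∈ C.X) {a : C.Ch}
    (ha : a ∈ P) : (C.moves κ k).R P (C.expand a P) :=
  (MoveSystem.RJ_tr (S := C.moves κ k) hP (by simpa using ha) (h.move a)).R hP
    (expand_mem_X hP ha)

variable (C) in
/-- Directedness of the set of subdivisions, together with the absence of cycles. -/
structure Cofinal (T : ℕ → Finset C.Ch) : Prop where
  acyclic : ∀ (a : C.Ch) (n : ℕ), C.Desc a n a → n = 0
  mem : ∀ N, T N ∈ C.X
  succ : ∀ N, C.Refines (T N) (T (N + 1))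
  exists_refines : ∀ P ∈ C.X, ∃ N, C.Refines P (T N)

variable {T : ℕ → Finset C.Ch}

lemma Cofinal.refines (hT : C.Cofinal T) {M N : ℕ} (h : M ≤ N) : C.Refines (T M) (T N) := by
  induction h with
  | refl => exact .refl _
  | step _ ih => exact ih.trans (hT.succ _)

lemma Cofinal.expStep_of_refines (hT : C.Cofinal T) {S P : Finset C.Ch}
    (hP : P ∈ C.X) {a : C.Ch} (ha : a ∈ P) (h : C.Refines (C.expand a P) S)
    (hPS : C.Refines P S) : C.ExpStep S P (C.expand a P) := by
  refine ⟨hP, hPS, a, ha, fun haS => ?_, rfl⟩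
  obtain ⟨b, hb, n, hd⟩ := h a haS
  rcases mem_expand.1 hb with ⟨hb, hne⟩ | hb
  · exact hne (hP.1.desc_unique hb ha hd (show C.Desc a 0 a from rfl))
  · have := hT.acyclic a (n + 1) ⟨b, hb, hd⟩
    omega

lemma refines_expand (P : Finset C.Ch) (a : C.Ch) (ha : a ∈ P) :
    C.Refines P (C.expand a P) := by
  intro b hb
  rcases mem_expand.1 hb with ⟨hb, -⟩ | hb
  · exact ⟨b, hb, 0, rfl⟩
  · exact ⟨a, ha, 1, b, hb, rfl⟩

/-- A relation which is symmetric, transitive and contains elementary subdivisions relates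
any two subdivisions. -/
lemma Cofinal.eqv (hT : C.Cofinal T) {P Q : Finset C.Ch} (hP : P ∈ C.X) (hQ : Q ∈ C.X) :
    Relation.EqvGen (fun P Q => P ∈ C.X ∧ ∃ a ∈ P, Q = C.expand a P) P Q := by
  have key : ∀ P ∈ C.X, ∀ N, C.Refines P (T N) →
      Relation.EqvGen (fun P Q => P ∈ C.X ∧ ∃ a ∈ P, Q = C.expand a P) P (T N) := by
    intro P hP N h
    refine Relation.EqvGen.mono ?_ _ _ (eqvGen_of_reflTransGen (reach_of_refines (hT.mem N) hP h))
    rintro P Q ⟨h1, -, a, ha, -, rfl⟩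
    exact ⟨h1, a, ha, rfl⟩
  obtain ⟨M, hM⟩ := hT.exists_refines P hP
  obtain ⟨N, hN⟩ := hT.exists_refines Q hQ
  exact .trans _ _ _ (key P hP _ (hM.trans (hT.refines (le_max_left M N))))
    (.symm _ _ (key Q hQ _ (hN.trans (hT.refines (le_max_right M N)))))

lemma Cofinal.connected (hT : C.Cofinal T) {κ k : ℕ} (h : C.Large κ k) {P Q : Finset C.Ch}
    (hP : P ∈ C.X) (hQ : Q ∈ C.X) : Relation.ReflTransGen (C.moves κ k).R P Q := by
  have := hT.eqv hP hQ
  induction this with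
  | rel P Q hr => obtain ⟨h1, a, ha, rfl⟩ := hr; exact .single (h.R_expand h1 ha)
  | refl => exact .refl
  | symm P Q _ ih =>
    exact reflTransGen_symm (fun _ _ h => MoveSystem.R.symm h) (ih hQ hP)
  | trans P Q S h1 h2 ih1 ih2 =>
    have hQ' : Q ∈ C.X := by
      by_cases e : Q ∈ C.X
      · exact e
      · exfalso
        clear ih1 ih2
        have : ∀ A B, Relation.EqvGen (fun P Q => P ∈ C.X ∧ ∃ a ∈ P, Q = C.expand a P) A B →
            (A ∈ C.X ↔ B ∈ C.X) := by
          intro A B hAB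
          induction hAB with
          | rel P Q hr =>
            obtain ⟨h1, a, ha, rfl⟩ := hr
            exact ⟨fun _ => expand_mem_X h1 ha, fun _ => h1⟩
          | refl => exact Iff.rfl
          | symm _ _ _ ih => exact ih.symm
          | trans _ _ _ _ _ ih1 ih2 => exact ih1.trans ih2
        exact e ((this _ _ h1).1 hP)
    exact (ih1 hP hQ').trans (ih2 hQ' hQ)

/-- A flat cocycle on the set of all subdivisions is a coboundary. -/
theorem Cofinal.exists_potential (hT : C.Cofinal T) {κ k : ℕ} (hl : C.Large κ k) {H : Type*}
    [Group H] {c : Finset C.Ch → Finset C.Ch → H} (hc : ∀ m, (C.moves κ k).Flat m c) :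
    ∃ u : Finset C.Ch → H, ∀ P Q, (C.moves κ k).R P Q → c P Q = u P * (u Q)⁻¹ := by
  have sq : ∀ x y z w, (C.moves κ k).R x y → (C.moves κ k).R y z → (C.moves κ k).R x w →
      (C.moves κ k).R w z → c x y * c y z = c x w * c w z := fun x y z w h1 h2 h3 h4 =>
    (hc (x.card + y.card + z.card + w.card)).2 x y z w (by omega) (by omega) (by omega) (by omega)
      h1 h2 h3 h4
  have one : ∀ x ∈ C.X, c x x = 1 := fun x hx => (hc x.card).1 x hx le_rfl
  have inv : ∀ x y, (C.moves κ k).R x y → c y x = (c x y)⁻¹ := fun x y h =>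
    (hc (x.card + y.card)).inv h (by omega) (by omega)
  let r : ℕ → Finset C.Ch → Finset C.Ch → Prop := fun N => C.ExpStep (T N)
  have hr : ∀ N P Q, r N P Q → r (N + 1) P Q := by
    intro N P Q h
    have h2 := h.refines
    obtain ⟨h1, h3, a, ha, -, rfl⟩ := h
    exact hT.expStep_of_refines h1 ha (h2.trans (hT.succ N)) (h3.trans (hT.succ N))
  obtain ⟨u, hu⟩ := exists_potential_of_exhaustion r hr T
    (fun N P Q h => ⟨eqvGen_of_reflTransGen (reach_of_refines (hT.mem N) h.1 h.2.1),
      eqvGen_of_reflTransGen (reach_of_refines (hT.mem N) h.mem h.refines)⟩)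
    (fun N => eqvGen_of_reflTransGen (reach_of_refines (hT.mem _) (hT.mem N) (hT.succ N))) c (by
      intro N
      obtain ⟨u, hu⟩ := exists_potential_of_diamond (C.ExpStep (T N)) c (expStep_wf (hT.mem N)) (by
        intro P Q Q' h1 h2
        have f1 := h1.refines
        have f2 := h2.refines
        obtain ⟨hP, g1, a, ha, haT, rfl⟩ := h1
        obtain ⟨-, g2, b, hb, hbT, rfl⟩ := h2
        by_cases e : a = b
        · exact Or.inl (by rw [e])
        · have hb' : b ∈ C.expand a P := mem_expand.2 (Or.inl ⟨hb, Ne.symm e⟩)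
          have ha' : a ∈ C.expand b P := mem_expand.2 (Or.inl ⟨ha, e⟩)
          have ec := expand_comm hP.1 ha hb e
          refine Or.inr ⟨C.expand b (C.expand a P),
            ⟨expand_mem_X hP ha, f1, b, hb', hbT, rfl⟩,
            ⟨expand_mem_X hP hb, f2, a, ha', haT, ec.symm⟩, ?_⟩
          refine sq _ _ _ _ (hl.R_expand hP ha) (hl.R_expand (expand_mem_X hP ha) hb')
            (hl.R_expand hP hb) ?_
          rw [← ec]
          exact hl.R_expand (expand_mem_X hP hb) ha')
      refine ⟨u, fun P Q h => ?_⟩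
      rw [hu P Q h]; group)
  have hexp : ∀ P ∈ C.X, ∀ a ∈ P, c P (C.expand a P) = u P * (u (C.expand a P))⁻¹ := by
    intro P hP a ha
    obtain ⟨N, hN⟩ := hT.exists_refines _ (expand_mem_X hP ha)
    exact hu N _ _ (hT.expStep_of_refines hP ha hN ((refines_expand P a ha).trans hN))
  have hwalk : ∀ r ≤ k, ∀ P ∈ C.X, ∀ A ⊆ P, ∀ A', C.Walk κ r A A' →
      c P (MoveSystem.tr A A' P) = u P * (u (MoveSystem.tr A A' P))⁻¹ := by
    intro r
    induction r with
    | zero =>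
      rintro - P hP A hA A' ⟨f, rfl, rfl, -⟩
      have : MoveSystem.tr (f 0) (f 0) P = P := Finset.sdiff_union_of_subset hA
      rw [this, one P hP]; group
    | succ r ih =>
      intro hrk P hP A hA A' h
      obtain ⟨B, h1, h2, h3⟩ := Walk.succ.1 h
      have RB : (C.moves κ k).R P (MoveSystem.tr A B P) :=
        (MoveSystem.RJ_tr (S := C.moves κ k) hP hA ⟨r, by omega, h1⟩).R hP
          (MoveSystem.tr_mem (S := C.moves κ k) hP hA ⟨r, by omega, h1⟩)
      have RA : (C.moves κ k).R P (MoveSystem.tr A A' P) :=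
        (MoveSystem.RJ_tr (S := C.moves κ k) hP hA ⟨r + 1, by omega, h⟩).R hP
          (MoveSystem.tr_mem (S := C.moves κ k) hP hA ⟨r + 1, by omega, h⟩)
      have e1 := ih (by omega) P hP A hA B h1
      have trtr : ∀ B, C.Supp A = C.Supp B → ∀ B',
          MoveSystem.tr B B' (MoveSystem.tr A B P) = MoveSystem.tr A B' P := by
        intro B hB B'
        have := hP.1.disjoint hA hB
        simp only [MoveSystem.tr, Finset.union_sdiff_right]
        rw [Finset.sdiff_eq_self_of_disjoint this]
      have e2 : (C.moves κ k).R (MoveSystem.tr A B P) (MoveSystem.tr A A' P) ∧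
          c (MoveSystem.tr A B P) (MoveSystem.tr A A' P) =
            u (MoveSystem.tr A B P) * (u (MoveSystem.tr A A' P))⁻¹ := by
        rcases h2 with ⟨hB, a, ha, rfl⟩ | ⟨hA', a, ha, rfl⟩
        · have hsub : B ⊆ MoveSystem.tr A B P := Finset.subset_union_right
          have := expand_subset RB.2.1.1 hsub ha
          rw [trtr B h1.Supp_eq] at this
          rw [this]
          exact ⟨hl.R_expand RB.2.1 (hsub ha), hexp _ RB.2.1 a (hsub ha)⟩
        · have hsub : A' ⊆ MoveSystem.tr A A' P := Finset.subset_union_right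
          have := expand_subset RA.2.1.1 hsub ha
          rw [trtr A' h.Supp_eq] at this
          have hR := hl.R_expand RA.2.1 (hsub ha)
          have he := hexp _ RA.2.1 a (hsub ha)
          rw [← this] at hR he
          refine ⟨hR.symm, ?_⟩
          rw [inv _ _ hR, he]; group
      have tri := sq _ _ _ _ RB e2.1 RA (MoveSystem.R.refl RA.2.1)
      rw [one _ RA.2.1, mul_one] at tri
      rw [← tri, e1, e2.2]; group
  refine ⟨u, ?_⟩
  rintro P Q ⟨hP, hQ, I, A, A', ⟨r, hr, hw⟩, -, rfl, rfl, d1, d2⟩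
  have := hwalk r hr _ hP A Finset.subset_union_right A' hw
  have e : MoveSystem.tr A A' (I ∪ A) = I ∪ A' := by
    simp only [MoveSystem.tr, Finset.union_sdiff_right]
    rw [Finset.sdiff_eq_self_of_disjoint d1]
  rwa [e] at this

end ChartSystem

lemma Multiset.exists_monotone_subseq {V : Type*} [Finite V] (s : ℕ → Multiset V) :
    ∃ g : ℕ ↪o ℕ, ∀ m n, m ≤ n → s (g m) ≤ s (g n) := by
  have h : WellQuasiOrdered ((· ≤ ·) : (V → ℕ) → (V → ℕ) → Prop) := wellQuasiOrdered_le
  obtain ⟨g, hg⟩ := h.exists_monotone_subseq fun n v => (s n).count v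
  exact ⟨g, fun m n h => Multiset.le_iff_count.2 (hg m n h)⟩

namespace ChartSystem

variable {C : ChartSystem}

variable (C) in
/-- Two type multisets differ by an elementary subdivision. -/
def TStep (s s' : Multiset C.V) : Prop :=
  (∃ u v, s = u + {v} ∧ s' = u + C.ch v) ∨ (∃ u v, s' = u + {v} ∧ s = u + C.ch v)

variable (C) in
/-- Walks of type multisets of bounded cardinality. -/
def TWalk (κ : ℕ) : ℕ → Multiset C.V → Multiset C.V → Prop
  | 0, s, s' => s = s' ∧ Multiset.card s ≤ κ
  | r + 1, s, s' => ∃ t, TWalk κ r s t ∧ C.TStep t s' ∧ Multiset.card s' ≤ κ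

variable (C) in
/-- Equivalence of type multisets under elementary subdivisions. -/
def TEq : Multiset C.V → Multiset C.V → Prop := Relation.ReflTransGen C.TStep

/-- The types occurring in a finite set of charts. -/
def types (A : Finset C.Ch) : Multiset C.V := A.val.map C.ty

lemma card_types (A : Finset C.Ch) : Multiset.card (types A) = A.card := by
  rw [types, Multiset.card_map]; rfl

lemma TStep.symm {s s' : Multiset C.V} (h : C.TStep s s') : C.TStep s' s := Or.symm h

lemma TStep.add {s s' : Multiset C.V} (h : C.TStep s s') (t : Multiset C.V) :
    C.TStep (s + t) (s' + t) := by
  rcases h with ⟨u, v, rfl, rfl⟩ | ⟨u, v, rfl, rfl⟩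
  · exact Or.inl ⟨u + t, v, by abel, by abel⟩
  · exact Or.inr ⟨u + t, v, by abel, by abel⟩

lemma TEq.symm {s s' : Multiset C.V} (h : C.TEq s s') : C.TEq s' s :=
  reflTransGen_symm (fun _ _ h => h.symm) h

lemma TEq.trans {s t u : Multiset C.V} (h : C.TEq s t) (h' : C.TEq t u) : C.TEq s u :=
  Relation.ReflTransGen.trans h h'

lemma TEq.refl (s : Multiset C.V) : C.TEq s s := Relation.ReflTransGen.refl

lemma TEq.add {s s' : Multiset C.V} (h : C.TEq s s') (t : Multiset C.V) :
    C.TEq (s + t) (s' + t) := by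
  induction h with
  | refl => exact .refl _
  | tail _ h ih => exact Relation.ReflTransGen.tail ih (h.add t)

lemma TWalk.mono {κ κ' r : ℕ} (h : κ ≤ κ') {s s' : Multiset C.V} (hw : C.TWalk κ r s s') :
    C.TWalk κ' r s s' := by
  induction r generalizing s' with
  | zero => exact ⟨hw.1, hw.2.trans h⟩
  | succ r ih =>
    obtain ⟨t, h1, h2, h3⟩ := hw
    exact ⟨t, ih h1, h2, h3.trans h⟩

lemma TEq.exists_walk {s s' : Multiset C.V} (h : C.TEq s s') : ∃ κ r, C.TWalk κ r s s' := by
  induction h with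
  | refl => exact ⟨Multiset.card s, 0, rfl, le_rfl⟩
  | @tail t s' _ h ih =>
    obtain ⟨κ, r, hw⟩ := ih
    exact ⟨max κ (Multiset.card s'), r + 1, t, hw.mono (le_max_left _ _), h, le_max_right _ _⟩

lemma exists_subset_types {A : Finset C.Ch} {u w : Multiset C.V} (h : types A = u + w) :
    ∃ B ⊆ A, types B = w ∧ types (A \ B) = u := by
  induction w using Multiset.induction generalizing A with
  | empty => exact ⟨∅, by simp, by simp [types], by simpa using h⟩
  | cons v w ih =>
    have hv : v ∈ types A := by rw [h]; simp
    obtain ⟨a, ha, hav⟩ := Multiset.mem_map.1 hv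
    have ha : a ∈ A := ha
    have hA : types A = v ::ₘ types (A.erase a) := by
      have e := (Multiset.cons_erase ((show a ∈ A.val from ha))).symm
      rw [types, e, Multiset.map_cons, hav]; rfl
    have h' : types (A.erase a) = u + w := by
      rw [hA, Multiset.add_cons] at h
      exact (Multiset.cons_inj_right v).1 h
    obtain ⟨B, hB, h1, h2⟩ := ih h'
    have haB : a ∉ B := fun h => by simpa using hB h
    refine ⟨insert a B, ?_, ?_, ?_⟩
    · exact Finset.insert_subset ha (hB.trans (Finset.erase_subset _ _))
    · rw [types, Finset.insert_val_of_notMem haB, Multiset.map_cons, hav]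
      exact congrArg _ h1
    · rw [← h2]; congr 1; ext x; simp; tauto

lemma types_tr {A B B' : Finset C.Ch} (hd : Disjoint (A \ B) B') :
    types (MoveSystem.tr B B' A) = types (A \ B) + types B' := by
  rw [MoveSystem.tr, ← Finset.disjUnion_eq_union _ _ hd]
  simp [types, Finset.disjUnion]

lemma types_of_subset {A B : Finset C.Ch} (h : B ⊆ A) : types A = types (A \ B) + types B := by
  rw [← types_tr Finset.sdiff_disjoint, MoveSystem.tr, Finset.sdiff_union_of_subset h]

lemma types_expand {A : Finset C.Ch} (hA : C.Code A) {a : C.Ch} (ha : a ∈ A) :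
    types (C.expand a A) = types (A \ {a}) + C.ch (C.ty a) := by
  rw [expand, types_tr (hA.disjoint (by simpa using ha) (by rw [Supp_singleton, Supp_kids])),
    ← C.ty_kids]; rfl

lemma TStep.lift {A : Finset C.Ch} (hA : C.Code A) {s' : Multiset C.V}
    (h : C.TStep (types A) s') : ∃ A', C.Step A A' ∧ types A' = s' := by
  rcases h with ⟨u, v, h1, rfl⟩ | ⟨u, v, rfl, h1⟩
  · obtain ⟨B, hB, h2, h3⟩ := exists_subset_types h1
    have : B.card = 1 := by rw [← card_types, h2]; simp
    obtain ⟨a, rfl⟩ := Finset.card_eq_one.1 this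
    have ha : a ∈ A := hB (by simp)
    refine ⟨C.expand a A, Or.inl ⟨hA, a, ha, rfl⟩, ?_⟩
    have hv : C.ty a = v := by simpa [types] using h2
    rw [types_expand hA ha, h3, hv]
  · obtain ⟨B, hB, h2, h3⟩ := exists_subset_types h1
    obtain ⟨a, hav, rfl⟩ := C.merge B v (hA.mono hB) h2
    have hS : C.Supp (C.kids a) = C.Supp {a} := by rw [Supp_singleton, Supp_kids]
    have hd := hA.disjoint hB hS
    have ha : a ∈ MoveSystem.tr (C.kids a) {a} A := by simp [MoveSystem.tr]
    refine ⟨MoveSystem.tr (C.kids a) {a} A,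
      Or.inr ⟨hA.tr hB (code_singleton a) hS, a, ha, ?_⟩, ?_⟩
    · simp only [expand, MoveSystem.tr, Finset.union_sdiff_right]
      rw [Finset.sdiff_eq_self_of_disjoint hd, Finset.sdiff_union_of_subset hB]
    · rw [types_tr hd, h3, ← hav]; simp [types]

lemma TWalk.lift {A : Finset C.Ch} (hA : C.Code A) {κ r : ℕ} {s' : Multiset C.V}
    (h : C.TWalk κ r (types A) s') : ∃ A', C.Walk κ r A A' ∧ types A' = s' := by
  induction r generalizing s' with
  | zero =>
    obtain ⟨rfl, h⟩ := h
    exact ⟨A, Walk.refl hA (by rwa [card_types] at h), rfl⟩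
  | succ r ih =>
    obtain ⟨t, h1, h2, h3⟩ := h
    obtain ⟨B, hB, rfl⟩ := ih h1
    obtain ⟨A', hs, rfl⟩ := h2.lift hB.symm.code.1
    exact ⟨A', Walk.succ.2 ⟨B, hB, hs, by rwa [card_types] at h3⟩, rfl⟩

variable (C) in
/-- Type multisets which are equivalent to smaller ones. -/
def Reducible (s : Multiset C.V) : Prop := ∃ s', C.TEq s s' ∧ Multiset.card s' < Multiset.card s

variable (C) in
/-- Every reducible type multiset contains one which is reducible by a walk with bounds
`κ` and `k`. -/
def UniformlyReducible (κ k : ℕ) : Prop :=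
  ∀ s, C.Reducible s → ∃ s₀ ≤ s, ∃ s₁, Multiset.card s₁ < Multiset.card s₀ ∧
    ∃ r ≤ k, C.TWalk κ r s₀ s₁

variable (C) in
lemma exists_uniformlyReducible : ∃ κ k, C.Large κ k ∧ C.UniformlyReducible κ k := by
  by_contra! hcon
  let b : ℕ := 1 + ∑ v, Multiset.card (C.ch v)
  have hl : ∀ j, C.Large (b + j) (1 + j) := fun j => by
    refine ⟨by omega, by omega, fun v => ?_⟩
    have := Finset.single_le_sum (f := fun v => Multiset.card (C.ch v)) (fun _ _ => Nat.zero_le _)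
      (Finset.mem_univ v)
    simp only [b]; omega
  have hbad := fun j => hcon _ _ (hl j)
  simp only [UniformlyReducible, not_forall] at hbad
  choose s hs hbad using hbad
  obtain ⟨g, hg⟩ := Multiset.exists_monotone_subseq s
  obtain ⟨s', h1, h2⟩ := hs (g 0)
  obtain ⟨κ, r, hw⟩ := h1.exists_walk
  have hle : κ + r ≤ g (κ + r) := g.strictMono.id_le _
  exact hbad (g (κ + r)) ⟨s (g 0), hg 0 _ (Nat.zero_le _), s', h2, r, by omega,
    hw.mono (by omega)⟩

variable (C) in
/-- From every type one can grow any given multiset of types. -/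
def Grows : Prop := ∀ w s, ∃ r, C.TEq {w} (s + r)

lemma types_eqv {T : ℕ → Finset C.Ch} (hT : C.Cofinal T) {P Q : Finset C.Ch} (hP : P ∈ C.X)
    (hQ : Q ∈ C.X) : C.TEq (types P) (types Q) := by
  have := hT.eqv hP hQ
  clear hP hQ
  induction this with
  | rel P Q hr =>
    obtain ⟨h1, a, ha, rfl⟩ := hr
    refine Relation.ReflTransGen.single (Or.inl ⟨types (P \ {a}), C.ty a, ?_, ?_⟩)
    · rw [types_of_subset (show {a} ⊆ P by simpa using ha)]; simp [types]
    · exact types_expand h1.1 ha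
  | refl => exact .refl _
  | symm _ _ _ ih => exact ih.symm
  | trans _ _ _ _ _ ih1 ih2 => exact ih1.trans ih2

lemma reducible_of_large {T : ℕ → Finset C.Ch} (hT : C.Cofinal T) (hgrow : C.Grows) (K : ℕ) :
    ∃ n₀, ∀ P ∈ C.X, n₀ ≤ P.card → ∀ J ⊆ P, (P \ J).card ≤ K → C.Reducible (types J) := by
  by_contra! hcon
  choose P hPX hPc J hJ hK hbad using fun j => hcon (j + K + 1)
  obtain ⟨g₁, hg₁⟩ := Multiset.exists_monotone_subseq fun j => types (P j \ J j)
  obtain ⟨g₂, hg₂⟩ := Multiset.exists_monotone_subseq fun j => types (J (g₁ j))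
  let F : ℕ → Multiset C.V := fun j => types (P (g₁ (g₂ j)) \ J (g₁ (g₂ j)))
  let Q : ℕ → Multiset C.V := fun j => types (J (g₁ (g₂ j)))
  have hF : ∀ i j, i ≤ j → F i ≤ F j := fun i j h => hg₁ _ _ (g₂.monotone h)
  have hQ : ∀ i j, i ≤ j → Q i ≤ Q j := hg₂
  have hFK : ∀ i, Multiset.card (F i) ≤ K := fun i => by
    simp only [F, card_types]; exact hK _
  have hFQ : ∀ i, types (P (g₁ (g₂ i))) = F i + Q i := fun i => types_of_subset (hJ _)
  have hcard : ∀ i, i + K + 1 ≤ Multiset.card (F i) + Multiset.card (Q i) := fun i => by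
    rw [← Multiset.card_add, ← hFQ, card_types]
    have h1 : i ≤ g₂ i := g₂.strictMono.id_le i
    have h2 : g₂ i ≤ g₁ (g₂ i) := g₁.strictMono.id_le _
    have := hPc (g₁ (g₂ i))
    omega
  obtain ⟨i, hi⟩ : ∃ i, ∀ m, i ≤ m → F m = F i := by
    have hbdd : ∃ b, ∀ i, Multiset.card (F i) ≤ b := ⟨K, hFK⟩
    have hne : ∃ i, ∀ j, Multiset.card (F j) ≤ Multiset.card (F i) := by
      have hfin : (Set.range fun i => Multiset.card (F i)).Finite :=
        (Set.finite_Iic K).subset (by rintro _ ⟨i, rfl⟩; exact hFK i)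
      obtain ⟨x, ⟨i, rfl⟩, hx⟩ := Set.exists_max_image _ id hfin ⟨_, 0, rfl⟩
      exact ⟨i, fun j => hx _ ⟨j, rfl⟩⟩
    obtain ⟨i, hi⟩ := hne
    exact ⟨i, fun m hm => (Multiset.eq_of_le_of_card_le (hF i m hm) (hi m)).symm⟩
  let m := i + Multiset.card (F i) + Multiset.card (Q i) + 1
  have him : i ≤ m := by omega
  obtain ⟨z, hz⟩ := Multiset.le_iff_exists_add.1 (hQ i m him)
  have hz0 : 0 < Multiset.card z := by
    have h1 := hcard m
    rw [hi m him, hz, Multiset.card_add] at h1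
    omega
  have hq : 0 < Multiset.card (Q i) := by have := hcard i; have := hFK i; omega
  obtain ⟨w, hw⟩ := Multiset.card_pos_iff_exists_mem.1 hq
  have heq : C.TEq (F i + Q i) (F i + Q i + z) := by
    have := types_eqv hT (hPX (g₁ (g₂ i))) (hPX (g₁ (g₂ m)))
    rw [hFQ, hFQ, hi m him, hz, ← add_assoc] at this
    exact this
  obtain ⟨r, hr⟩ := hgrow w (F i + Q i)
  have hwz : C.TEq ({w} + z) {w} := by
    refine (hr.add z).trans (TEq.trans ?_ hr.symm)
    have := (heq.symm).add r
    rwa [add_right_comm] at this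
  obtain ⟨q, hq'⟩ := Multiset.exists_cons_of_mem hw
  refine absurd (show C.Reducible (Q m) from ⟨Q i, ?_, ?_⟩) (by
    have := hbad (g₁ (g₂ m))
    simpa [Reducible] using this)
  · have := hwz.add q
    rw [hz, hq', ← Multiset.singleton_add]
    rwa [add_right_comm] at this
  · rw [hz, Multiset.card_add]; omega

theorem exists_hasDescents {T : ℕ → Finset C.Ch} (hT : C.Cofinal T) (hgrow : C.Grows) {κ k : ℕ}
    (h : C.UniformlyReducible κ k) (K : ℕ) : ∃ n₀, (C.moves κ k).HasDescents K n₀ := by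
  obtain ⟨n₀, hn⟩ := reducible_of_large hT hgrow K
  refine ⟨n₀, fun P hP hPc J hJ hJK => ?_⟩
  obtain ⟨s₀, hs, s₁, hlt, r, hr, hw⟩ := h _ (hn P hP hPc J hJ hJK)
  obtain ⟨u, hu⟩ := Multiset.le_iff_exists_add.1 hs
  rw [add_comm] at hu
  obtain ⟨A, hA, rfl, -⟩ := exists_subset_types hu
  obtain ⟨A', hw', rfl⟩ := hw.lift (hP.1.mono (hA.trans hJ))
  exact ⟨A, A', ⟨r, hr, hw'⟩, hA, by simpa [card_types] using hlt⟩

/-- Growth follows from transitivity and branching of the subdivision rule. -/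
lemma grows_of_reach (hreach : ∀ v w, Relation.ReflTransGen (fun v w => w ∈ C.ch v) v w)
    (hbranch : ∃ v, 2 ≤ Multiset.card (C.ch v)) : C.Grows := by
  have h1 : ∀ v w, ∃ r, C.TEq {v} ({w} + r) := by
    intro v w
    induction hreach v w with
    | refl => exact ⟨0, by rw [add_zero]; exact .refl _⟩
    | @tail x y _ h ih =>
      obtain ⟨r, hr⟩ := ih
      obtain ⟨q, hq⟩ := Multiset.exists_cons_of_mem h
      refine ⟨q + r, hr.trans (Relation.ReflTransGen.single (Or.inl ⟨r, x, add_comm _ _, ?_⟩))⟩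
      rw [hq, ← Multiset.singleton_add]; abel
  obtain ⟨v₀, hv₀⟩ := hbranch
  obtain ⟨a, s, hs⟩ : ∃ a s, C.ch v₀ = a ::ₘ s := by
    obtain ⟨a, ha⟩ := Multiset.card_pos_iff_exists_mem.1 (show 0 < Multiset.card (C.ch v₀) by omega)
    exact ⟨a, Multiset.exists_cons_of_mem ha⟩
  obtain ⟨b, t, ht⟩ : ∃ b t, s = b ::ₘ t := by
    have : 0 < Multiset.card s := by rw [hs, Multiset.card_cons] at hv₀; omega
    obtain ⟨b, hb⟩ := Multiset.card_pos_iff_exists_mem.1 this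
    exact ⟨b, Multiset.exists_cons_of_mem hb⟩
  have h2 : ∀ w v, ∃ r, C.TEq {w} ({w} + {v} + r) := by
    intro w v
    obtain ⟨r₁, e₁⟩ := h1 w v₀
    obtain ⟨r₂, e₂⟩ := h1 a w
    obtain ⟨r₃, e₃⟩ := h1 b v
    refine ⟨r₂ + r₃ + t + r₁, e₁.trans ?_⟩
    have e₀ : C.TEq ({v₀} + r₁) ({a} + ({b} + t + r₁)) := by
      refine Relation.ReflTransGen.single (Or.inl ⟨r₁, v₀, add_comm _ _, ?_⟩)
      rw [hs, ht, ← Multiset.singleton_add, ← Multiset.singleton_add]; abel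
    refine e₀.trans ((e₂.add _).trans ?_)
    have := e₃.add ({w} + r₂ + t + r₁)
    convert this using 1 <;> abel
  have h3 : ∀ w s, ∃ r, C.TEq {w} (s + ({w} + r)) := by
    intro w s
    induction s using Multiset.induction with
    | empty => exact ⟨0, by simp only [zero_add, add_zero]; exact .refl _⟩
    | cons v s ih =>
      obtain ⟨r, hr⟩ := ih
      obtain ⟨r', hr'⟩ := h2 w v
      refine ⟨r' + r, hr.trans ?_⟩
      have := hr'.add (s + r)
      rw [← Multiset.singleton_add]
      convert this using 1 <;> abel
  exact fun w s => (h3 w s).imp' _ fun r hr => hr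

end ChartSystem

namespace ChartSystem

open scoped Pointwise

variable {C : ChartSystem}

variable (C) in
/-- A group acting on the points and charts of a chart system, such that the subdivisions of
the whole space are classified by their types and have finite stabilizers. -/
structure Acts (G : Type) [Group G] [MulAction G C.Pt] [MulAction G C.Ch] : Prop where
  supp_smul : ∀ (g : G) a, C.supp (g • a) = g • C.supp a
  kids_smul : ∀ (g : G) a, C.kids (g • a) = g • C.kids a
  transitive : ∀ P ∈ C.X, ∀ Q ∈ C.X, types P = types Q → ∃ g : G, g • P = Q
  finite_stab : ∀ P ∈ C.X, ∀ Q ∈ C.X, {g : G | g • P = Q}.Finite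

section

variable {G : Type} [Group G] [MulAction G C.Pt] [MulAction G C.Ch]

lemma Acts.code (hG : C.Acts G) (g : G) {A : Finset C.Ch} (h : C.Code A) : C.Code (g • A) := by
  intro k hk l hl hne
  obtain ⟨k', hk', rfl⟩ := Finset.mem_smul_finset.1 hk
  obtain ⟨l', hl', rfl⟩ := Finset.mem_smul_finset.1 hl
  rw [hG.supp_smul, hG.supp_smul, Set.disjoint_smul_set]
  exact h k' hk' l' hl' fun e => hne (e ▸ rfl)

lemma Acts.mem_X (hG : C.Acts G) (g : G) {P : Finset C.Ch} (h : P ∈ C.X) : g • P ∈ C.X := by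
  refine ⟨hG.code g h.1, Set.eq_univ_of_forall fun x => ?_⟩
  have : g⁻¹ • x ∈ C.Supp P := h.2 ▸ Set.mem_univ _
  obtain ⟨k, hk, hx⟩ := mem_Supp.1 this
  refine mem_Supp.2 ⟨g • k, Finset.smul_mem_smul_finset hk, ?_⟩
  rwa [hG.supp_smul, Set.mem_smul_set_iff_inv_smul_mem]

lemma Acts.step (hG : C.Acts G) (g : G) {A A' : Finset C.Ch} (h : C.Step A A') :
    C.Step (g • A) (g • A') := by
  have key : ∀ {A : Finset C.Ch} {a}, g • C.expand a A = C.expand (g • a) (g • A) := by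
    intro A a
    rw [expand, expand, MoveSystem.tr, MoveSystem.tr, Finset.smul_finset_union,
      Finset.smul_finset_sdiff, Finset.smul_finset_singleton, hG.kids_smul]
  rcases h with ⟨h, a, ha, rfl⟩ | ⟨h, a, ha, rfl⟩
  · exact Or.inl ⟨hG.code g h, g • a, Finset.smul_mem_smul_finset ha, key⟩
  · exact Or.inr ⟨hG.code g h, g • a, Finset.smul_mem_smul_finset ha, key⟩

lemma Acts.walk (hG : C.Acts G) (g : G) {κ r : ℕ} {A A' : Finset C.Ch} (h : C.Walk κ r A A') :
    C.Walk κ r (g • A) (g • A') := by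
  obtain ⟨f, rfl, rfl, h1, h2⟩ := h
  refine ⟨fun i => g • f i, rfl, rfl, fun i hi => hG.step g (h1 i hi), fun i hi => ?_⟩
  exact ⟨hG.code g (h2 i hi).1, by rw [Finset.card_smul_finset]; exact (h2 i hi).2⟩

lemma Acts.adjacent (hG : C.Acts G) (g : G) {κ k : ℕ} {P Q : Finset C.Ch}
    (h : (C.moves κ k).R P Q) : (C.moves κ k).R (g • P) (g • Q) := by
  obtain ⟨hP, hQ, I, A, A', ⟨r, hr, hw⟩, -, rfl, rfl, h1, h2⟩ := h
  refine ⟨hG.mem_X g hP, hG.mem_X g hQ, g • I, g • A, g • A', ⟨r, hr, hG.walk g hw⟩,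
    Finset.empty_subset _, Finset.smul_finset_union, Finset.smul_finset_union, ?_, ?_⟩
  · exact (Finset.disjoint_image (MulAction.injective g)).2 h1
  · exact (Finset.disjoint_image (MulAction.injective g)).2 h2

theorem Acts.finitelyPresentedGroup (hG : C.Acts G) {T : ℕ → Finset C.Ch} (hT : C.Cofinal T)
    (hgrow : C.Grows) : FinitelyPresentedGroup G := by
  obtain ⟨κ, k, hl, hu⟩ := exists_uniformlyReducible (C := C)
  let S := C.moves κ k
  obtain ⟨n₀, hD⟩ := exists_hasDescents hT hgrow hu (22 * κ)
  let n := n₀ + 2 * κ + (T 0).card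
  have hn : n₀ + 2 * S.κ ≤ n := Nat.le_add_right _ _
  let Ω := {P : Finset C.Ch // P ∈ C.X ∧ P.card ≤ n}
  let _ : MulAction G Ω :=
    { smul := fun g P => ⟨g • P.1, hG.mem_X g P.2.1, by
        rw [Finset.card_smul_finset]; exact P.2.2⟩
      one_smul := fun P => Subtype.ext (one_smul G P.1)
      mul_smul := fun g h P => Subtype.ext (mul_smul g h P.1) }
  have hsmul : ∀ (g : G) (P : Ω), (g • P).1 = g • P.1 := fun _ _ => rfl
  refine finitelyPresentedGroup_of_action (Ω := Ω) (fun P Q => S.R P.1 Q.1)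
    (fun P => MoveSystem.R.refl P.2.1) (fun _ _ h => h.symm) (fun g _ _ h => hG.adjacent g h)
    ⟨T 0, hT.mem 0, Nat.le_add_left _ _⟩ ?_ ?_ ?_ ?_ ?_
  · exact fun P => Set.Finite.preimage (f := Subtype.val) Subtype.val_injective.injOn
      (finite_adjacent κ k P.1)
  · intro P Q
    refine (hG.finite_stab P.1 P.2.1 Q.1 Q.2.1).subset ?_
    intro g hg
    exact (hsmul g P).symm.trans (congrArg Subtype.val hg)
  · have hfin : {s : Multiset C.V | Multiset.card s ≤ n}.Finite := by
      have : {s : Multiset C.V | Multiset.card s ≤ n} ⊆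
          ⋃ i ∈ Set.Iic n, Set.range fun s : Sym C.V i => (s : Multiset C.V) := by
        intro s hs
        simp only [Set.mem_iUnion]
        exact ⟨_, hs, ⟨s, rfl⟩, rfl⟩
      exact ((Set.finite_Iic n).biUnion fun i _ => Set.finite_range _).subset this
    have hfin' : (Set.range fun P : Ω => types P.1).Finite :=
      hfin.subset (by rintro _ ⟨P, rfl⟩; simpa [card_types] using P.2.2)
    choose f hf using fun s : Set.range fun P : Ω => types P.1 => s.2
    have := hfin'.to_subtype
    refine ⟨Set.range f, Set.finite_range f, fun P => ?_⟩
    obtain ⟨g, hg⟩ := hG.transitive _ (f ⟨_, P, rfl⟩).2.1 _ P.2.1 (hf ⟨_, P, rfl⟩)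
    exact ⟨g, _, ⟨_, rfl⟩, Subtype.ext hg.symm⟩
  · intro P Q
    have h := MoveSystem.connected_le hD hn P.2.2 Q.2.2 (hT.connected hl P.2.1 Q.2.1)
    obtain ⟨P, hP⟩ := P
    obtain ⟨Q, hQ⟩ := Q
    dsimp only at h
    induction h with
    | refl => exact .refl
    | @tail P' Q' _ h ih =>
      exact (ih ⟨h.1.1, h.2.1⟩).tail h.1
  · intro H _ c hc1 hc
    let c₀ : Finset C.Ch → Finset C.Ch → H := fun P Q =>
      if h : (P ∈ C.X ∧ P.card ≤ n) ∧ Q ∈ C.X ∧ Q.card ≤ n then c ⟨P, h.1⟩ ⟨Q, h.2⟩ else 1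
    have hc₀ : ∀ P Q : Ω, c₀ P.1 Q.1 = c P Q := fun P Q => dif_pos ⟨P.2, Q.2⟩
    have hflat : S.Flat n c₀ := by
      refine ⟨fun P hP hPn => ?_, fun x y z w hx hy hz hw xy yz xw wz => ?_⟩
      · exact (hc₀ ⟨P, hP, hPn⟩ ⟨P, hP, hPn⟩).trans (hc1 _)
      · have := hc ⟨x, xy.1, hx⟩ ⟨y, xy.2.1, hy⟩ ⟨z, yz.2.1, hz⟩ ⟨w, wz.1, hw⟩ xy yz xw wz
        simpa only [← hc₀] using this
    obtain ⟨c', hc', he⟩ := hflat.extend_all hD hn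
    obtain ⟨u, hu⟩ := hT.exists_potential hl hc'
    refine ⟨fun P => (u P.1)⁻¹, fun P Q h => ?_⟩
    rw [inv_inv, ← hc₀, ← he _ _ h P.2.2 Q.2.2, hu _ _ h]

end

end ChartSystem

namespace FinDigraph

variable {Γ : FinDigraph}

/-! ### Finite words and infinite paths -/

/-- Prepend an edge to a sequence. -/
def cons (e : Γ.E) (x : ℕ → Γ.E) : ℕ → Γ.E
  | 0 => e
  | n + 1 => x n

/-- Prepend a word to a sequence. -/
def app : List Γ.E → (ℕ → Γ.E) → ℕ → Γ.E
  | [], x => x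
  | e :: l, x => cons e (app l x)

/-- The sequence without its first `n` terms. -/
def dropSeq (n : ℕ) (x : ℕ → Γ.E) : ℕ → Γ.E := fun i => x (i + n)

/-- The first `n` terms of a sequence. -/
def pre : ℕ → (ℕ → Γ.E) → List Γ.E
  | 0, _ => []
  | n + 1, x => x 0 :: pre n (dropSeq 1 x)

variable (Γ) in
/-- The infinite paths with origin `v`. -/
def Cn (v : Γ.V) : Set (ℕ → Γ.E) := {x | x ∈ Γ.shift ∧ Γ.o (x 0) = v}

lemma cons_dropSeq (x : ℕ → Γ.E) : cons (x 0) (dropSeq 1 x) = x := by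
  funext i; cases i <;> rfl

lemma dropSeq_cons (e : Γ.E) (x : ℕ → Γ.E) : dropSeq 1 (cons e x) = x := rfl

lemma app_append (l m : List Γ.E) (x : ℕ → Γ.E) : app (l ++ m) x = app l (app m x) := by
  induction l with
  | nil => rfl
  | cons e l ih => simp only [List.cons_append, app, ih]

lemma app_get (l : List Γ.E) (x : ℕ → Γ.E) (i : ℕ) (h : i < l.length) :
    app l x i = l.get ⟨i, h⟩ := by
  induction l generalizing i with
  | nil => simp at h
  | cons e l ih =>
    cases i with
    | zero => rfl
    | succ i => exact ih i (by simpa using h)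

lemma app_ge (l : List Γ.E) (x : ℕ → Γ.E) (i : ℕ) : app l x (i + l.length) = x i := by
  induction l with
  | nil => rfl
  | cons e l ih => exact ih

lemma length_pre (n : ℕ) (x : ℕ → Γ.E) : (pre n x).length = n := by
  induction n generalizing x with
  | zero => rfl
  | succ n ih => simp [pre, ih]

lemma app_pre (n : ℕ) (x : ℕ → Γ.E) : app (pre n x) (dropSeq n x) = x := by
  induction n generalizing x with
  | zero => rfl
  | succ n ih =>
    have : dropSeq (n + 1) x = dropSeq n (dropSeq 1 x) := by
      funext i; simp only [dropSeq]; congr 1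
    rw [pre, app, this, ih, cons_dropSeq]

lemma pre_app (l : List Γ.E) (x : ℕ → Γ.E) : pre l.length (app l x) = l := by
  induction l with
  | nil => rfl
  | cons e l ih => simp only [List.length_cons, pre, app, dropSeq_cons, ih]; rfl

lemma pre_add (n k : ℕ) (x : ℕ → Γ.E) : pre (n + k) x = pre n x ++ pre k (dropSeq n x) := by
  have h := pre_app (pre n x ++ pre k (dropSeq n x)) (dropSeq k (dropSeq n x))
  rwa [app_append, app_pre, app_pre, List.length_append, length_pre, length_pre] at h

lemma app_injective (l : List Γ.E) : Function.Injective (app l) := by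
  intro x y h
  funext i
  rw [← app_ge l x, h, app_ge]

lemma exists_append_of_app_eq {l m : List Γ.E} {x y : ℕ → Γ.E} (h : app l x = app m y)
    (hlm : l.length ≤ m.length) : ∃ r, m = l ++ r := by
  obtain ⟨k, hk⟩ := Nat.exists_eq_add_of_le hlm
  refine ⟨pre k (dropSeq l.length (app m y)), ?_⟩
  have hm := pre_app m y
  rw [← h, hk, pre_add, pre_app, h] at hm
  exact hm.symm

lemma eq_of_app_self {l : List Γ.E} (hl : l ≠ []) {x y : ℕ → Γ.E} (hx : app l x = x)
    (hy : app l y = y) : x = y := by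
  have h0 : 0 < l.length := List.length_pos_iff.2 hl
  funext i
  induction i using Nat.strong_induction_on with
  | _ i ih =>
    by_cases h : i < l.length
    · rw [← hx, ← hy, app_get _ _ _ h, app_get _ _ _ h]
    · obtain ⟨j, rfl⟩ := Nat.exists_eq_add_of_le' (not_lt.1 h)
      rw [← hx, ← hy, app_ge, app_ge]
      exact ih j (by omega)

lemma pathOk_append {v : Γ.V} {l m : List Γ.E} :
    Γ.pathOk v (l ++ m) ↔ Γ.pathOk v l ∧ Γ.pathOk (Γ.pathEndAux v l) m := by
  induction l generalizing v with
  | nil => simp [pathOk, pathEndAux]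
  | cons e l ih => simp [pathOk, pathEndAux, ih, and_assoc]

lemma pathEndAux_append (v : Γ.V) (l m : List Γ.E) :
    Γ.pathEndAux v (l ++ m) = Γ.pathEndAux (Γ.pathEndAux v l) m := by
  induction l generalizing v with
  | nil => rfl
  | cons e l ih => exact ih _

lemma cons_mem_shift {e : Γ.E} {x : ℕ → Γ.E} : cons e x ∈ Γ.shift ↔ x ∈ Γ.Cn (Γ.t e) := by
  constructor
  · exact fun h => ⟨fun i => h (i + 1), (h 0).symm⟩
  · rintro ⟨h, h0⟩ (_ | i)
    · exact h0.symm
    · exact h i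

lemma app_mem_Cn {v : Γ.V} {l : List Γ.E} (hl : Γ.pathOk v l) {x : ℕ → Γ.E} :
    app l x ∈ Γ.Cn v ↔ x ∈ Γ.Cn (Γ.pathEndAux v l) := by
  induction l generalizing v with
  | nil => rfl
  | cons e l ih =>
    rw [pathEndAux, ← ih hl.2, ← cons_mem_shift]
    exact ⟨fun h => h.1, fun h => ⟨h, hl.1⟩⟩

lemma dropSeq_mem_shift {x : ℕ → Γ.E} (hx : x ∈ Γ.shift) (n : ℕ) : dropSeq n x ∈ Γ.shift := by
  intro i
  have := hx (i + n)
  rwa [add_right_comm] at this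

lemma pathOk_pre {x : ℕ → Γ.E} (hx : x ∈ Γ.shift) (n : ℕ) :
    Γ.pathOk (Γ.o (x 0)) (pre n x) := by
  induction n generalizing x with
  | zero => trivial
  | succ n ih =>
    refine ⟨rfl, ?_⟩
    rw [hx 0]
    exact ih (dropSeq_mem_shift hx 1)

lemma pathEndAux_pre {x : ℕ → Γ.E} (hx : x ∈ Γ.shift) (n : ℕ) :
    Γ.pathEndAux (Γ.o (x 0)) (pre n x) = Γ.o (x n) := by
  induction n generalizing x with
  | zero => rfl
  | succ n ih =>
    rw [pre, pathEndAux, hx 0]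
    exact ih (dropSeq_mem_shift hx 1)

lemma mem_cone_iff {α : Γ.FinPath} {x : ℕ → Γ.E} :
    x ∈ Γ.cone α ↔ ∃ y ∈ Γ.Cn (Γ.pathEnd α), x = app α.edges y := by
  constructor
  · rintro ⟨hx, h0, h⟩
    have : app α.edges (dropSeq α.edges.length x) = x := by
      funext i
      by_cases hi : i < α.edges.length
      · rw [app_get _ _ _ hi, h i hi]
      · obtain ⟨j, rfl⟩ := Nat.exists_eq_add_of_le' (not_lt.1 hi)
        rw [app_ge]; rfl
    refine ⟨_, ?_, this.symm⟩
    rw [pathEnd, ← app_mem_Cn α.ok, this]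
    exact ⟨hx, h0⟩
  · rintro ⟨y, hy, rfl⟩
    have := (app_mem_Cn α.ok).2 hy
    exact ⟨this.1, this.2, fun i hi => app_get _ _ _ hi⟩

lemma splice_app (α β : Γ.FinPath) (y : ℕ → Γ.E) :
    Γ.splice α β (app α.edges y) = app β.edges y := by
  funext i
  rw [splice]
  split_ifs with h
  · rw [app_get _ _ _ h]
  · obtain ⟨j, rfl⟩ := Nat.exists_eq_add_of_le' (not_lt.1 h)
    rw [Nat.add_sub_cancel, app_ge, app_ge]

/-! ### The irreducible core -/

variable (Γ) in
/-- A set of nodes which is closed under outgoing edges, strongly connected, and contains a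
branching node. -/
structure Core (W : Set Γ.V) : Prop where
  closed : ∀ e, Γ.o e ∈ W → Γ.t e ∈ W
  reach : ∀ v ∈ W, ∀ w ∈ W, ∃ l, Γ.pathOk v l ∧ Γ.pathEndAux v l = w
  out : ∀ v ∈ W, ∃ e, Γ.o e = v
  branch : ∃ v ∈ W, ∃ e e', e ≠ e' ∧ Γ.o e = v ∧ Γ.o e' = v

lemma exists_last_edge {W : Set Γ.V} {u : Γ.V} {l : List Γ.E} (hne : l ≠ [])
    (hl : ∀ e ∈ l, Γ.InducedEdge W e) : ∃ e, Γ.InducedEdge W e ∧ Γ.t e = Γ.pathEndAux u l := by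
  induction l generalizing u with
  | nil => exact absurd rfl hne
  | cons e l ih =>
    by_cases h : l = []
    · subst h; exact ⟨e, hl e (by simp), rfl⟩
    · exact ih h fun e' he' => hl e' (List.mem_cons_of_mem _ he')

lemma HasIrreducibleCore.exists_core (h : Γ.HasIrreducibleCore) :
    ∃ W, Γ.Core W ∧ ∃ N, ∀ x ∈ Γ.shift, ∀ n, N ≤ n → Γ.o (x n) ∈ W := by
  obtain ⟨W, ⟨hirr, hcyc⟩, -, N, hN⟩ := h
  have hpath : ∀ n, ∀ v ∈ W, ∃ u l, Γ.pathOk u l ∧ l.length = n ∧ Γ.pathEndAux u l = v := by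
    intro n
    induction n with
    | zero => exact fun v _ => ⟨v, [], trivial, rfl, rfl⟩
    | succ n ih =>
      intro v hv
      obtain ⟨α, -, h2, h3, h4⟩ := hirr v hv v hv
      obtain ⟨e, he, hev⟩ := exists_last_edge (u := α.start) h3 h4.2
      obtain ⟨u, l, h5, h6, h7⟩ := ih (Γ.o e) he.1
      refine ⟨u, l ++ [e], pathOk_append.2 ⟨h5, h7.symm, trivial⟩, by simp [h6], ?_⟩
      rw [pathEndAux_append]
      exact hev.trans h2
  have hclosed : ∀ e, Γ.o e ∈ W → Γ.t e ∈ W := by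
    intro e he
    cases N with
    | zero => exact hN (Γ.trivPath (Γ.t e)) rfl
    | succ N =>
      obtain ⟨u, l, h5, h6, h7⟩ := hpath N _ he
      have := hN ⟨u, l ++ [e], pathOk_append.2 ⟨h5, h7.symm, trivial⟩⟩ (by simp [h6])
      simpa [pathEnd, pathEndAux_append, pathEndAux] using this
  have hout : ∀ v ∈ W, ∃ e, Γ.InducedEdge W e ∧ Γ.o e = v := by
    intro v hv
    obtain ⟨⟨u, l, hok⟩, rfl, -, h3, h4⟩ := hirr v hv v hv
    cases l with
    | nil => exact absurd rfl h3
    | cons e l => exact ⟨e, h4.2 e (by simp), hok.1⟩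
  refine ⟨W, ⟨hclosed, ?_, fun v hv => (hout v hv).imp fun e he => he.2, ?_⟩, N, ?_⟩
  · intro v hv w hw
    obtain ⟨α, rfl, h2, -, -⟩ := hirr v hv w hw
    exact ⟨α.edges, α.ok, h2⟩
  · by_contra hcon
    refine hcyc fun v hv => ?_
    obtain ⟨e, he⟩ := hout v hv
    refine ⟨e, he, fun e' he' => ?_⟩
    by_contra hne
    exact hcon ⟨v, hv, e', e, hne, he'.2, he.2⟩
  · intro x hx n hn
    obtain ⟨k, rfl⟩ := Nat.exists_eq_add_of_le' hn
    have := hN ⟨Γ.o (x k), pre N (dropSeq k x), by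
      have := pathOk_pre (dropSeq_mem_shift hx k) N
      simpa [dropSeq] using this⟩ (length_pre _ _)
    have h2 := pathEndAux_pre (dropSeq_mem_shift hx k) N
    simp only [dropSeq, zero_add] at h2
    rw [add_comm k N, ← h2]
    exact this

lemma Core.pathEnd_mem {W : Set Γ.V} (hW : Γ.Core W) {v : Γ.V} (hv : v ∈ W) {l : List Γ.E}
    (hl : Γ.pathOk v l) : Γ.pathEndAux v l ∈ W := by
  induction l generalizing v with
  | nil => exact hv
  | cons e l ih => exact ih (hW.closed e (hl.1 ▸ hv)) hl.2

lemma Core.exists_mem_Cn {W : Set Γ.V} (hW : Γ.Core W) {v : Γ.V} (hv : v ∈ W) :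
    (Γ.Cn v).Nonempty := by
  have : Nonempty Γ.E := (hW.out v hv).nonempty
  choose! f hf using hW.out
  have key : ∀ i, (fun u => Γ.t (f u))^[i] v ∈ W := by
    intro i
    induction i with
    | zero => exact hv
    | succ i ih =>
      rw [Function.iterate_succ_apply']
      exact hW.closed _ (by rw [hf _ ih]; exact ih)
  refine ⟨fun i => f ((fun u => Γ.t (f u))^[i] v), fun i => ?_, hf v hv⟩
  rw [hf _ (key (i + 1)), Function.iterate_succ_apply']

lemma Core.exists_ne {W : Set Γ.V} (hW : Γ.Core W) {v : Γ.V} (hv : v ∈ W) :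
    ∃ x ∈ Γ.Cn v, ∃ y ∈ Γ.Cn v, x ≠ y := by
  obtain ⟨w, hw, e, e', hne, he, he'⟩ := hW.branch
  obtain ⟨l, hl, hlw⟩ := hW.reach v hv w hw
  obtain ⟨x, hx⟩ := hW.exists_mem_Cn (hW.closed e (he ▸ hw))
  obtain ⟨y, hy⟩ := hW.exists_mem_Cn (hW.closed e' (he' ▸ hw))
  refine ⟨app l (cons e x), (app_mem_Cn hl).2 (hlw ▸ ⟨cons_mem_shift.2 hx, he⟩),
    app l (cons e' y), (app_mem_Cn hl).2 (hlw ▸ ⟨cons_mem_shift.2 hy, he'⟩), fun h => hne ?_⟩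
  exact congrFun (app_injective l h) 0

end FinDigraph

namespace FinDigraph

/-! ### Charts -/

/-- A partial parametrization of `E` by infinite paths, labelled by a node. -/
@[ext] structure Raw (Γ : FinDigraph) (E : Set (ℕ → Γ.E)) : Type where
  v : Γ.V
  f : (ℕ → Γ.E) → Option ↥E

variable {Γ : FinDigraph} {E : Set (ℕ → Γ.E)}

namespace Raw

/-- The restriction of a chart to the paths beginning with a given word. -/
def sub (a : Γ.Raw E) (l : List Γ.E) : Γ.Raw E := ⟨Γ.pathEndAux a.v l, fun x => a.f (app l x)⟩

/-- Postcomposition with a permutation. -/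
def act (g : Equiv.Perm ↥E) (a : Γ.Raw E) : Γ.Raw E := ⟨a.v, fun x => (a.f x).map g⟩

variable (E) in
/-- The identity chart on the paths with origin `v`. -/
def base (v : Γ.V) : Γ.Raw E :=
  ⟨v, fun x => if h : x ∈ E ∧ Γ.o (x 0) = v then some ⟨x, h.1⟩ else none⟩

/-- The canonical charts of cones. -/
def IsCone (a : Γ.Raw E) : Prop := ∃ v l, Γ.pathOk v l ∧ a = (base E v).sub l

/-- Charts all of whose sufficiently small parts are canonical charts of cones. -/
def Tame (a : Γ.Raw E) : Prop :=
  ∃ n, ∀ l, n ≤ l.length → Γ.pathOk a.v l → (a.sub l).IsCone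

/-- The domain of the chart consists of all paths with origin `a.v`. -/
def Total (a : Γ.Raw E) : Prop := ∀ x, x ∈ Γ.Cn a.v ↔ ∃ p, a.f x = some p

/-- Injectivity of the parametrization. -/
def Inj (a : Γ.Raw E) : Prop := ∀ x y p, a.f x = some p → a.f y = some p → x = y

/-- The admissible charts. -/
structure Good (W : Set Γ.V) (a : Γ.Raw E) : Prop where
  mem : a.v ∈ W
  total : a.Total
  inj : a.Inj
  tame : a.Tame

/-- The image of the parametrization. -/
def im (a : Γ.Raw E) : Set ↥E := {p | ∃ x, a.f x = some p}

lemma sub_sub (a : Γ.Raw E) (l m : List Γ.E) : (a.sub l).sub m = a.sub (l ++ m) := by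
  simp only [sub, pathEndAux_append, app_append]

lemma act_sub (g : Equiv.Perm ↥E) (a : Γ.Raw E) (l : List Γ.E) :
    (a.sub l).act g = (a.act g).sub l := rfl

lemma act_mul (g h : Equiv.Perm ↥E) (a : Γ.Raw E) : a.act (g * h) = (a.act h).act g := by
  simp [act, Option.map_map, Equiv.Perm.coe_mul]

lemma act_one (a : Γ.Raw E) : a.act 1 = a := by
  simp [act]

lemma base_sub_eq_some {v : Γ.V} {l : List Γ.E} {x : ℕ → Γ.E} {p : ↥E} :
    ((base E v).sub l).f x = some p ↔ p.1 = app l x ∧ Γ.o (p.1 0) = v := by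
  simp only [sub, base]
  split_ifs with h
  · rw [Option.some_inj]
    constructor
    · rintro rfl; exact ⟨rfl, h.2⟩
    · rintro ⟨h1, -⟩; exact Subtype.ext h1.symm
  · simp only [false_iff, not_and]
    intro h1 h2
    exact h ⟨h1 ▸ p.2, h1 ▸ h2⟩

lemma base_sub_mem_Cn (hE : E ⊆ Γ.shift) {v : Γ.V} {l : List Γ.E} (hl : Γ.pathOk v l)
    {x : ℕ → Γ.E} {p : ↥E} (h : ((base E v).sub l).f x = some p) :
    x ∈ Γ.Cn (Γ.pathEndAux v l) := by
  obtain ⟨h1, h2⟩ := base_sub_eq_some.1 h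
  rw [← app_mem_Cn hl, ← h1]
  exact ⟨hE p.2, h2⟩

lemma IsCone.sub {a : Γ.Raw E} (h : a.IsCone) {l : List Γ.E} (hl : Γ.pathOk a.v l) :
    (a.sub l).IsCone := by
  obtain ⟨v, m, hm, rfl⟩ := h
  exact ⟨v, m ++ l, pathOk_append.2 ⟨hm, hl⟩, sub_sub _ _ _⟩

lemma IsCone.tame {a : Γ.Raw E} (h : a.IsCone) : a.Tame := ⟨0, fun _ _ hl => h.sub hl⟩

lemma Tame.sub {a : Γ.Raw E} (h : a.Tame) {l : List Γ.E} (hl : Γ.pathOk a.v l) :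
    (a.sub l).Tame := by
  obtain ⟨n, hn⟩ := h
  refine ⟨n, fun m hm hmok => ?_⟩
  rw [sub_sub]
  exact hn _ (by rw [List.length_append]; omega) (pathOk_append.2 ⟨hl, hmok⟩)

lemma Total.sub {a : Γ.Raw E} (h : a.Total) {l : List Γ.E} (hl : Γ.pathOk a.v l) :
    (a.sub l).Total := by
  intro x
  rw [show (a.sub l).v = Γ.pathEndAux a.v l from rfl, ← app_mem_Cn hl]
  exact h _

lemma Inj.sub {a : Γ.Raw E} (h : a.Inj) (l : List Γ.E) : (a.sub l).Inj :=
  fun _ _ p hx hy => app_injective l (h _ _ p hx hy)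

lemma base_inj (v : Γ.V) : (base E v).Inj := by
  intro x y p hx hy
  have h1 := (base_sub_eq_some (l := [])).1 hx
  have h2 := (base_sub_eq_some (l := [])).1 hy
  exact h1.1.symm.trans h2.1

lemma Good.sub {W : Set Γ.V} (hW : Γ.Core W) {a : Γ.Raw E} (h : a.Good W) {l : List Γ.E}
    (hl : Γ.pathOk a.v l) : (a.sub l).Good W :=
  ⟨hW.pathEnd_mem h.mem hl, h.total.sub hl, h.inj.sub l, h.tame.sub hl⟩

lemma act_eq_some {g : Equiv.Perm ↥E} {a : Γ.Raw E} {x : ℕ → Γ.E} {p : ↥E} :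
    (a.act g).f x = some p ↔ a.f x = some (g⁻¹ p) := by
  simp only [act, Option.map_eq_some_iff]
  constructor
  · rintro ⟨q, hq, rfl⟩; simpa using hq
  · exact fun h => ⟨_, h, by simp⟩

lemma Total.act {a : Γ.Raw E} (h : a.Total) (g : Equiv.Perm ↥E) : (a.act g).Total := by
  intro x
  refine (h x).trans ⟨?_, ?_⟩
  · rintro ⟨p, hp⟩; exact ⟨g p, act_eq_some.2 (by simpa using hp)⟩
  · rintro ⟨p, hp⟩; exact ⟨_, act_eq_some.1 hp⟩

lemma Inj.act {a : Γ.Raw E} (h : a.Inj) (g : Equiv.Perm ↥E) : (a.act g).Inj :=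
  fun x y _ hx hy => h x y _ (act_eq_some.1 hx) (act_eq_some.1 hy)

lemma Good.act {W : Set Γ.V} {a : Γ.Raw E} (h : a.Good W) {g : Equiv.Perm ↥E}
    (ht : (a.act g).Tame) : (a.act g).Good W :=
  ⟨h.mem, h.total.act g, h.inj.act g, ht⟩

lemma im_act (g : Equiv.Perm ↥E) (a : Γ.Raw E) : (a.act g).im = g '' a.im := by
  ext p
  simp only [im, Set.mem_ofPred_eq, act_eq_some, Set.mem_image]
  constructor
  · rintro ⟨x, hx⟩; exact ⟨_, ⟨x, hx⟩, by simp⟩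
  · rintro ⟨q, ⟨x, hx⟩, rfl⟩; exact ⟨x, by simpa using hx⟩

lemma Good.im_nonempty {W : Set Γ.V} (hW : Γ.Core W) {a : Γ.Raw E} (h : a.Good W) :
    a.im.Nonempty := by
  obtain ⟨x, hx⟩ := hW.exists_mem_Cn h.mem
  obtain ⟨p, hp⟩ := (h.total x).1 hx
  exact ⟨p, x, hp⟩

/-- Any point in the image of a chart lies in a part of prescribed depth. -/
lemma Total.exists_sub {a : Γ.Raw E} (h : a.Total) {p : ↥E} (hp : p ∈ a.im) (n : ℕ) :
    ∃ l, l.length = n ∧ Γ.pathOk a.v l ∧ p ∈ (a.sub l).im := by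
  obtain ⟨x, hx⟩ := hp
  have hxC := (h x).2 ⟨p, hx⟩
  refine ⟨pre n x, length_pre _ _, hxC.2 ▸ pathOk_pre hxC.1 n, dropSeq n x, ?_⟩
  simpa only [Raw.sub, app_pre] using hx

/-- Parts of the same depth which meet coincide. -/
lemma Inj.sub_unique {a : Γ.Raw E} (h : a.Inj) {l m : List Γ.E} (hlm : l.length = m.length)
    {p : ↥E} (hl : p ∈ (a.sub l).im) (hm : p ∈ (a.sub m).im) : l = m := by
  obtain ⟨x, hx⟩ := hl
  obtain ⟨y, hy⟩ := hm
  have := h _ _ p hx hy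
  rw [← pre_app l x, this, hlm, pre_app]

/-- A chart is determined by its parts of depth one. -/
lemma Total.ext {a b : Γ.Raw E} (ha : a.Total) (hb : b.Total) (hv : a.v = b.v)
    (h : ∀ e, Γ.o e = a.v → a.sub [e] = b.sub [e]) : a = b := by
  refine Raw.ext hv (funext fun x => ?_)
  by_cases hx : x ∈ Γ.Cn a.v
  · have := congrArg (fun c => c.f (dropSeq 1 x)) (h (x 0) hx.2)
    simpa only [Raw.sub, app, cons_dropSeq] using this
  · have h1 : a.f x = none := by
      rw [Option.eq_none_iff_forall_ne_some]
      exact fun p hp => hx ((ha x).2 ⟨p, hp⟩)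
    have h2 : b.f x = none := by
      rw [Option.eq_none_iff_forall_ne_some]
      exact fun p hp => hx (hv ▸ (hb x).2 ⟨p, hp⟩)
    rw [h1, h2]

/-- A chart all of whose parts of depth one are tame is tame. -/
lemma tame_of_sub {a : Γ.Raw E} (h : ∀ e, Γ.o e = a.v → (a.sub [e]).Tame) : a.Tame := by
  choose! n hn using h
  refine ⟨1 + ∑ e, n e, fun l hl hok => ?_⟩
  cases l with
  | nil => simp at hl
  | cons e l =>
    have h1 := Finset.single_le_sum (f := n) (fun _ _ => Nat.zero_le _) (Finset.mem_univ e)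
    rw [List.length_cons] at hl
    exact hn e hok.1 l (by omega) hok.2

lemma finite_words (n : ℕ) : {l : List Γ.E | l.length = n}.Finite := List.finite_length_eq _ _

/-- Deep parts of a tame chart are charts of long words. -/
lemma Tame.exists_deep {a : Γ.Raw E} (h : a.Tame) (N : ℕ) :
    ∃ n, ∀ l, n ≤ l.length → Γ.pathOk a.v l →
      ∃ v m, Γ.pathOk v m ∧ N ≤ m.length ∧ a.sub l = (base E v).sub m := by
  obtain ⟨n, hn⟩ := h
  refine ⟨n + N, fun l hl hok => ?_⟩
  rw [← List.take_append_drop n l, pathOk_append] at hok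
  obtain ⟨v, m, hm, he⟩ := hn (l.take n) (by rw [List.length_take]; omega) hok.1
  have hv : Γ.pathEndAux v m = Γ.pathEndAux a.v (l.take n) := (congrArg Raw.v he).symm
  refine ⟨v, m ++ l.drop n, pathOk_append.2 ⟨hm, hv ▸ hok.2⟩, ?_, ?_⟩
  · rw [List.length_append, List.length_drop]; omega
  · rw [← sub_sub, ← he, sub_sub, List.take_append_drop]

/-- The cones of sufficiently long words which meet the image of a tame chart are deep parts of
this chart. -/
lemma exists_eq_sub {a : Γ.Raw E} (ht : a.Total) (h : a.Tame) (K : ℕ) :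
    ∃ N, ∀ v m p, N ≤ m.length → Γ.pathOk v m → p ∈ ((base E v).sub m).im → p ∈ a.im →
      ∃ l, K ≤ l.length ∧ Γ.pathOk a.v l ∧ (base E v).sub m = a.sub l := by
  obtain ⟨n, hn⟩ := h
  have hn' : ∀ l : List Γ.E, ∃ N, l.length = n + K → Γ.pathOk a.v l →
      ∃ v m, Γ.pathOk v m ∧ m.length = N ∧ a.sub l = (base E v).sub m := by
    intro l
    by_cases hl : l.length = n + K ∧ Γ.pathOk a.v l
    · obtain ⟨v, m, h1, h2⟩ := hn l (by omega) hl.2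
      exact ⟨m.length, fun _ _ => ⟨v, m, h1, rfl, h2⟩⟩
    · exact ⟨0, fun h1 h2 => absurd ⟨h1, h2⟩ hl⟩
  choose N hN using hn'
  refine ⟨∑ l ∈ (finite_words (Γ := Γ) (n + K)).toFinset, N l, fun v m p hm hok hp hpa => ?_⟩
  obtain ⟨l, hl, hlok, x, hx⟩ := ht.exists_sub hpa (n + K)
  obtain ⟨v', m', hok', hlen, he⟩ := hN l hl hlok
  have hle : m'.length ≤ m.length := by
    rw [hlen]
    refine le_trans ?_ hm
    exact Finset.single_le_sum (f := N) (fun _ _ => Nat.zero_le _) (by simpa using hl)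
  obtain ⟨y, hy⟩ := hp
  rw [he] at hx
  obtain ⟨hx1, hx2⟩ := base_sub_eq_some.1 hx
  obtain ⟨hy1, hy2⟩ := base_sub_eq_some.1 hy
  obtain ⟨r, rfl⟩ := exists_append_of_app_eq (hx1.symm.trans hy1) hle
  have hvv : v' = v := hx2.symm.trans hy2
  subst hvv
  refine ⟨l ++ r, by rw [List.length_append]; omega, ?_, ?_⟩
  · refine pathOk_append.2 ⟨hlok, ?_⟩
    have : Γ.pathEndAux a.v l = Γ.pathEndAux v' m' := congrArg Raw.v he
    rw [this]
    exact (pathOk_append.1 hok).2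
  · rw [← sub_sub, ← sub_sub, he]

lemma mem_base_im {v : Γ.V} {l : List Γ.E} {p : ↥E} :
    p ∈ ((base E v).sub l).im ↔ (∃ x, p.1 = app l x) ∧ Γ.o (p.1 0) = v := by
  simp only [im, Set.mem_ofPred_eq, base_sub_eq_some, exists_and_right]

/-- A total canonical chart parametrizes the cone. -/
lemma image_im_eq_cone (hE : E ⊆ Γ.shift) {α : Γ.FinPath}
    (h : ((base E α.start).sub α.edges).Total) :
    Subtype.val '' ((base E α.start).sub α.edges).im = Γ.cone α := by
  ext x
  rw [mem_cone_iff]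
  constructor
  · rintro ⟨p, ⟨y, hy⟩, rfl⟩
    exact ⟨y, base_sub_mem_Cn hE α.ok hy, (base_sub_eq_some.1 hy).1⟩
  · rintro ⟨y, hy, rfl⟩
    obtain ⟨p, hp⟩ := (h y).1 hy
    exact ⟨p, ⟨y, hp⟩, (base_sub_eq_some.1 hp).1⟩

end Raw

/-- Words of length at least `N₀` detect membership in `E`, and lead to the core. -/
structure Depth (W : Set Γ.V) (E : Set (ℕ → Γ.E)) (N₀ : ℕ) : Prop where
  mem : ∀ x ∈ E, ∀ y ∈ Γ.shift, (∀ i < N₀, x i = y i) → Γ.o (x 0) = Γ.o (y 0) → y ∈ E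
  core : ∀ x ∈ Γ.shift, ∀ n, N₀ ≤ n → Γ.o (x n) ∈ W

lemma Depth.good {W : Set Γ.V} {N₀ : ℕ} (h : Depth W E N₀) (hE : E ⊆ Γ.shift) (p : ↥E) {n : ℕ}
    (hn : N₀ ≤ n) : ((Raw.base E (Γ.o (p.1 0))).sub (pre n p.1)).Good W := by
  have hp := hE p.2
  have hok := pathOk_pre hp n
  refine ⟨?_, fun x => ⟨fun hx => ?_, ?_⟩, (Raw.base_inj _).sub _,
    Raw.IsCone.tame ⟨_, _, hok, rfl⟩⟩
  · have := h.core _ hp n hn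
    rwa [← pathEndAux_pre hp n] at this
  · have hx' := (app_mem_Cn hok).2 hx
    refine ⟨⟨app (pre n p.1) x, h.mem p.1 p.2 _ hx'.1 ?_ hx'.2.symm⟩,
      Raw.base_sub_eq_some.2 ⟨rfl, hx'.2⟩⟩
    intro i hi
    have hi' : i < (pre n p.1).length := by rw [length_pre]; omega
    rw [app_get _ _ _ hi', ← app_get _ (dropSeq n p.1) _ hi', app_pre]
  · rintro ⟨q, hq⟩
    exact Raw.base_sub_mem_Cn hE hok hq

lemma Depth.mem_im (p : ↥E) (n : ℕ) :
    p ∈ ((Raw.base E (Γ.o (p.1 0))).sub (pre n p.1)).im :=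
  Raw.mem_base_im.2 ⟨⟨_, (app_pre n p.1).symm⟩, rfl⟩

end FinDigraph

/-- Two finite families with the same multiset of values are matched by a bijection. -/
lemma exists_equiv_of_map_eq {α β V : Type*} [Fintype α] [Fintype β] {f : α → V} {g : β → V}
    (h : (Finset.univ : Finset α).val.map f = (Finset.univ : Finset β).val.map g) :
    ∃ e : α ≃ β, ∀ a, g (e a) = f a := by
  have hc : ∀ v, Nonempty ({a // f a = v} ≃ {b // g b = v}) := by
    intro v
    rw [← Fintype.card_eq, Fintype.card_subtype, Fintype.card_subtype]
    have := congrArg (Multiset.count v) h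
    rw [Multiset.count_map, Multiset.count_map] at this
    simp only [eq_comm (a := v)] at this
    exact this
  exact ⟨Equiv.ofFiberEquiv fun v => (hc v).some, fun a => Equiv.ofFiberEquiv_map _ a⟩

namespace FinDigraph

variable {Γ : FinDigraph} {E : Set (ℕ → Γ.E)} {W : Set Γ.V}

/-- Charts with disjoint images can be assembled along the edges issuing from a node. -/
lemma Raw.exists_glue {v : Γ.V} (hv : v ∈ W) (φ : {e // Γ.o e = v} → {a : Γ.Raw E // a.Good W})
    (hφ : ∀ e e', e ≠ e' → Disjoint (φ e).1.im (φ e').1.im)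
    (hty : ∀ e, (φ e).1.v = Γ.t e.1) :
    ∃ a : Γ.Raw E, a.Good W ∧ a.v = v ∧ ∀ e : {e // Γ.o e = v}, a.sub [e.1] = (φ e).1 := by
  let a : Γ.Raw E := ⟨v, fun x =>
    if h : x ∈ Γ.Cn v then (φ ⟨x 0, h.2⟩).1.f (dropSeq 1 x) else none⟩
  have hsub : ∀ e : {e // Γ.o e = v}, a.sub [e.1] = (φ e).1 := by
    intro e
    refine Raw.ext (hty e).symm (funext fun x => ?_)
    have hiff : cons e.1 x ∈ Γ.Cn v ↔ x ∈ Γ.Cn (Γ.t e.1) := by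
      rw [← cons_mem_shift]; exact ⟨fun h => h.1, fun h => ⟨h, e.2⟩⟩
    change (if h : cons e.1 x ∈ Γ.Cn v then (φ ⟨e.1, h.2⟩).1.f x else none) = _
    split_ifs with h
    · rfl
    · rw [eq_comm, Option.eq_none_iff_forall_ne_some]
      intro p hp
      have := ((φ e).2.total x).2 ⟨p, hp⟩
      rw [hty] at this
      exact h (hiff.2 this)
  have hf : ∀ x p, a.f x = some p →
      ∃ h : x ∈ Γ.Cn v, (φ ⟨x 0, h.2⟩).1.f (dropSeq 1 x) = some p := by
    intro x p hx
    simp only [a] at hx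
    split_ifs at hx with h
    exact ⟨h, hx⟩
  refine ⟨a, ⟨hv, fun x => ⟨fun hx => ?_, fun ⟨p, hp⟩ => (hf x p hp).1⟩, ?_, ?_⟩, rfl, hsub⟩
  · obtain ⟨p, hp⟩ := ((φ ⟨x 0, hx.2⟩).2.total (dropSeq 1 x)).1 (by
      rw [hty, ← cons_mem_shift, cons_dropSeq]; exact hx.1)
    exact ⟨p, by simp only [a]; rw [dif_pos hx, hp]⟩
  · intro x y p hx hy
    obtain ⟨h1, h2⟩ := hf x p hx
    obtain ⟨h3, h4⟩ := hf y p hy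
    have hxy : x 0 = y 0 := by
      by_contra hne
      exact Set.disjoint_left.1 (hφ ⟨x 0, h1.2⟩ ⟨y 0, h3.2⟩ fun h => hne (congrArg Subtype.val h))
        ⟨_, h2⟩ ⟨_, h4⟩
    have he : (⟨x 0, h1.2⟩ : {e // Γ.o e = v}) = ⟨y 0, h3.2⟩ := Subtype.ext hxy
    rw [he] at h2
    have := (φ _).2.inj _ _ _ h2 h4
    rw [← cons_dropSeq x, ← cons_dropSeq y, this, hxy]
  · refine Raw.tame_of_sub fun e he => ?_
    rw [hsub ⟨e, he⟩]
    exact (φ _).2.tame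

variable (E) in
/-- The chart system of all good charts. -/
def charts (hW : Γ.Core W) : ChartSystem where
  Pt := ↥E
  Ch := {a : Γ.Raw E // a.Good W}
  V := ↥W
  fintypeV := Fintype.ofFinite _
  supp a := a.1.im
  kids a := Finset.univ.image fun e : {e // Γ.o e = a.1.v} =>
    ⟨a.1.sub [e.1], a.2.sub hW ⟨e.2, trivial⟩⟩
  ty a := ⟨a.1.v, a.2.mem⟩
  ch v := (Finset.univ : Finset {e // Γ.o e = v.1}).val.map fun e =>
    ⟨Γ.t e.1, hW.closed _ (e.2.symm ▸ v.2)⟩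
  supp_nonempty a := a.2.im_nonempty hW
  supp_kids a := by
    ext p
    simp only [Finset.mem_image, Finset.mem_univ, true_and, Set.mem_iUnion, exists_prop]
    constructor
    · rintro ⟨_, ⟨e, rfl⟩, x, hx⟩
      exact ⟨_, hx⟩
    · intro hp
      obtain ⟨l, hl, hok, hpl⟩ := a.2.total.exists_sub hp 1
      obtain ⟨e, rfl⟩ := List.length_eq_one_iff.1 hl
      exact ⟨_, ⟨⟨e, hok.1⟩, rfl⟩, hpl⟩
  disj_kids a k hk l hl hne := by
    simp only [Finset.mem_image, Finset.mem_univ, true_and] at hk hl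
    obtain ⟨e, rfl⟩ := hk
    obtain ⟨e', rfl⟩ := hl
    rw [Set.disjoint_left]
    intro p hp hp'
    have := a.2.inj.sub_unique (l := [e.1]) (m := [e'.1]) rfl hp hp'
    rw [List.cons.injEq] at this
    exact hne (by rw [Subtype.ext (a1 := e) (a2 := e') this.1])
  ty_kids a := by
    rw [Finset.image_val_of_injOn, Multiset.map_map]
    · rfl
    · intro e _ e' _ h
      have h' : a.1.sub [e.1] = a.1.sub [e'.1] := congrArg Subtype.val h
      obtain ⟨p, hp⟩ := (a.2.sub hW (l := [e.1]) ⟨e.2, trivial⟩).im_nonempty hW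
      have := a.2.inj.sub_unique (l := [e.1]) (m := [e'.1]) rfl hp (h' ▸ hp)
      rw [List.cons.injEq] at this
      exact Subtype.ext this.1
  merge A v hA hty := by
    obtain ⟨v, hv⟩ := v
    have hty' : (Finset.univ : Finset {e // Γ.o e = v}).val.map
        (fun e => (⟨Γ.t e.1, hW.closed _ (e.2.symm ▸ hv)⟩ : ↥W)) =
        (Finset.univ : Finset ↥A).val.map fun a => (⟨a.1.1.v, a.1.2.mem⟩ : ↥W) := by
      rw [← hty, Finset.univ_eq_attach, Finset.attach_val]
      exact (Multiset.attach_map_val' A.val fun a => (⟨a.1.v, a.2.mem⟩ : ↥W)).symm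
    obtain ⟨φ, hφ⟩ := exists_equiv_of_map_eq hty'
    obtain ⟨a, ha, rfl, hsub⟩ := Raw.exists_glue hv (fun e => (φ e).1)
      (fun e e' hne => hA _ (φ e).2 _ (φ e').2 fun h => hne (φ.injective (Subtype.ext h)))
      (fun e => congrArg Subtype.val (hφ e))
    refine ⟨⟨a, ha⟩, rfl, ?_⟩
    ext k
    simp only [Finset.mem_image, Finset.mem_univ, true_and]
    constructor
    · rintro ⟨e, rfl⟩
      have : (⟨a.sub [e.1], ha.sub hW ⟨e.2, trivial⟩⟩ : {a : Γ.Raw E // a.Good W}) = (φ e).1 :=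
        Subtype.ext (hsub e)
      exact this ▸ (φ e).2
    · intro hk
      refine ⟨φ.symm ⟨k, hk⟩, Subtype.ext ((hsub _).trans ?_)⟩
      rw [Equiv.apply_symm_apply]
  finite_merge A := by
    let F : {a : Γ.Raw E // a.Good W} → Γ.V × (Γ.E → Set ↥A) := fun a =>
      (a.1.v, fun e => {k | k.1.1 = a.1.sub [e]})
    refine Set.Finite.of_injOn (f := F) (t := Set.univ) (fun _ _ => Set.mem_univ _) ?_
      Set.finite_univ
    intro a ha b hb hab
    have hv : a.1.v = b.1.v := congrArg Prod.fst hab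
    refine Subtype.ext (a.2.total.ext b.2.total hv fun e he => ?_)
    have hk : (⟨a.1.sub [e], a.2.sub hW ⟨he, trivial⟩⟩ : {a : Γ.Raw E // a.Good W}) ∈ A := by
      have := Finset.mem_image_of_mem (fun e : {e // Γ.o e = a.1.v} =>
        (⟨a.1.sub [e.1], a.2.sub hW ⟨e.2, trivial⟩⟩ : {a : Γ.Raw E // a.Good W}))
        (Finset.mem_univ ⟨e, he⟩)
      exact ha ▸ this
    have h1 : (⟨_, hk⟩ : ↥A) ∈ (F a).2 e := rfl
    rw [hab] at h1
    exact h1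

end FinDigraph

namespace FinDigraph

variable {Γ : FinDigraph} {E : Set (ℕ → Γ.E)} {W : Set Γ.V}

lemma mem_charts_kids {hW : Γ.Core W} {a b : (charts E hW).Ch} :
    b ∈ (charts E hW).kids a ↔ ∃ e, Γ.o e = a.1.v ∧ b.1 = a.1.sub [e] := by
  refine (Finset.mem_image (β := {a : Γ.Raw E // a.Good W})).trans ?_
  constructor
  · rintro ⟨e, -, rfl⟩; exact ⟨e.1, e.2, rfl⟩
  · rintro ⟨e, he, h⟩; exact ⟨⟨e, he⟩, Finset.mem_univ _, Subtype.ext h.symm⟩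

lemma charts_desc {hW : Γ.Core W} {a b : (charts E hW).Ch} {n : ℕ} :
    (charts E hW).Desc a n b ↔ ∃ l, l.length = n ∧ Γ.pathOk a.1.v l ∧ b.1 = a.1.sub l := by
  induction n generalizing a with
  | zero =>
    constructor
    · rintro rfl; exact ⟨[], rfl, trivial, rfl⟩
    · rintro ⟨l, hl, -, h⟩
      obtain rfl := List.length_eq_zero_iff.1 hl
      exact Subtype.ext h.symm
  | succ n ih =>
    constructor
    · rintro ⟨k, hk, h⟩
      obtain ⟨e, he, hk⟩ := mem_charts_kids.1 hk
      obtain ⟨l, hl, hok, hb⟩ := ih.1 h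
      rw [hk] at hok hb
      exact ⟨e :: l, by simp [hl], ⟨he, hok⟩, hb⟩
    · rintro ⟨l, hl, hok, hb⟩
      cases l with
      | nil => simp at hl
      | cons e l =>
        refine ⟨⟨a.1.sub [e], a.2.sub hW ⟨hok.1, trivial⟩⟩,
          mem_charts_kids.2 ⟨e, hok.1, rfl⟩, ih.2 ⟨l, by simpa using hl, hok.2, hb⟩⟩

lemma charts_grows (hW : Γ.Core W) : (charts E hW).Grows := by
  have hch : ∀ (v : ↥W) (e : Γ.E) (he : Γ.o e = v.1),
      (⟨Γ.t e, hW.closed _ (he.symm ▸ v.2)⟩ : ↥W) ∈ (charts E hW).ch v := fun v e he =>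
    Multiset.mem_map.2 ⟨⟨e, he⟩, Finset.mem_univ_val _, rfl⟩
  refine ChartSystem.grows_of_reach ?_ ?_
  · rintro ⟨v, hv⟩ ⟨w, hw⟩
    obtain ⟨l, hl, hlw⟩ := hW.reach v hv w hw
    induction l generalizing v with
    | nil => cases hlw; exact .refl
    | cons e l ih =>
      exact Relation.ReflTransGen.head (hch ⟨v, hv⟩ e hl.1) (ih _ _ hl.2 hlw)
  · obtain ⟨v, hv, e, e', hne, he, he'⟩ := hW.branch
    refine ⟨⟨v, hv⟩, ?_⟩
    refine le_of_le_of_eq ?_ (Multiset.card_map _ _).symm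
    have : ({⟨e, he⟩, ⟨e', he'⟩} : Finset {e // Γ.o e = v}).card = 2 :=
      Finset.card_pair fun h => hne (congrArg Subtype.val h)
    rw [← this]
    exact Finset.card_le_card (Finset.subset_univ _)

lemma finite_level (hW : Γ.Core W) (n : ℕ) :
    {a : (charts E hW).Ch | ∃ v l, l.length = n ∧ Γ.pathOk v l ∧
      a.1 = (Raw.base E v).sub l}.Finite := by
  have h : ((fun q : Γ.V × List Γ.E => (Raw.base E q.1).sub q.2) ''
      (Set.univ ×ˢ {l | l.length = n})).Finite :=
    (Set.finite_univ.prod (Raw.finite_words n)).image _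
  refine (h.preimage (f := Subtype.val) Subtype.val_injective.injOn).subset ?_
  rintro a ⟨v, l, hl, -, ha⟩
  exact ⟨(v, l), ⟨trivial, hl⟩, ha.symm⟩

/-- The canonical charts of all cones of a given depth. -/
def level (E : Set (ℕ → Γ.E)) (hW : Γ.Core W) (n : ℕ) : Finset (charts E hW).Ch :=
  (finite_level hW n).toFinset

lemma mem_level {hW : Γ.Core W} {n : ℕ} {a : (charts E hW).Ch} :
    a ∈ level E hW n ↔ ∃ v l, l.length = n ∧ Γ.pathOk v l ∧ a.1 = (Raw.base E v).sub l := by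
  simp [level]

/-- The canonical chart of the cone of depth `n` around a point. -/
def nbhd (hW : Γ.Core W) {N₀ : ℕ} (h : Depth W E N₀) (hE : E ⊆ Γ.shift) (p : ↥E) {n : ℕ}
    (hn : N₀ ≤ n) : (charts E hW).Ch := ⟨_, h.good hE p hn⟩

lemma exists_mem_charts_supp {hW : Γ.Core W} (a : (charts E hW).Ch) : ∃ p, p ∈ a.1.im :=
  a.2.im_nonempty hW

lemma level_mem_X (hW : Γ.Core W) {N₀ : ℕ} (h : Depth W E N₀) (hE : E ⊆ Γ.shift) {n : ℕ}
    (hn : N₀ ≤ n) : level E hW n ∈ (charts E hW).X := by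
  constructor
  · intro k hk l hl hne
    change Disjoint k.1.im l.1.im
    rw [Set.disjoint_left]
    intro p hp hp'
    obtain ⟨v, m, h1, h2, h3⟩ := mem_level.1 hk
    obtain ⟨v', m', h1', h2', h3'⟩ := mem_level.1 hl
    rw [h3] at hp
    rw [h3'] at hp'
    obtain ⟨⟨x, hx⟩, hv⟩ := Raw.mem_base_im.1 hp
    obtain ⟨⟨y, hy⟩, hv'⟩ := Raw.mem_base_im.1 hp'
    have hm : m = m' := by rw [← pre_app m x, ← hx, hy, h1, ← h1', pre_app]
    exact hne (Subtype.ext (by rw [h3, h3', hm, ← hv, ← hv']))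
  · refine Set.eq_univ_of_forall fun p => ChartSystem.mem_Supp.2 ⟨nbhd hW h hE p hn, ?_, ?_⟩
    · exact mem_level.2 ⟨_, _, length_pre _ _, pathOk_pre (hE p.2) n, rfl⟩
    · exact Depth.mem_im p n

lemma exists_refines_level (hW : Γ.Core W) {P : Finset (charts E hW).Ch}
    (hP : P ∈ (charts E hW).X) (K : ℕ) : ∃ N, ∀ v m, N ≤ m.length → Γ.pathOk v m →
      ((Raw.base E v).sub m).im.Nonempty → ∃ a ∈ P, ∃ l, K ≤ l.length ∧ Γ.pathOk a.1.v l ∧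
        (Raw.base E v).sub m = a.1.sub l := by
  choose N hN using fun a : (charts E hW).Ch => Raw.exists_eq_sub a.2.total a.2.tame K
  refine ⟨∑ a ∈ P, N a, fun v m hm hok ⟨p, hp⟩ => ?_⟩
  obtain ⟨a, ha, hpa⟩ := ChartSystem.mem_Supp.1 (hP.2 ▸ Set.mem_univ p)
  obtain ⟨l, hl⟩ := hN a v m p
    ((Finset.single_le_sum (fun _ _ => Nat.zero_le _) ha).trans hm) hok hp hpa
  exact ⟨a, ha, l, hl⟩

lemma charts_cofinal (hW : Γ.Core W) {N₀ : ℕ} (h : Depth W E N₀) (hE : E ⊆ Γ.shift) :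
    (charts E hW).Cofinal fun n => level E hW (N₀ + n) where
  acyclic a n hd := by
    obtain ⟨l, hl, hok, ha⟩ := charts_desc.1 hd
    by_contra hn
    have hne : l ≠ [] := by rintro rfl; exact hn hl.symm
    obtain ⟨x, hx, y, hy, hxy⟩ := hW.exists_ne a.2.mem
    have key : ∀ x ∈ Γ.Cn a.1.v, app l x = x := by
      intro x hx
      obtain ⟨p, hp⟩ := (a.2.total x).1 hx
      have : a.1.f (app l x) = some p := by
        rw [ha] at hp; exact hp
      exact a.2.inj _ _ p this hp
    exact hxy (eq_of_app_self hne (key x hx) (key y hy))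
  mem N := level_mem_X hW h hE (Nat.le_add_right _ _)
  succ N b hb := by
    obtain ⟨v, m, hm, hok, hbm⟩ := mem_level.1 hb
    obtain ⟨p, hp⟩ := exists_mem_charts_supp b
    rw [hbm] at hp
    obtain ⟨⟨x, hx⟩, hv⟩ := Raw.mem_base_im.1 hp
    refine ⟨nbhd hW h hE p (Nat.le_add_right N₀ N), ?_, 1, charts_desc.2 ?_⟩
    · exact mem_level.2 ⟨_, _, length_pre _ _, pathOk_pre (hE p.2) _, rfl⟩
    · have hm' : m = pre (N₀ + N) p.1 ++ pre 1 (dropSeq (N₀ + N) p.1) := by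
        rw [← pre_add, add_assoc, ← hm, hx, pre_app]
      rw [hm', ← hv] at hok
      exact ⟨pre 1 (dropSeq (N₀ + N) p.1), length_pre _ _, (pathOk_append.1 hok).2, by
        rw [hbm, nbhd, Raw.sub_sub, ← hm', hv]⟩
  exists_refines P hP := by
    obtain ⟨N, hN⟩ := exists_refines_level hW hP 0
    refine ⟨N, fun b hb => ?_⟩
    obtain ⟨v, m, hm, hok, hbm⟩ := mem_level.1 hb
    obtain ⟨a, ha, l, -, hl, he⟩ := hN v m (by omega) hok (hbm ▸ exists_mem_charts_supp b)
    exact ⟨a, ha, l.length, charts_desc.2 ⟨l, rfl, hl, hbm.trans he⟩⟩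

end FinDigraph

namespace FinDigraph

variable {Γ : FinDigraph} {E : Set (ℕ → Γ.E)} {W : Set Γ.V}

/-! ### The Thompson group as the group preserving the good charts -/

lemma RealizesCanonSim.act_eq (hE : E ⊆ Γ.shift) {g : Equiv.Perm ↥E} {α β : Γ.FinPath}
    (h : Γ.RealizesCanonSim E g α β) (he : Γ.pathEnd α = Γ.pathEnd β) (hα : Γ.cone α ⊆ E) :
    ((Raw.base E α.start).sub α.edges).act g = (Raw.base E β.start).sub β.edges := by
  have key : ∀ x ∈ Γ.Cn (Γ.pathEnd α), ∃ q : ↥E, q.1 = app α.edges x ∧ (g q).1 = app β.edges x := by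
    intro x hx
    have hc : app α.edges x ∈ Γ.cone α := mem_cone_iff.2 ⟨x, hx, rfl⟩
    exact ⟨⟨_, hα hc⟩, rfl, (h _ (hα hc) hc).trans (splice_app _ _ _)⟩
  refine Raw.ext he (funext fun x => Option.ext fun p => ?_)
  rw [Raw.act_eq_some]
  constructor
  · intro hp
    have hx := Raw.base_sub_mem_Cn hE α.ok hp
    obtain ⟨q, hq, hgq⟩ := key x hx
    have hqp : g q = p := by
      rw [← Equiv.Perm.eq_inv_iff_eq]
      exact Subtype.ext (hq.trans (Raw.base_sub_eq_some.1 hp).1.symm)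
    subst hqp
    refine Raw.base_sub_eq_some.2 ⟨hgq, ?_⟩
    rw [hgq]
    exact ((app_mem_Cn β.ok).2 (he ▸ hx : x ∈ Γ.Cn (Γ.pathEnd β))).2
  · intro hp
    have hx : x ∈ Γ.Cn (Γ.pathEnd α) := he ▸ Raw.base_sub_mem_Cn hE β.ok hp
    obtain ⟨q, hq, hgq⟩ := key x hx
    have hqp : g q = p := Subtype.ext (hgq.trans (Raw.base_sub_eq_some.1 hp).1.symm)
    rw [Equiv.Perm.inv_eq_iff_eq.2 hqp.symm]
    refine Raw.base_sub_eq_some.2 ⟨hq, ?_⟩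
    rw [hq]
    exact ((app_mem_Cn α.ok).2 hx).2

lemma RealizesCanonSim.symm {g : Equiv.Perm ↥E} {α β : Γ.FinPath}
    (h : Γ.RealizesCanonSim E g α β) (he : Γ.pathEnd α = Γ.pathEnd β) (hα : Γ.cone α ⊆ E) :
    Γ.RealizesCanonSim E g⁻¹ β α := by
  intro x hx hxβ
  obtain ⟨y, hy, rfl⟩ := mem_cone_iff.1 hxβ
  have hc : app α.edges y ∈ Γ.cone α := mem_cone_iff.2 ⟨y, he ▸ hy, rfl⟩
  have hg : ⟨_, hx⟩ = g ⟨_, hα hc⟩ :=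
    Subtype.ext ((h _ (hα hc) hc).trans (splice_app _ _ _)).symm
  rw [Equiv.Perm.inv_eq_iff_eq.2 hg, splice_app]

lemma IsThompson.inv {g : Equiv.Perm ↥E} (h : Γ.IsThompson E g) : Γ.IsThompson E g⁻¹ := by
  obtain ⟨k, α, β, he, hα, hα', hβ, hβ', hg⟩ := h
  refine ⟨k, β, α, fun i => (he i).symm, hβ, hβ', hα, hα', fun i => (hg i).symm (he i) ?_⟩
  exact (Set.subset_iUnion (fun i => Γ.cone (α i)) i).trans hα.superset

lemma IsThompson.good_act (hW : Γ.Core W) (hE : E ⊆ Γ.shift) {g : Equiv.Perm ↥E}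
    (h : Γ.IsThompson E g) {a : Γ.Raw E} (ha : a.Good W) : (a.act g).Good W := by
  obtain ⟨k, α, β, he, hα, -, -, -, hg⟩ := h
  refine ha.act ?_
  obtain ⟨n, hn⟩ := ha.tame.exists_deep (∑ i, (α i).edges.length)
  refine ⟨n, fun l hl hok => ?_⟩
  obtain ⟨v, m, hmok, hm, h⟩ := hn l hl hok
  have hgood := ha.sub hW hok
  rw [← Raw.act_sub]
  rw [h] at hgood ⊢
  obtain ⟨p, hp⟩ := hgood.im_nonempty hW
  obtain ⟨⟨x, hx⟩, hv⟩ := Raw.mem_base_im.1 hp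
  have hpα : p.1 ∈ ⋃ i, Γ.cone (α i) := hα.subset p.2
  obtain ⟨i, hi⟩ := Set.mem_iUnion.1 hpα
  obtain ⟨y, hy, hpy⟩ := mem_cone_iff.1 hi
  obtain ⟨r, rfl⟩ := exists_append_of_app_eq (hpy.symm.trans hx)
    ((Finset.single_le_sum (f := fun i => (α i).edges.length) (fun _ _ => Nat.zero_le _)
      (Finset.mem_univ i)).trans hm)
  have hsub : Γ.cone (α i) ⊆ E := by
    exact (Set.subset_iUnion (fun i => Γ.cone (α i)) i).trans hα.superset
  have hact := (hg i).act_eq hE (he i) hsub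
  obtain rfl : (α i).start = v := hi.2.1.symm.trans hv
  rw [← Raw.sub_sub, Raw.act_sub, hact]
  exact Raw.IsCone.sub ⟨_, _, (β i).ok, rfl⟩
    (he i ▸ (pathOk_append.1 hmok).2 : Γ.pathOk (Γ.pathEnd (β i)) r)

lemma exists_isCone_act (hW : Γ.Core W) {P : Finset (charts E hW).Ch}
    (hP : P ∈ (charts E hW).X) {g : Equiv.Perm ↥E} (hg : ∀ a ∈ P, (a.1.act g).Tame) :
    ∃ N, ∀ v m, N ≤ m.length → Γ.pathOk v m → ((Raw.base E v).sub m).im.Nonempty →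
      (((Raw.base E v).sub m).act g).IsCone := by
  choose! n hn using hg
  obtain ⟨N, hN⟩ := exists_refines_level hW hP (∑ a ∈ P, n a)
  refine ⟨N, fun v m hm hok hne => ?_⟩
  obtain ⟨a, ha, l, hl, hlok, h⟩ := hN v m hm hok hne
  rw [h, Raw.act_sub]
  exact hn a ha l ((Finset.single_le_sum (fun _ _ => Nat.zero_le _) ha).trans hl) hlok

lemma eq_iUnion_of_image {ι : Type*} {γ : ι → Set (ℕ → Γ.E)} {S : ι → Set ↥E}
    (h : ∀ i, Subtype.val '' S i = γ i) (hS : ⋃ i, S i = Set.univ) : E = ⋃ i, γ i := by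
  simp_rw [← h, ← Set.image_iUnion, hS, Set.image_univ, Subtype.range_val]

lemma pairwise_disjoint_of_image {ι : Type*} {γ : ι → Set (ℕ → Γ.E)} {S : ι → Set ↥E}
    (h : ∀ i, Subtype.val '' S i = γ i) (hS : Pairwise fun i j => Disjoint (S i) (S j)) :
    Pairwise fun i j => Disjoint (γ i) (γ j) := by
  intro i j hij
  rw [← h, ← h]
  exact Set.disjoint_image_of_injective Subtype.val_injective (hS hij)

lemma isThompson_of_tame (hW : Γ.Core W) {N₀ : ℕ} (h : Depth W E N₀) (hE : E ⊆ Γ.shift)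
    {g : Equiv.Perm ↥E} (hg : ∀ a : Γ.Raw E, a.Good W → (a.act g).Tame) : Γ.IsThompson E g := by
  obtain ⟨N, hN⟩ := exists_isCone_act hW (level_mem_X hW h hE le_rfl) fun a _ => hg a.1 a.2
  have hX := level_mem_X hW h hE (Nat.le_add_right N₀ N)
  have hα : ∀ a : level E hW (N₀ + N), ∃ α : Γ.FinPath,
      a.1.1 = (Raw.base E α.start).sub α.edges ∧ α.edges.length = N₀ + N := by
    rintro ⟨a, ha⟩
    obtain ⟨v, l, h1, h2, h3⟩ := mem_level.1 ha
    exact ⟨⟨v, l, h2⟩, h3, h1⟩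
  choose α hα hlen using hα
  have hβ : ∀ a : level E hW (N₀ + N), ∃ β : Γ.FinPath,
      a.1.1.act g = (Raw.base E β.start).sub β.edges := by
    intro a
    obtain ⟨v, l, h1, h2⟩ := hN (α a).start (α a).edges (by rw [hlen]; omega) (α a).ok
      (hα a ▸ a.1.2.im_nonempty hW)
    exact ⟨⟨v, l, h1⟩, (hα a).symm ▸ h2⟩
  choose β hβ using hβ
  let e := (level E hW (N₀ + N)).equivFin.symm
  have hcα : ∀ i, Subtype.val '' (e i).1.1.im = Γ.cone (α (e i)) := by
    intro i
    rw [hα]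
    exact Raw.image_im_eq_cone hE (hα (e i) ▸ (e i).1.2.total)
  have hcβ : ∀ i, Subtype.val '' ((e i).1.1.act g).im = Γ.cone (β (e i)) := by
    intro i
    rw [hβ]
    exact Raw.image_im_eq_cone hE (hβ (e i) ▸ (e i).1.2.total.act g)
  have hU : ⋃ i, (e i).1.1.im = Set.univ := by
    refine Set.eq_univ_of_forall fun p => ?_
    obtain ⟨a, ha, hp⟩ := ChartSystem.mem_Supp.1 (hX.2 ▸ Set.mem_univ p)
    exact Set.mem_iUnion.2 ⟨e.symm ⟨a, ha⟩, by rw [Equiv.apply_symm_apply]; exact hp⟩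
  have hD : Pairwise fun i j => Disjoint (e i).1.1.im (e j).1.1.im := fun i j hij =>
    hX.1 _ (e i).2 _ (e j).2 fun h => hij (e.injective (Subtype.ext h))
  refine ⟨_, fun i => α (e i), fun i => β (e i), fun i => ?_, eq_iUnion_of_image hcα hU,
    pairwise_disjoint_of_image hcα hD, eq_iUnion_of_image hcβ ?_,
    pairwise_disjoint_of_image hcβ fun i j hij => ?_, fun i x hx hxα => ?_⟩
  · exact (congrArg Raw.v (hα (e i))).symm.trans (congrArg Raw.v (hβ (e i)))
  · simp_rw [Raw.im_act, ← Set.image_iUnion, hU, Set.image_univ, g.surjective.range_eq]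
  · simp only [Raw.im_act]
    exact Set.disjoint_image_of_injective g.injective (hD hij)
  · rw [← hcα] at hxα
    obtain ⟨p, ⟨y, hy⟩, rfl⟩ := hxα
    have h1 := hy
    rw [hα, Raw.base_sub_eq_some] at h1
    have h2 : ((e i).1.1.act g).f y = some (g p) := congrArg (Option.map g) hy
    rw [hβ, Raw.base_sub_eq_some] at h2
    exact h2.1.trans (by rw [h1.1, splice_app])

variable (E W) in
/-- The group of permutations preserving the good charts. -/
def vGroup : Subgroup (Equiv.Perm ↥E) where
  carrier := {g | ∀ a : Γ.Raw E, a.Good W → (a.act g).Good W ∧ (a.act g⁻¹).Good W}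
  mul_mem' {g h} hg hh a ha := by
    rw [mul_inv_rev, Raw.act_mul, Raw.act_mul]
    exact ⟨(hg _ (hh a ha).1).1, (hh _ (hg a ha).2).2⟩
  one_mem' a ha := by
    rw [inv_one, Raw.act_one]
    exact ⟨ha, ha⟩
  inv_mem' {g} hg a ha := by
    rw [inv_inv]
    exact (hg a ha).symm

lemma coe_vGroup (hW : Γ.Core W) {N₀ : ℕ} (h : Depth W E N₀) (hE : E ⊆ Γ.shift) :
    (vGroup E W : Set (Equiv.Perm ↥E)) = {g | Γ.IsThompson E g} := by
  ext g
  constructor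
  · exact fun hg => isThompson_of_tame hW h hE fun a ha => (hg a ha).1.tame
  · exact fun hg a ha => ⟨hg.good_act hW hE ha, hg.inv.good_act hW hE ha⟩

instance (hW : Γ.Core W) : MulAction ↥(vGroup E W) (charts E hW).Pt where
  smul g p := g.1 p
  one_smul _ := rfl
  mul_smul _ _ _ := rfl

instance (hW : Γ.Core W) : MulAction ↥(vGroup E W) (charts E hW).Ch where
  smul g a := ⟨a.1.act g.1, (g.2 a.1 a.2).1⟩
  one_smul a := Subtype.ext (Raw.act_one a.1)
  mul_smul g h a := Subtype.ext (Raw.act_mul g.1 h.1 a.1)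

end FinDigraph

namespace FinDigraph

variable {Γ : FinDigraph} {E : Set (ℕ → Γ.E)} {W : Set Γ.V}

lemma tame_act (hW : Γ.Core W) {P : Finset (charts E hW).Ch} (hP : P ∈ (charts E hW).X)
    {g : Equiv.Perm ↥E} (hg : ∀ a ∈ P, (a.1.act g).Tame) {c : Γ.Raw E} (hc : c.Good W) :
    (c.act g).Tame := by
  obtain ⟨N, hN⟩ := exists_isCone_act hW hP hg
  obtain ⟨n, hn⟩ := hc.tame.exists_deep N
  refine ⟨n, fun l hl hok => ?_⟩
  obtain ⟨v, m, hm, hlen, h⟩ := hn l hl hok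
  rw [← Raw.act_sub, h]
  exact hN v m hlen hm (h ▸ (hc.sub hW hok).im_nonempty hW)

/-- In a subdivision, each point has unique coordinates. -/
lemma coordinates_unique {hW : Γ.Core W} {P : Finset (charts E hW).Ch}
    (hP : P ∈ (charts E hW).X) {a b : (charts E hW).Ch} (ha : a ∈ P) (hb : b ∈ P)
    {x y : ℕ → Γ.E} {p : ↥E} (hx : a.1.f x = some p) (hy : b.1.f y = some p) :
    a = b ∧ x = y := by
  have hab : a = b := by
    by_contra hne
    exact Set.disjoint_left.1 (hP.1 a ha b hb hne) (⟨x, hx⟩ : p ∈ a.1.im) ⟨y, hy⟩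
  subst hab
  exact ⟨rfl, a.2.inj _ _ _ hx hy⟩

lemma exists_map_of_matching {hW : Γ.Core W} {P : Finset (charts E hW).Ch}
    (hP : P ∈ (charts E hW).X) {Q : Finset (charts E hW).Ch} (φ : P → Q)
    (hφ : ∀ a, (φ a).1.1.v = a.1.1.v) :
    ∃ F : ↥E → ↥E, ∀ (a : P) x p, a.1.1.f x = some p → (φ a).1.1.f x = some (F p) := by
  have h1 : ∀ p : ↥E, ∃ (a : P) (x : ℕ → Γ.E) (q : ↥E),
      a.1.1.f x = some p ∧ (φ a).1.1.f x = some q := by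
    intro p
    obtain ⟨a, ha, x, hx⟩ := ChartSystem.mem_Supp.1 (hP.2 ▸ Set.mem_univ p)
    obtain ⟨q, hq⟩ := ((φ ⟨a, ha⟩).1.2.total x).1 (by
      rw [hφ]; exact (a.2.total x).2 ⟨p, hx⟩)
    exact ⟨⟨a, ha⟩, x, q, hx, hq⟩
  choose a x F hx hF using h1
  refine ⟨F, fun b y p hy => ?_⟩
  obtain ⟨hab, hxy⟩ := coordinates_unique hP (a p).2 b.2 (hx p) hy
  rw [← Subtype.ext hab, ← hxy]
  exact hF p

lemma exists_perm_of_matching {hW : Γ.Core W} {P Q : Finset (charts E hW).Ch}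
    (hP : P ∈ (charts E hW).X) (hQ : Q ∈ (charts E hW).X) (φ : P ≃ Q)
    (hφ : ∀ a, (φ a).1.1.v = a.1.1.v) :
    ∃ g : Equiv.Perm ↥E, ∀ a, a.1.1.act g = (φ a).1.1 := by
  have hφ' : ∀ b, (φ.symm b).1.1.v = b.1.1.v := fun b => by
    rw [← hφ, Equiv.apply_symm_apply]
  obtain ⟨F, hF⟩ := exists_map_of_matching hP φ hφ
  obtain ⟨G, hG⟩ := exists_map_of_matching hQ φ.symm hφ'
  have hGF : ∀ p, G (F p) = p := by
    intro p
    obtain ⟨a, ha, x, hx⟩ := ChartSystem.mem_Supp.1 (hP.2 ▸ Set.mem_univ p)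
    have := hG _ _ _ (hF ⟨a, ha⟩ x p hx)
    rw [Equiv.symm_apply_apply] at this
    exact Option.some_injective _ (this.symm.trans hx)
  have hFG : ∀ p, F (G p) = p := by
    intro p
    obtain ⟨a, ha, x, hx⟩ := ChartSystem.mem_Supp.1 (hQ.2 ▸ Set.mem_univ p)
    have := hF _ _ _ (hG ⟨a, ha⟩ x p hx)
    rw [Equiv.apply_symm_apply] at this
    exact Option.some_injective _ (this.symm.trans hx)
  refine ⟨⟨F, G, hGF, hFG⟩, fun a => Raw.ext (hφ a).symm (funext fun x => ?_)⟩
  rcases hx : a.1.1.f x with _ | p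
  · have : (φ a).1.1.f x = none := by
      rw [Option.eq_none_iff_forall_ne_some]
      intro q hq
      obtain ⟨p, hp⟩ := (a.1.2.total x).1 (hφ a ▸ ((φ a).1.2.total x).2 ⟨q, hq⟩)
      rw [hx] at hp
      exact Option.some_ne_none p hp.symm
    rw [this]
    exact congrArg (Option.map F) hx
  · exact (congrArg (Option.map F) hx).trans (hF a x p hx).symm

lemma charts_acts (hW : Γ.Core W) : (charts E hW).Acts ↥(vGroup E W) where
  supp_smul g a := Raw.im_act g.1 a.1
  kids_smul g a := by
    ext b
    rw [mem_charts_kids, Finset.mem_smul_finset]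
    constructor
    · rintro ⟨e, he, hb⟩
      exact ⟨⟨a.1.sub [e], a.2.sub hW ⟨he, trivial⟩⟩, mem_charts_kids.2 ⟨e, he, rfl⟩,
        Subtype.ext hb.symm⟩
    · rintro ⟨k, hk, rfl⟩
      obtain ⟨e, he, hk⟩ := mem_charts_kids.1 hk
      exact ⟨e, he, congrArg (Raw.act g.1) hk⟩
  transitive P hP Q hQ h := by
    have h' : (Finset.univ : Finset ↥P).val.map (fun a => (charts E hW).ty a.1) =
        (Finset.univ : Finset ↥Q).val.map (fun a => (charts E hW).ty a.1) := by
      rw [Finset.univ_eq_attach, Finset.attach_val, Finset.univ_eq_attach, Finset.attach_val]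
      exact (Multiset.attach_map_val' P.val _).trans
        (h.trans (Multiset.attach_map_val' Q.val _).symm)
    obtain ⟨φ, hφ⟩ := exists_equiv_of_map_eq h'
    obtain ⟨g, hg⟩ := exists_perm_of_matching hP hQ φ fun a => congrArg Subtype.val (hφ a)
    have hg' : ∀ b, b.1.1.act g⁻¹ = (φ.symm b).1.1 := by
      intro b
      rw [← φ.apply_symm_apply b, ← hg, ← Raw.act_mul, inv_mul_cancel, Raw.act_one,
        Equiv.symm_apply_apply]
    have hmem : g ∈ vGroup E W := by
      refine fun c hc => ⟨hc.act (tame_act hW hP (fun a ha => ?_) hc),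
        hc.act (tame_act hW hQ (fun b hb => ?_) hc)⟩
      · exact hg ⟨a, ha⟩ ▸ (φ ⟨a, ha⟩).1.2.tame
      · exact hg' ⟨b, hb⟩ ▸ (φ.symm ⟨b, hb⟩).1.2.tame
    refine ⟨⟨g, hmem⟩, ?_⟩
    have hsmul : ∀ a, (⟨g, hmem⟩ : ↥(vGroup E W)) • a.1 = (φ a).1 := fun a => Subtype.ext (hg a)
    ext b
    rw [Finset.mem_smul_finset]
    constructor
    · rintro ⟨a, ha, rfl⟩
      exact hsmul ⟨a, ha⟩ ▸ (φ ⟨a, ha⟩).2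
    · intro hb
      exact ⟨(φ.symm ⟨b, hb⟩).1, (φ.symm ⟨b, hb⟩).2, by rw [hsmul, Equiv.apply_symm_apply]⟩
  finite_stab P hP Q hQ := by
    refine Set.Finite.of_injOn (f := fun (g : ↥(vGroup E W)) (a : ↥P) => g • a.1)
      (t := {f | ∀ a, f a ∈ (Q : Set (charts E hW).Ch)}) ?_ ?_
      (Set.Finite.pi' fun _ => Q.finite_toSet)
    · rintro g rfl a
      exact Finset.smul_mem_smul_finset a.2
    · intro g _ g' _ h
      refine Subtype.ext (Equiv.ext fun p => ?_)
      obtain ⟨a, ha, x, hx⟩ := ChartSystem.mem_Supp.1 (hP.2 ▸ Set.mem_univ p)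
      have h1 : a.1.act g.1 = a.1.act g'.1 := congrArg Subtype.val (congrFun h ⟨a, ha⟩)
      have h2 := congrArg (fun c => c.f x) h1
      have h3 : some (g.1 p) = some (g'.1 p) :=
        (congrArg (Option.map g.1) hx).symm.trans (h2.trans (congrArg (Option.map g'.1) hx))
      exact Option.some_injective _ h3

end FinDigraph

namespace FinDigraph

variable {Γ : FinDigraph} {E : Set (ℕ → Γ.E)}

lemma isClosed_shift : IsClosed Γ.shift := by
  have : Γ.shift = ⋂ i, {x : ℕ → Γ.E | Γ.t (x i) = Γ.o (x (i + 1))} := by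
    ext x; simp [shift]
  rw [this]
  refine isClosed_iInter fun i => ?_
  have hc : Continuous fun x : ℕ → Γ.E => (x i, x (i + 1)) := by fun_prop
  exact (isClosed_discrete {q : Γ.E × Γ.E | Γ.t q.1 = Γ.o q.2}).preimage hc

/-- Membership in a clopen set is determined by finitely many coordinates. -/
lemma ClopenIn.exists_bound (h : Γ.ClopenIn E) :
    ∃ n, ∀ x ∈ E, x ∈ Γ.shift → ∀ y ∈ Γ.shift, (∀ i < n, x i = y i) → y ∈ E := by
  have : CompactSpace ↥Γ.shift := isCompact_iff_compactSpace.1 isClosed_shift.isCompact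
  let D : ℕ → Set (↥Γ.shift × ↥Γ.shift) := fun n =>
    {q | q.1.1 ∈ E ∧ q.2.1 ∉ E ∧ ∀ i < n, q.1.1 i = q.2.1 i}
  have hD : ∀ n, IsClosed (D n) := by
    intro n
    have hi : IsClosed {q : ↥Γ.shift × ↥Γ.shift | ∀ i < n, q.1.1 i = q.2.1 i} := by
      simp only [Set.ofPred_forall]
      exact isClosed_biInter fun i _ => isClosed_eq
        ((continuous_apply i).comp (continuous_subtype_val.comp continuous_fst))
        ((continuous_apply i).comp (continuous_subtype_val.comp continuous_snd))
    exact (h.isClosed.preimage continuous_fst).inter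
      ((h.compl.isClosed.preimage continuous_snd).inter hi)
  by_contra! hne
  obtain ⟨q, hq⟩ := IsCompact.nonempty_iInter_of_sequence_nonempty_isCompact_isClosed D
    (fun n q hq => ⟨hq.1, hq.2.1, fun i hi => hq.2.2 i (by omega)⟩)
    (fun n => by
      obtain ⟨x, hx, hxs, y, hys, hxy, hy⟩ := hne n
      exact ⟨(⟨x, hxs⟩, ⟨y, hys⟩), hx, hy, hxy⟩)
    (hD 0).isCompact hD
  rw [Set.mem_iInter] at hq
  have : q.1.1 = q.2.1 := funext fun i => (hq (i + 1)).2.2 i (Nat.lt_succ_self i)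
  exact (hq 0).2.1 (this ▸ (hq 0).1)

lemma ClopenIn.exists_depth (h : Γ.ClopenIn E) (hE : E ⊆ Γ.shift) {W : Set Γ.V}
    (hW : ∃ N, ∀ x ∈ Γ.shift, ∀ n, N ≤ n → Γ.o (x n) ∈ W) : ∃ N₀, Depth W E N₀ := by
  obtain ⟨n, hn⟩ := h.exists_bound
  obtain ⟨N, hN⟩ := hW
  exact ⟨n + N, fun x hx y hy hxy _ => hn x hx (hE hx) y hy fun i hi => hxy i (by omega),
    fun x hx k hk => hN x hx k (by omega)⟩

end FinDigraph

/-- If `Σ_Γ` has an irreducible core and `E ⊆ Σ_Γ` is a nonempty clopen set, then the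
Thompson group `V_{Γ,E}` is finitely presented. -/
theorem thompson_group_finitely_presented (Γ : FinDigraph)
    (hcore : Γ.HasIrreducibleCore)
    (E : Set (ℕ → Γ.E)) (hEsub : E ⊆ Γ.shift) (hEne : E.Nonempty)
    (hEclopen : Γ.ClopenIn E) :
    ∃ V : Subgroup (Equiv.Perm ↥E),
      (V : Set (Equiv.Perm ↥E)) = {g | Γ.IsThompson E g} ∧
      FinitelyPresentedGroup ↥V := by
  obtain ⟨W, hW, hN⟩ := hcore.exists_core
  obtain ⟨N₀, h⟩ := hEclopen.exists_depth hEsub hN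
  exact ⟨FinDigraph.vGroup E W, FinDigraph.coe_vGroup hW h hEsub,
    (FinDigraph.charts_acts hW).finitelyPresentedGroup (FinDigraph.charts_cofinal hW h hEsub)
      (FinDigraph.charts_grows hW)⟩

end
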